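/- Let D ⊂ ℂ be a domain and let ρ : D → [-∞,∞) be a subharmonic function that is bounded from below and not constant. Let z₁⁰ ∈ D be a point for which there exists an open connected neighborhood U ⊂ D of z₁⁰ on which ρ is constant. Then ρ̃* ≡ ρ on U. -/

import Mathlib

open MeasureTheory Filter Metric Set

/-- `elog x` is `log x` with value `-∞` for `x ≤ 0`, as an extended real. -/
noncomputable def elog (x : ℝ) : EReal := if x ≤ 0 then ⊥ else ((Real.log x : ℝ) : EReal)

/-- The sub-mean value inequality over circles of closed discs contained in `Ω`, phrased via
continuous real-valued majorants of the (extended-real-valued) function on the circle. -/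
def SubmeanOn (u : ℂ → EReal) (Ω : Set ℂ) : Prop :=
  ∀ c : ℂ, ∀ r : ℝ, 0 < r → Metric.closedBall c r ⊆ Ω →
    ∀ φ : ℝ → ℝ, Continuous φ →
      (∀ θ : ℝ, u (c + r * Complex.exp (θ * Complex.I)) ≤ ((φ θ : ℝ) : EReal)) →
      u c ≤ (((2 * Real.pi)⁻¹ * ∫ θ in (0:ℝ)..(2 * Real.pi), φ θ : ℝ) : EReal)

/-- `u : Ω → [-∞, ∞)` is subharmonic on the open set `Ω ⊆ ℂ`: upper semicontinuous,
nowhere `+∞`, not identically `-∞` on any connected component, sub-mean value inequality. -/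
def SubharmonicOn (u : ℂ → EReal) (Ω : Set ℂ) : Prop :=
  IsOpen Ω ∧ UpperSemicontinuousOn u Ω ∧
  (∀ z ∈ Ω, u z ≠ ⊤) ∧
  (∀ z ∈ Ω, ∃ w ∈ connectedComponentIn Ω z, u w ≠ ⊥) ∧
  SubmeanOn u Ω

/-- A set `E ⊆ ℂ` is polar if some subharmonic function on an open set containing `E`
equals `-∞` on `E`. -/
def PolarSet (E : Set ℂ) : Prop :=
  ∃ Ω : Set ℂ, E ⊆ Ω ∧ ∃ u : ℂ → EReal, SubharmonicOn u Ω ∧ ∀ z ∈ E, u z = ⊥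

/-- The space of square-integrable holomorphic functions on `D`. -/
def L2h {E : Type*} [NormedAddCommGroup E] [NormedSpace ℂ E] [MeasureSpace E]
    (D : Set E) : Set (E → ℂ) :=
  {f | DifferentiableOn ℂ f D ∧ IntegrableOn (fun z => ‖f z‖ ^ 2) D volume}

/-- `D` is an `L²ₕ`-domain of holomorphy. -/
def IsL2hDomainOfHolomorphy {E : Type*} [NormedAddCommGroup E] [NormedSpace ℂ E]
    [MeasureSpace E] (D : Set E) : Prop :=
  ¬ ∃ D₀ D₁ : Set E, IsOpen D₀ ∧ IsConnected D₀ ∧ IsOpen D₁ ∧ IsConnected D₁ ∧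
      D₀ ⊆ D₁ ∩ D ∧ ¬ (D₁ ⊆ D) ∧
      ∀ f ∈ L2h D, ∃ g : E → ℂ, DifferentiableOn ℂ g D₁ ∧ Set.EqOn g f D₀

/-- The Hartogs domain `G_{D,ρ} = {(z₁,z₂) : z₁ ∈ D, |z₂| < e^{-ρ(z₁)}}`. -/
def hartogs (D : Set ℂ) (ρ : ℂ → EReal) : Set (ℂ × ℂ) :=
  {p | p.1 ∈ D ∧ elog ‖p.2‖ < - ρ p.1}

/-- `S(D)`: boundary points near which the complement of `D` is polar. -/
def polarS (D : Set ℂ) : Set ℂ :=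
  {z ∈ frontier D | ∃ U : Set ℂ, IsOpen U ∧ z ∈ U ∧ PolarSet (U \ D)}

/-- `fj` is the family of coefficients of a Hartogs expansion of `f` on `G_{D,ρ}`. -/
def HartogsExpansion (D : Set ℂ) (ρ : ℂ → EReal) (f : ℂ × ℂ → ℂ) (fj : ℕ → ℂ → ℂ) : Prop :=
  (∀ j, DifferentiableOn ℂ (fj j) D) ∧
  ∀ p ∈ hartogs D ρ, HasSum (fun j => fj j p.1 * p.2 ^ j) (f p)

/-- `ρ_f(z) = limsup_j (1/j) log |f_j(z)|` for coefficients `fj`. -/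
noncomputable def coeffGrowth (fj : ℕ → ℂ → ℂ) (z : ℂ) : EReal :=
  Filter.limsup (fun (j : ℕ) => ((((j : ℝ)⁻¹ : ℝ)) : EReal) * elog ‖fj j z‖) Filter.atTop

/-- The upper semicontinuous regularization `g*`. -/
noncomputable def uscReg (g : ℂ → EReal) (z : ℂ) : EReal := Filter.limsup g (nhds z)

/-- `ρ̃ = sup_{f ∈ L²ₕ(G_{D,ρ})} (ρ_f)*`. -/
noncomputable def rhoTilde (D : Set ℂ) (ρ : ℂ → EReal) (z : ℂ) : EReal :=
  ⨆ fj ∈ {fj : ℕ → ℂ → ℂ | ∃ f ∈ L2h (hartogs D ρ), HartogsExpansion D ρ f fj},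
    uscReg (coeffGrowth fj) z

/-- `D̂ = D ∪ {z ∈ S(D) : limsup_{D ∋ w → z} ρ(w) < ∞}`. -/
def DHat (D : Set ℂ) (ρ : ℂ → EReal) : Set ℂ :=
  D ∪ {z ∈ polarS D | Filter.limsup ρ (nhdsWithin z D) < ⊤}

open Classical in
/-- `ρ̂`, extending `ρ` to `D̂` by boundary limsups. -/
noncomputable def rhoHat (D : Set ℂ) (ρ : ℂ → EReal) (z : ℂ) : EReal :=
  if z ∈ D then ρ z else Filter.limsup ρ (nhdsWithin z D)

/-- `u` is plurisubharmonic on an open `Ω ⊆ ℂⁿ`. -/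
def PlurisubharmonicOn {n : ℕ} (u : (Fin n → ℂ) → EReal) (Ω : Set (Fin n → ℂ)) : Prop :=
  IsOpen Ω ∧ UpperSemicontinuousOn u Ω ∧
  (∀ z ∈ Ω, u z ≠ ⊤) ∧
  (∀ z ∈ Ω, ∃ w ∈ connectedComponentIn Ω z, u w ≠ ⊥) ∧
  ∀ a b : Fin n → ℂ, SubmeanOn (fun lam => u (a + lam • b)) {lam : ℂ | a + lam • b ∈ Ω}

/-- A set `E ⊆ ℂⁿ` is pluripolar. -/
def PluripolarSet {n : ℕ} (E : Set (Fin n → ℂ)) : Prop :=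
  ∃ Ω : Set (Fin n → ℂ), E ⊆ Ω ∧
    ∃ u : (Fin n → ℂ) → EReal, PlurisubharmonicOn u Ω ∧ ∀ z ∈ E, u z = ⊥

/-- `D ⊆ ℂⁿ` is pseudoconvex: it admits a plurisubharmonic exhaustion function. -/
def IsPseudoconvex {n : ℕ} (D : Set (Fin n → ℂ)) : Prop :=
  ∃ u : (Fin n → ℂ) → EReal, PlurisubharmonicOn u D ∧
    ∀ c : ℝ, IsCompact {z | z ∈ D ∧ u z ≤ (c : EReal)}

/-- `L²ₕ(D)` is infinite dimensional: arbitrarily many elements that are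
linearly independent as functions on `D`. -/
def L2hInfiniteDim {E : Type*} [NormedAddCommGroup E] [NormedSpace ℂ E] [MeasureSpace E]
    (D : Set E) : Prop :=
  ∀ N : ℕ, ∃ fs : Fin N → E → ℂ, (∀ i, fs i ∈ L2h D) ∧
    ∀ c : Fin N → ℂ, (∀ z ∈ D, ∑ i, c i * fs i z = 0) → c = 0

namespace HartogsL2

/-- Partial derivative in the real direction. -/
noncomputable def dx (f : ℂ → ℝ) (z : ℂ) : ℝ := fderiv ℝ f z 1

/-- Partial derivative in the imaginary direction. -/
noncomputable def dy (f : ℂ → ℝ) (z : ℂ) : ℝ := fderiv ℝ f z Complex.I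

/-- The Laplacian of a real function on `ℂ`. -/
noncomputable def lap (f : ℂ → ℝ) (z : ℂ) : ℝ := dx (dx f) z + dy (dy f) z

lemma contDiff_dx {f : ℂ → ℝ} {n m : WithTop ℕ∞} (hf : ContDiff ℝ n f) (h : m + 1 ≤ n) :
    ContDiff ℝ m (dx f) :=
  (hf.fderiv_right h).clm_apply contDiff_const

lemma contDiff_dy {f : ℂ → ℝ} {n m : WithTop ℕ∞} (hf : ContDiff ℝ n f) (h : m + 1 ≤ n) :
    ContDiff ℝ m (dy f) :=
  (hf.fderiv_right h).clm_apply contDiff_const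

lemma one_add_one_le_two : (1 : WithTop ℕ∞) + 1 ≤ 2 := by norm_num

lemma continuous_lap {f : ℂ → ℝ} (hf : ContDiff ℝ 2 f) : Continuous (lap f) := by
  have h0 : (0 : WithTop ℕ∞) + 1 ≤ 1 := by norm_num
  exact (contDiff_dx (contDiff_dx hf one_add_one_le_two) h0).continuous.add
    (contDiff_dy (contDiff_dy hf one_add_one_le_two) h0).continuous

lemma dx_dy_comm {f : ℂ → ℝ} (hf : ContDiff ℝ 2 f) (z : ℂ) : dx (dy f) z = dy (dx f) z := by
  have hs : IsSymmSndFDerivAt ℝ f z :=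
    hf.contDiffAt.isSymmSndFDerivAt (by simp)
  have hd : DifferentiableAt ℝ (fderiv ℝ f) z :=
    ((hf.fderiv_right (m := 1) one_add_one_le_two).differentiable (by norm_num)) z
  have e : ∀ v w : ℂ, fderiv ℝ (fun y => fderiv ℝ f y v) z w = fderiv ℝ (fderiv ℝ f) z w v := by
    intro v w
    rw [fderiv_clm_apply hd (by fun_prop)]
    simp
  show fderiv ℝ (fun y => fderiv ℝ f y Complex.I) z 1
    = fderiv ℝ (fun y => fderiv ℝ f y 1) z Complex.I
  rw [e, e]
  exact hs 1 Complex.I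

lemma hasCompactSupport_dx {f : ℂ → ℝ} (hf : HasCompactSupport f) : HasCompactSupport (dx f) :=
  (hf.fderiv ℝ).comp_left (g := fun L : ℂ →L[ℝ] ℝ => L 1) (by simp)

lemma hasCompactSupport_dy {f : ℂ → ℝ} (hf : HasCompactSupport f) : HasCompactSupport (dy f) :=
  (hf.fderiv ℝ).comp_left (g := fun L : ℂ →L[ℝ] ℝ => L Complex.I) (by simp)

lemma hasCompactSupport_lap {f : ℂ → ℝ} (hf : HasCompactSupport f) : HasCompactSupport (lap f) :=
  (hasCompactSupport_dx (hasCompactSupport_dx hf)).add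
    (hasCompactSupport_dy (hasCompactSupport_dy hf))

lemma integral_fderiv_apply_eq_zero {f : ℂ → ℝ} (hf : ContDiff ℝ 1 f) (hc : HasCompactSupport f)
    (v : ℂ) : ∫ z, fderiv ℝ f z v = 0 := by
  have hi : Integrable (fun z => fderiv ℝ f z v) :=
    ((hf.continuous_fderiv (by norm_num)).clm_apply
        continuous_const).integrable_of_hasCompactSupport
      ((hc.fderiv ℝ).comp_left (g := fun L : ℂ →L[ℝ] ℝ => L v) (by simp))
  have := integral_mul_fderiv_eq_neg_fderiv_mul_of_integrable (𝕜 := ℝ) (μ := (volume : Measure ℂ))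
    (f := fun _ : ℂ => (1 : ℝ)) (g := f) (v := v) (by simp) (by simpa using hi)
    (by simpa using hf.continuous.integrable_of_hasCompactSupport hc)
    (fun _ _ => by fun_prop) (fun x _ => hf.differentiable (by norm_num) x)
  simpa using this

/-- Green's second identity. -/
lemma integral_mul_lap {u η : ℂ → ℝ} (hu : ContDiff ℝ 2 u) (hη : ContDiff ℝ 2 η)
    (hc : HasCompactSupport η) : ∫ z, u z * lap η z = ∫ z, η z * lap u z := by
  have h0 : (0 : WithTop ℕ∞) + 1 ≤ 1 := by norm_num
  have hux := contDiff_dx hu one_add_one_le_two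
  have huy := contDiff_dy hu one_add_one_le_two
  have hηx := contDiff_dx hη one_add_one_le_two
  have hηy := contDiff_dy hη one_add_one_le_two
  have hu1 : ContDiff ℝ 1 u := hu.of_le (by norm_num)
  have hη1 : ContDiff ℝ 1 η := hη.of_le (by norm_num)
  have key : ∀ (a b : ℂ → ℝ), ContDiff ℝ 1 a → ContDiff ℝ 1 b → ∀ z v,
      fderiv ℝ (fun z => u z * a z - η z * b z) z v =
        u z * fderiv ℝ a z v + a z * fderiv ℝ u z v
          - (η z * fderiv ℝ b z v + b z * fderiv ℝ η z v) := by
    intro a b ha hb z v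
    have h1 := ((hu1.differentiable one_ne_zero z).hasFDerivAt.mul
      (ha.differentiable one_ne_zero z).hasFDerivAt).sub
      ((hη1.differentiable one_ne_zero z).hasFDerivAt.mul
      (hb.differentiable one_ne_zero z).hasFDerivAt)
    have h2 := h1.fderiv
    have : (fun z => u z * a z - η z * b z) = (u * a - η * b) := rfl
    rw [this, h2]
    simp
  have z1 := integral_fderiv_apply_eq_zero (f := fun z => u z * dx η z - η z * dx u z)
    ((hu1.mul hηx).sub (hη1.mul hux))
    ((hasCompactSupport_dx hc).mul_left.sub hc.mul_right) 1
  have z2 := integral_fderiv_apply_eq_zero (f := fun z => u z * dy η z - η z * dy u z)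
    ((hu1.mul hηy).sub (hη1.mul huy))
    ((hasCompactSupport_dy hc).mul_left.sub hc.mul_right) Complex.I
  have i1 : Integrable (fun z => u z * lap η z) :=
    (hu.continuous.mul (continuous_lap hη)).integrable_of_hasCompactSupport
      (hasCompactSupport_lap hc).mul_left
  have i2 : Integrable (fun z => η z * lap u z) :=
    (hη.continuous.mul (continuous_lap hu)).integrable_of_hasCompactSupport
      hc.mul_right
  have hI : ∀ (f : ℂ → ℝ) (v : ℂ), ContDiff ℝ 1 f → HasCompactSupport f →
      Integrable (fun z => fderiv ℝ f z v) := fun f v hf hc =>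
    ((hf.continuous_fderiv (by norm_num)).clm_apply
        continuous_const).integrable_of_hasCompactSupport
      ((hc.fderiv ℝ).comp_left (g := fun L : ℂ →L[ℝ] ℝ => L v) (by simp))
  have j1 := hI (fun z => u z * dx η z - η z * dx u z) 1 ((hu1.mul hηx).sub (hη1.mul hux))
    ((hasCompactSupport_dx hc).mul_left.sub hc.mul_right)
  have j2 := hI (fun z => u z * dy η z - η z * dy u z) Complex.I
    ((hu1.mul hηy).sub (hη1.mul huy))
    ((hasCompactSupport_dy hc).mul_left.sub hc.mul_right)
  have e : ∀ z, u z * lap η z - η z * lap u z =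
      fderiv ℝ (fun z => u z * dx η z - η z * dx u z) z 1
      + fderiv ℝ (fun z => u z * dy η z - η z * dy u z) z Complex.I := by
    intro z
    rw [key _ _ hηx hux, key _ _ hηy huy]
    simp only [lap, dx, dy]
    ring
  rw [← sub_eq_zero, ← integral_sub i1 i2, integral_congr_ae (Eventually.of_forall e),
    integral_add j1 j2, z1, z2, add_zero]

/-- The weighted `L²` a priori inequality for the `∂̄`-operator with weight `exp φ`. -/
lemma integral_lap_mul_le {p q φ : ℂ → ℝ} (hp : ContDiff ℝ 2 p) (hq : ContDiff ℝ 2 q)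
    (hφ : ContDiff ℝ 2 φ) (hpc : HasCompactSupport p) (hqc : HasCompactSupport q) :
    ∫ z, lap φ z * (p z ^ 2 + q z ^ 2) * Real.exp (φ z) ≤
      ∫ z, ((dx p z - dy q z) ^ 2 + (dy p z + dx q z) ^ 2) * Real.exp (φ z) := by
  have hpx := contDiff_dx hp one_add_one_le_two
  have hpy := contDiff_dy hp one_add_one_le_two
  have hqx := contDiff_dx hq one_add_one_le_two
  have hqy := contDiff_dy hq one_add_one_le_two
  have hφx := contDiff_dx hφ one_add_one_le_two
  have hφy := contDiff_dy hφ one_add_one_le_two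
  have hp1 : ContDiff ℝ 1 p := hp.of_le (by norm_num)
  have hq1 : ContDiff ℝ 1 q := hq.of_le (by norm_num)
  have hφ1 : ContDiff ℝ 1 φ := hφ.of_le (by norm_num)
  have key : ∀ (a b c : ℂ → ℝ), ContDiff ℝ 1 a → ContDiff ℝ 1 b → ContDiff ℝ 1 c → ∀ z v,
      fderiv ℝ (fun z => Real.exp (φ z) * (2 * (p z * a z - q z * b z)
          + c z * (p z * p z + q z * q z))) z v =
        Real.exp (φ z) * (fderiv ℝ φ z v * (2 * (p z * a z - q z * b z)
          + c z * (p z * p z + q z * q z))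
          + 2 * (fderiv ℝ p z v * a z + p z * fderiv ℝ a z v
            - (fderiv ℝ q z v * b z + q z * fderiv ℝ b z v))
          + (fderiv ℝ c z v * (p z * p z + q z * q z)
            + c z * (2 * p z * fderiv ℝ p z v + 2 * q z * fderiv ℝ q z v))) := by
    intro a b c ha hb hc z v
    have Hp := (hp1.differentiable one_ne_zero z).hasFDerivAt
    have Hq := (hq1.differentiable one_ne_zero z).hasFDerivAt
    have Hφ := (hφ1.differentiable one_ne_zero z).hasFDerivAt
    have Ha := (ha.differentiable one_ne_zero z).hasFDerivAt
    have Hb := (hb.differentiable one_ne_zero z).hasFDerivAt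
    have Hc := (hc.differentiable one_ne_zero z).hasFDerivAt
    have h1 := Hφ.exp.mul ((((Hp.mul Ha).sub (Hq.mul Hb)).const_mul 2).add
      (Hc.mul ((Hp.mul Hp).add (Hq.mul Hq))))
    have h2 := h1.fderiv
    have e : (fun z => Real.exp (φ z) * (2 * (p z * a z - q z * b z)
          + c z * (p z * p z + q z * q z))) = (fun x ↦ Real.exp (φ x)) *
        ((fun y ↦ 2 * (p * a - q * b) y) + c * (p * p + q * q)) := rfl
    rw [e, h2]
    simp
    ring
  have cs : ∀ (a b c : ℂ → ℝ), HasCompactSupport (fun z => Real.exp (φ z) *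
      (2 * (p z * a z - q z * b z) + c z * (p z * p z + q z * q z))) := by
    intro a b c
    refine HasCompactSupport.mul_left (HasCompactSupport.add ?_ ?_)
    · exact (HasCompactSupport.sub hpc.mul_right hqc.mul_right).mul_left
    · exact (HasCompactSupport.add hpc.mul_right hqc.mul_right).mul_left
  have cd : ∀ (a b c : ℂ → ℝ), ContDiff ℝ 1 a → ContDiff ℝ 1 b → ContDiff ℝ 1 c →
      ContDiff ℝ 1 (fun z => Real.exp (φ z) *
      (2 * (p z * a z - q z * b z) + c z * (p z * p z + q z * q z))) := by
    intro a b c ha hb hc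
    exact hφ1.exp.mul ((contDiff_const.mul ((hp1.mul ha).sub (hq1.mul hb))).add
      (hc.mul ((hp1.mul hp1).add (hq1.mul hq1))))
  have hI : ∀ (f : ℂ → ℝ) (v : ℂ), ContDiff ℝ 1 f → HasCompactSupport f →
      Integrable (fun z => fderiv ℝ f z v) := fun f v hf hc =>
    ((hf.continuous_fderiv (by norm_num)).clm_apply
        continuous_const).integrable_of_hasCompactSupport
      ((hc.fderiv ℝ).comp_left (g := fun L : ℂ →L[ℝ] ℝ => L v) (by simp))
  obtain ⟨P, hP⟩ : ∃ P : ℂ → ℝ, P = fun z => Real.exp (φ z) *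
      (2 * (p z * dy q z - q z * dy p z) + dx φ z * (p z * p z + q z * q z)) := ⟨_, rfl⟩
  obtain ⟨Q, hQ⟩ : ∃ Q : ℂ → ℝ, Q = fun z => Real.exp (φ z) *
      (2 * (p z * (-dx q) z - q z * (-dx p) z) + dy φ z * (p z * p z + q z * q z)) := ⟨_, rfl⟩
  have cdP : ContDiff ℝ 1 P := hP ▸ cd _ _ _ hqy hpy hφx
  have cdQ : ContDiff ℝ 1 Q := hQ ▸ cd (-dx q) (-dx p) _ hqx.neg hpx.neg hφy
  have csP : HasCompactSupport P := hP ▸ cs (dy q) (dy p) (dx φ)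
  have csQ : HasCompactSupport Q := hQ ▸ cs (-dx q) (-dx p) (dy φ)
  have zP := integral_fderiv_apply_eq_zero cdP csP 1
  have zQ := integral_fderiv_apply_eq_zero cdQ csQ Complex.I
  have iP := hI _ 1 cdP csP
  have iQ := hI _ Complex.I cdQ csQ
  have i1 : Integrable (fun z => lap φ z * (p z ^ 2 + q z ^ 2) * Real.exp (φ z)) := by
    refine Continuous.integrable_of_hasCompactSupport ?_ ?_
    · have := continuous_lap hφ
      have := hp.continuous
      have := hq.continuous
      have := hφ.continuous
      fun_prop
    · refine HasCompactSupport.mul_right (HasCompactSupport.mul_left ?_)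
      exact (hpc.comp_left (g := fun t => t ^ 2) (by simp)).add
        (hqc.comp_left (g := fun t => t ^ 2) (by simp))
  have i2 : Integrable (fun z => ((dx p z - dy q z) ^ 2 + (dy p z + dx q z) ^ 2)
      * Real.exp (φ z)) := by
    refine Continuous.integrable_of_hasCompactSupport ?_ ?_
    · have := hpx.continuous
      have := hqx.continuous
      have := hpy.continuous
      have := hqy.continuous
      have := hφ.continuous
      fun_prop
    · refine HasCompactSupport.mul_right ?_
      exact (((hasCompactSupport_dx hpc).sub (hasCompactSupport_dy hqc)).comp_left
        (g := fun t => t ^ 2) (by simp)).add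
        (((hasCompactSupport_dy hpc).add (hasCompactSupport_dx hqc)).comp_left
        (g := fun t => t ^ 2) (by simp))
  have step : ∫ z, lap φ z * (p z ^ 2 + q z ^ 2) * Real.exp (φ z) ≤
      ∫ z, (((dx p z - dy q z) ^ 2 + (dy p z + dx q z) ^ 2) * Real.exp (φ z)
        + (fderiv ℝ P z 1 + fderiv ℝ Q z Complex.I)) := by
    refine integral_mono i1 (i2.add (iP.add iQ)) fun z => ?_
    show _ ≤ _ + (_ + _)
    have kP := key _ _ _ hqy hpy hφx z 1
    have kQ := key (-dx q) (-dx p) _ hqx.neg hpx.neg hφy z Complex.I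
    rw [← hP] at kP
    rw [← hQ] at kQ
    rw [kP, kQ, ← sub_nonneg]
    have s1 : fderiv ℝ (dy p) z 1 = dy (dx p) z := dx_dy_comm hp z
    have s2 : fderiv ℝ (dy q) z 1 = dy (dx q) z := dx_dy_comm hq z
    have n1 : ∀ f : ℂ → ℝ, fderiv ℝ (-f) z Complex.I = - dy f z := by
      intro f; simp [dy, fderiv_neg]
    rw [n1, n1, s1, s2]
    have hdx : ∀ f : ℂ → ℝ, fderiv ℝ f z 1 = dx f z := fun _ => rfl
    have hdy : ∀ f : ℂ → ℝ, fderiv ℝ f z Complex.I = dy f z := fun _ => rfl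
    simp only [hdx, hdy, lap, Pi.neg_apply]
    have := mul_nonneg (Real.exp_pos (φ z)).le
      (add_nonneg (sq_nonneg (dx p z + dy q z + dx φ z * p z + dy φ z * q z))
        (sq_nonneg (dx q z - dy p z + dx φ z * q z - dy φ z * p z)))
    refine this.trans (le_of_eq ?_)
    ring
  refine step.trans (le_of_eq ?_)
  have iPQ : Integrable (fun z => fderiv ℝ P z 1 + fderiv ℝ Q z Complex.I) := iP.add iQ
  rw [integral_add i2 iPQ, integral_add iP iQ, zP, zQ]
  simp


section Convolution

variable {E : Type*} [NormedAddCommGroup E] [NormedSpace ℝ E]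

lemma continuous_integral_sub {μ : Measure ℂ} [IsFiniteMeasure μ] {F : ℂ → E} (hF : Continuous F)
    (hc : HasCompactSupport F) : Continuous fun z => ∫ y, F (z - y) ∂μ := by
  obtain ⟨C, hC⟩ := hF.bounded_above_of_compact_support hc
  refine continuous_of_dominated (bound := fun _ => C) (fun z => ?_)
    (fun z => Eventually.of_forall fun y => hC _) (integrable_const C)
    (Eventually.of_forall fun y => by fun_prop)
  exact (hF.comp (continuous_const.sub continuous_id)).aestronglyMeasurable

lemma hasFDerivAt_integral_sub {μ : Measure ℂ} [IsFiniteMeasure μ] {F : ℂ → E}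
    (hF : ContDiff ℝ 1 F) (hc : HasCompactSupport F) (z : ℂ) :
    HasFDerivAt (fun z => ∫ y, F (z - y) ∂μ) (∫ y, fderiv ℝ F (z - y) ∂μ) z := by
  have hF' := hF.continuous_fderiv one_ne_zero
  obtain ⟨C, hC⟩ := hF'.bounded_above_of_compact_support (hc.fderiv ℝ)
  obtain ⟨C0, hC0⟩ := hF.continuous.bounded_above_of_compact_support hc
  refine hasFDerivAt_integral_of_dominated_of_fderiv_le (F' := fun z y => fderiv ℝ F (z - y))
    (bound := fun _ => C) (s := univ) univ_mem
    (Eventually.of_forall fun z => ?_) ?_ ?_ (Eventually.of_forall fun y z _ => hC _)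
    (integrable_const C) (Eventually.of_forall fun y z _ => ?_)
  · exact (hF.continuous.comp (continuous_const.sub continuous_id)).aestronglyMeasurable
  · exact Integrable.of_bound
      (hF.continuous.comp (continuous_const.sub continuous_id)).aestronglyMeasurable C0
      (Eventually.of_forall fun y => hC0 _)
  · exact (hF'.comp (continuous_const.sub continuous_id)).aestronglyMeasurable
  · have := (hF.differentiable one_ne_zero (z - y)).hasFDerivAt.comp z
      ((hasFDerivAt_id z).sub_const y)
    simpa using! this

lemma contDiff_one_integral_sub {μ : Measure ℂ} [IsFiniteMeasure μ] {F : ℂ → E}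
    (hF : ContDiff ℝ 1 F) (hc : HasCompactSupport F) :
    ContDiff ℝ 1 fun z => ∫ y, F (z - y) ∂μ := by
  refine contDiff_one_iff_fderiv.2
      ⟨fun z => (hasFDerivAt_integral_sub hF hc z).differentiableAt, ?_⟩
  have : fderiv ℝ (fun z => ∫ y, F (z - y) ∂μ) = fun z => ∫ y, fderiv ℝ F (z - y) ∂μ :=
    funext fun z => (hasFDerivAt_integral_sub hF hc z).fderiv
  rw [this]
  exact continuous_integral_sub (hF.continuous_fderiv one_ne_zero) (hc.fderiv ℝ)

lemma contDiff_two_integral_sub {μ : Measure ℂ} [IsFiniteMeasure μ] {F : ℂ → E}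
    (hF : ContDiff ℝ 2 F) (hc : HasCompactSupport F) :
    ContDiff ℝ 2 fun z => ∫ y, F (z - y) ∂μ := by
  have hF1 : ContDiff ℝ 1 F := hF.of_le (by norm_num)
  have e : (2 : WithTop ℕ∞) = 1 + 1 := by norm_num
  rw [e, contDiff_succ_iff_fderiv]
  refine ⟨fun z => (hasFDerivAt_integral_sub hF1 hc z).differentiableAt, by simp, ?_⟩
  have : fderiv ℝ (fun z => ∫ y, F (z - y) ∂μ) = fun z => ∫ y, fderiv ℝ F (z - y) ∂μ :=
    funext fun z => (hasFDerivAt_integral_sub hF1 hc z).fderiv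
  rw [this]
  exact contDiff_one_integral_sub (hF.fderiv_right one_add_one_le_two) (hc.fderiv ℝ)

end Convolution

lemma fderiv_integral_sub_apply {μ : Measure ℂ} [IsFiniteMeasure μ] {F : ℂ → ℝ}
    (hF : ContDiff ℝ 1 F) (hc : HasCompactSupport F) (z v : ℂ) :
    fderiv ℝ (fun z => ∫ y, F (z - y) ∂μ) z v = ∫ y, fderiv ℝ F (z - y) v ∂μ := by
  have hF' := hF.continuous_fderiv one_ne_zero
  obtain ⟨C, hC⟩ := hF'.bounded_above_of_compact_support (hc.fderiv ℝ)
  rw [(hasFDerivAt_integral_sub hF hc z).fderiv, ContinuousLinearMap.integral_apply]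
  exact Integrable.of_bound
    (hF'.comp (continuous_const.sub continuous_id)).aestronglyMeasurable C
    (Eventually.of_forall fun y => hC _)

lemma lap_integral_sub {μ : Measure ℂ} [IsFiniteMeasure μ] {F : ℂ → ℝ}
    (hF : ContDiff ℝ 2 F) (hc : HasCompactSupport F) (z : ℂ) :
    lap (fun z => ∫ y, F (z - y) ∂μ) z = ∫ y, lap F (z - y) ∂μ := by
  have hF1 : ContDiff ℝ 1 F := hF.of_le (by norm_num)
  have h1 : dx (fun z => ∫ y, F (z - y) ∂μ) = fun z => ∫ y, dx F (z - y) ∂μ :=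
    funext fun z => fderiv_integral_sub_apply hF1 hc z 1
  have h2 : dy (fun z => ∫ y, F (z - y) ∂μ) = fun z => ∫ y, dy F (z - y) ∂μ :=
    funext fun z => fderiv_integral_sub_apply hF1 hc z Complex.I
  have hx := contDiff_dx hF one_add_one_le_two
  have hy := contDiff_dy hF one_add_one_le_two
  have cx := hasCompactSupport_dx hc
  have cy := hasCompactSupport_dy hc
  have i : ∀ G : ℂ → ℝ, Continuous G → HasCompactSupport G →
      Integrable (fun y => G (z - y)) μ := by
    intro G hG hGc
    obtain ⟨C, hC⟩ := hG.bounded_above_of_compact_support hGc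
    exact Integrable.of_bound
      (hG.comp (continuous_const.sub continuous_id)).aestronglyMeasurable C
      (Eventually.of_forall fun y => hC _)
  have e1 : dx (fun z => ∫ y, dx F (z - y) ∂μ) z = ∫ y, dx (dx F) (z - y) ∂μ :=
    fderiv_integral_sub_apply hx cx z 1
  have e2 : dy (fun z => ∫ y, dy F (z - y) ∂μ) z = ∫ y, dy (dy F) (z - y) ∂μ :=
    fderiv_integral_sub_apply hy cy z Complex.I
  rw [lap, h1, h2, e1, e2, ← integral_add]
  · rfl
  · exact i _ (contDiff_dx hx (m := 0) (by norm_num)).continuous (hasCompactSupport_dx cx)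
  · exact i _ (contDiff_dy hy (m := 0) (by norm_num)).continuous (hasCompactSupport_dy cy)

/-- Powers of the positive part are differentiable. -/
lemma hasDerivAt_max_pow (n : ℕ) (t : ℝ) :
    HasDerivAt (fun t : ℝ => max t 0 ^ (n + 2)) ((n + 2) * max t 0 ^ (n + 1)) t := by
  rcases lt_trichotomy t 0 with h | h | h
  · have : (fun t : ℝ => max t 0 ^ (n + 2)) =ᶠ[nhds t] fun _ => 0 := by
      filter_upwards [Iio_mem_nhds h] with s hs
      rw [max_eq_right (le_of_lt hs)]; simp
    rw [max_eq_right h.le]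
    simpa using (hasDerivAt_const t (0 : ℝ)).congr_of_eventuallyEq this
  · subst h
    simp only [max_self, ne_eq, Nat.add_eq_zero_iff, one_ne_zero, and_false, not_false_eq_true,
      zero_pow, mul_zero]
    have hl : HasDerivWithinAt (fun t : ℝ => max t 0 ^ (n + 2)) 0 (Iic 0) 0 := by
      refine (hasDerivWithinAt_const (0 : ℝ) (Iic 0) (0 : ℝ)).congr (fun s hs => ?_) (by simp)
      rw [max_eq_right hs]; simp
    have hr : HasDerivWithinAt (fun t : ℝ => max t 0 ^ (n + 2)) 0 (Ici 0) 0 := by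
      have := (hasDerivAt_pow (n + 2) (0 : ℝ)).hasDerivWithinAt (s := Ici 0)
      have h0 : (0:ℝ) ^ (n + 2 - 1) = 0 := by rw [show n + 2 - 1 = n + 1 by omega]; simp
      rw [h0, mul_zero] at this
      refine this.congr (fun s hs => ?_) (by simp)
      rw [max_eq_left hs]
    have := hl.union hr
    rwa [Iic_union_Ici, hasDerivWithinAt_univ] at this
  · have : (fun t : ℝ => max t 0 ^ (n + 2)) =ᶠ[nhds t] fun t => t ^ (n + 2) := by
      filter_upwards [Ioi_mem_nhds h] with s hs
      rw [max_eq_left (le_of_lt hs)]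
    rw [max_eq_left h.le]
    have h2 := (hasDerivAt_pow (n + 2) t).congr_of_eventuallyEq this
    simpa using h2

lemma contDiff_max_pow : ∀ n : ℕ, ContDiff ℝ n (fun t : ℝ => max t 0 ^ (n + 1))
  | 0 => by
    simp only [zero_add, pow_one, Nat.cast_zero, contDiff_zero]
    fun_prop
  | n + 1 => by
    have e : ((n + 1 : ℕ) : WithTop ℕ∞) = (n : WithTop ℕ∞) + 1 := by push_cast; rfl
    rw [e, contDiff_succ_iff_deriv]
    refine ⟨fun t => (hasDerivAt_max_pow n t).differentiableAt, by simp, ?_⟩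
    have : deriv (fun t : ℝ => max t 0 ^ (n + 1 + 1)) = fun t => ((n : ℝ) + 2) * max t 0 ^ (n + 1)
        :=
      funext fun t => (hasDerivAt_max_pow n t).deriv
    rw [this]
    exact contDiff_const.mul (contDiff_max_pow n)


/-- The squared distance to `w`, shifted by `τ`. -/
def sqd (w : ℂ) (τ : ℝ) (z : ℂ) : ℝ := (z.re - w.re) ^ 2 + (z.im - w.im) ^ 2 + τ

lemma sqd_eq (w : ℂ) (τ : ℝ) (z : ℂ) : sqd w τ z = ‖z - w‖ ^ 2 + τ := by
  rw [sqd, ← Complex.normSq_eq_norm_sq, Complex.normSq_apply]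
  simp only [Complex.sub_re, Complex.sub_im]; ring

lemma contDiff_sqd (w : ℂ) (τ : ℝ) {n : WithTop ℕ∞} : ContDiff ℝ n (sqd w τ) := by
  have h1 : ContDiff ℝ n fun z : ℂ => z.re := Complex.reCLM.contDiff
  have h2 : ContDiff ℝ n fun z : ℂ => z.im := Complex.imCLM.contDiff
  exact (((h1.sub contDiff_const).pow 2).add ((h2.sub contDiff_const).pow 2)).add contDiff_const

lemma hasFDerivAt_sqd (w : ℂ) (τ : ℝ) (z : ℂ) :
    HasFDerivAt (sqd w τ) ((2 * (z.re - w.re)) • Complex.reCLM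
      + (2 * (z.im - w.im)) • Complex.imCLM) z := by
  have h1 : HasFDerivAt (fun z : ℂ => z.re - w.re) Complex.reCLM z :=
    Complex.reCLM.hasFDerivAt.sub_const _
  have h2 : HasFDerivAt (fun z : ℂ => z.im - w.im) Complex.imCLM z :=
    Complex.imCLM.hasFDerivAt.sub_const _
  have := ((h1.pow 2).add (h2.pow 2)).add_const τ
  refine this.congr_fderiv ?_
  ext; simp

lemma dx_radial {h : ℝ → ℝ} {h' : ℝ} {w z : ℂ} {τ : ℝ} (hh : HasDerivAt h h' (sqd w τ z)) :
    dx (fun z => h (sqd w τ z)) z = 2 * (z.re - w.re) * h' := by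
  have := hh.comp_hasFDerivAt z (hasFDerivAt_sqd w τ z)
  rw [dx, HasFDerivAt.fderiv (f := fun z => h (sqd w τ z)) this]
  simp; ring

lemma dy_radial {h : ℝ → ℝ} {h' : ℝ} {w z : ℂ} {τ : ℝ} (hh : HasDerivAt h h' (sqd w τ z)) :
    dy (fun z => h (sqd w τ z)) z = 2 * (z.im - w.im) * h' := by
  have := hh.comp_hasFDerivAt z (hasFDerivAt_sqd w τ z)
  rw [dy, HasFDerivAt.fderiv (f := fun z => h (sqd w τ z)) this]
  simp; ring

lemma lap_radial {h h' : ℝ → ℝ} {h'' : ℝ} {w z : ℂ} {τ : ℝ}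
    (hh : ∀ᶠ y in nhds z, HasDerivAt h (h' (sqd w τ y)) (sqd w τ y))
    (hh' : HasDerivAt h' h'' (sqd w τ z)) :
    lap (fun z => h (sqd w τ z)) z
      = 4 * h' (sqd w τ z) + 4 * (sqd w τ z - τ) * h'' := by
  have hs := hh'.comp_hasFDerivAt z (hasFDerivAt_sqd w τ z)
  have h1 : dx (fun z => h (sqd w τ z)) =ᶠ[nhds z] fun y => (2 * (y.re - w.re)) * h' (sqd w τ y) :=
    hh.mono fun y hy => dx_radial hy
  have h2 : dy (fun z => h (sqd w τ z)) =ᶠ[nhds z] fun y => (2 * (y.im - w.im)) * h' (sqd w τ y) :=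
    hh.mono fun y hy => dy_radial hy
  have k1 : HasFDerivAt (fun z : ℂ => 2 * (z.re - w.re)) ((2 : ℝ) • Complex.reCLM) z :=
    (Complex.reCLM.hasFDerivAt.sub_const _).const_mul 2
  have k2 : HasFDerivAt (fun z : ℂ => 2 * (z.im - w.im)) ((2 : ℝ) • Complex.imCLM) z :=
    (Complex.imCLM.hasFDerivAt.sub_const _).const_mul 2
  have e1 := h1.fderiv_eq (𝕜 := ℝ)
  have e2 := h2.fderiv_eq (𝕜 := ℝ)
  rw [HasFDerivAt.fderiv (f := fun y : ℂ => (2 * (y.re - w.re)) * h' (sqd w τ y)) (k1.mul hs)] at e1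
  rw [HasFDerivAt.fderiv (f := fun y : ℂ => (2 * (y.im - w.im)) * h' (sqd w τ y)) (k2.mul hs)] at e2
  simp only [lap]
  rw [dx, e1, dy, e2]
  simp [sqd]; ring

/-- The kernel `(1 - |x|²)₊⁴`. -/
noncomputable def kerB (x : ℂ) : ℝ := max (1 - sqd 0 0 x) 0 ^ 4

/-- The averaging kernel `8 (1 - |x|²)₊³`. -/
noncomputable def kerW (x : ℂ) : ℝ := 8 * max (1 - sqd 0 0 x) 0 ^ 3

lemma kerB_nonneg (x : ℂ) : 0 ≤ kerB x := by unfold kerB; positivity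
lemma kerW_nonneg (x : ℂ) : 0 ≤ kerW x := by unfold kerW; positivity

lemma contDiff_kerW : ContDiff ℝ 2 kerW :=
  contDiff_const.mul ((contDiff_max_pow 2).comp (contDiff_const.sub (contDiff_sqd 0 0)))

lemma contDiff_kerB : ContDiff ℝ 2 kerB :=
  ((contDiff_max_pow 3).comp (contDiff_const.sub (contDiff_sqd 0 0))).of_le (by norm_num)

lemma max_eq_zero_of_one_lt {x : ℂ} (hx : 1 ≤ ‖x‖) : max (1 - sqd 0 0 x) 0 = 0 := by
  rw [sqd_eq]; simp; exact hx

lemma kerB_eq_zero {x : ℂ} (hx : 1 ≤ ‖x‖) : kerB x = 0 := by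
  rw [kerB, max_eq_zero_of_one_lt hx]; norm_num
lemma kerW_eq_zero {x : ℂ} (hx : 1 ≤ ‖x‖) : kerW x = 0 := by
  rw [kerW, max_eq_zero_of_one_lt hx]; norm_num

lemma hasCompactSupport_of_eq_zero {E : Type*} [Zero E] {f : ℂ → E} {r : ℝ}
    (h : ∀ x : ℂ, r ≤ ‖x‖ → f x = 0) : HasCompactSupport f :=
  HasCompactSupport.intro (isCompact_closedBall 0 r) fun x hx => h x (by
    simp at hx; exact hx.le)

lemma hasCompactSupport_kerB : HasCompactSupport kerB :=
  hasCompactSupport_of_eq_zero fun _ => kerB_eq_zero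
lemma hasCompactSupport_kerW : HasCompactSupport kerW :=
  hasCompactSupport_of_eq_zero fun _ => kerW_eq_zero

lemma kerW_neg (x : ℂ) : kerW (-x) = kerW x := by simp [kerW, sqd_eq]

lemma kerW_pos {x : ℂ} (hx : ‖x‖ < 1) : 0 < kerW x := by
  have : 0 < 1 - sqd 0 0 x := by
    rw [sqd_eq]; simp; exact hx
  rw [kerW, max_eq_left this.le]; positivity

lemma integral_kerW_pos : 0 < ∫ x, kerW x := by
  rw [integral_pos_iff_support_of_nonneg kerW_nonneg
    (contDiff_kerW.continuous.integrable_of_hasCompactSupport hasCompactSupport_kerW)]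
  refine lt_of_lt_of_le (measure_ball_pos volume (0 : ℂ) one_pos) (measure_mono fun x hx => ?_)
  exact (kerW_pos (by simpa using hx)).ne'

lemma integral_kerB_pos : 0 < ∫ x, kerB x := by
  rw [integral_pos_iff_support_of_nonneg kerB_nonneg
    (contDiff_kerB.continuous.integrable_of_hasCompactSupport hasCompactSupport_kerB)]
  refine lt_of_lt_of_le (measure_ball_pos volume (0 : ℂ) one_pos) (measure_mono fun x hx => ?_)
  have : 0 < 1 - sqd 0 0 x := by
    rw [sqd_eq]; simpa using hx
  show max (1 - sqd 0 0 x) 0 ^ 4 ≠ 0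
  rw [max_eq_left this.le]; positivity

lemma dx_kerB (x : ℂ) : dx kerB x = - x.re * kerW x := by
  have h := (hasDerivAt_max_pow 2 (1 - sqd 0 0 x)).comp_const_sub (1 : ℝ) (sqd 0 0 x)
  have := dx_radial (h := fun t => max (1 - t) 0 ^ 4) (w := 0) (τ := 0) (z := x) h
  rw [show kerB = fun z => (fun t : ℝ => max (1 - t) 0 ^ 4) (sqd 0 0 z) from rfl, this, kerW]
  simp; ring

lemma dy_kerB (x : ℂ) : dy kerB x = - x.im * kerW x := by
  have h := (hasDerivAt_max_pow 2 (1 - sqd 0 0 x)).comp_const_sub (1 : ℝ) (sqd 0 0 x)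
  have := dy_radial (h := fun t => max (1 - t) 0 ^ 4) (w := 0) (τ := 0) (z := x) h
  rw [show kerB = fun z => (fun t : ℝ => max (1 - t) 0 ^ 4) (sqd 0 0 z) from rfl, this, kerW]
  simp; ring


lemma continuous_integral_mul_ker {X : Type*} [TopologicalSpace X] [FirstCountableTopology X]
    [LocallyCompactSpace X] {f : X → ℂ → ℝ} {k : ℂ → ℝ} (hf : Continuous f.uncurry)
    (hk : Continuous k) (h0 : ∀ x : ℂ, 1 ≤ ‖x‖ → k x = 0) :
    Continuous fun s => ∫ x, f s x * k x := by
  have : (fun s => ∫ x, f s x * k x) = fun s => ∫ x in closedBall (0 : ℂ) 1, f s x * k x := by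
    funext s
    refine (setIntegral_eq_integral_of_forall_compl_eq_zero fun x hx => ?_).symm
    rw [h0 x, mul_zero]
    simp at hx; exact hx.le
  rw [this]
  refine continuous_parametric_integral_of_continuous (f := fun s x => f s x * k x) ?_
    (isCompact_closedBall _ _)
  exact hf.mul (hk.comp continuous_snd)

lemma hasDerivAt_avg_aux {F : ℂ → ℝ} (hF : ContDiff ℝ 2 F) (z : ℂ) (s : ℝ) :
    HasDerivAt (fun s : ℝ => ∫ x, F (z - s • x) * kerW x)
      (∫ x, -(fderiv ℝ F (z - s • x) x) * kerW x) s := by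
  have hF' : Continuous (fderiv ℝ F) := hF.continuous_fderiv (by norm_num)
  have hF0 := hF.continuous
  have hW := contDiff_kerW.continuous
  have hG : Continuous fun p : ℝ × ℂ => fderiv ℝ F (z - p.1 • p.2) p.2 := by fun_prop
  obtain ⟨C, hC⟩ := ((isCompact_closedBall s 1).prod
    (isCompact_closedBall (0 : ℂ) 1)).exists_bound_of_continuousOn hG.continuousOn
  refine (hasDerivAt_integral_of_dominated_loc_of_deriv_le (s := ball s 1)
    (F' := fun s x => -(fderiv ℝ F (z - s • x) x) * kerW x)
    (bound := fun x => C * kerW x) (ball_mem_nhds s one_pos)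
    (Eventually.of_forall fun t => ?_) ?_ ?_ ?_ ?_ ?_).2
  · exact Continuous.aestronglyMeasurable (by fun_prop)
  · exact Continuous.integrable_of_hasCompactSupport (by fun_prop) hasCompactSupport_kerW.mul_left
  · exact Continuous.aestronglyMeasurable (by fun_prop)
  · refine Eventually.of_forall fun x t ht => ?_
    rw [norm_mul, norm_neg, Real.norm_of_nonneg (kerW_nonneg x)]
    by_cases hx : 1 ≤ ‖x‖
    · simp [kerW_eq_zero hx]
    · refine mul_le_mul_of_nonneg_right (hC (t, x) ⟨ball_subset_closedBall ht, ?_⟩) (kerW_nonneg x)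
      simpa using (not_le.1 hx).le
  · exact (hW.integrable_of_hasCompactSupport hasCompactSupport_kerW).const_mul C
  · refine Eventually.of_forall fun x t _ => HasDerivAt.mul_const ?_ _
    have h1 : HasDerivAt (fun t : ℝ => z - t • x) (-x) t := by
      simpa using ((hasDerivAt_id t).smul_const x).const_sub z
    have := (hF.differentiable (by norm_num) (z - t • x)).hasFDerivAt.comp_hasDerivAt t h1
    simpa using! this

lemma integral_comp_mul_kerB {G : ℂ → ℝ} (hG : ContDiff ℝ 1 G) (z : ℂ) (s : ℝ) (v : ℂ) :
    ∫ x, G (z - s • x) * fderiv ℝ kerB x v = s * ∫ x, fderiv ℝ G (z - s • x) v * kerB x := by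
  have hB := contDiff_kerB
  have hBc := hB.continuous
  have hB' : Continuous (fderiv ℝ kerB) := hB.continuous_fderiv (by norm_num)
  have hG' : Continuous (fderiv ℝ G) := hG.continuous_fderiv (by norm_num)
  have hG0 := hG.continuous
  have hd : ∀ x, HasFDerivAt (fun x : ℂ => G (z - s • x))
      ((fderiv ℝ G (z - s • x)).comp (-(s • ContinuousLinearMap.id ℝ ℂ))) x := fun x =>
    (hG.differentiable one_ne_zero _).hasFDerivAt.comp x
      (((hasFDerivAt_id x).const_smul s).const_sub z)
  have hd' : ∀ x, fderiv ℝ (fun x : ℂ => G (z - s • x)) x v = -s * fderiv ℝ G (z - s • x) v := by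
    intro x; rw [(hd x).fderiv]; simp
  have := integral_mul_fderiv_eq_neg_fderiv_mul_of_integrable (𝕜 := ℝ) (μ := (volume : Measure ℂ))
    (f := fun x : ℂ => G (z - s • x)) (g := kerB) (v := v) ?_ ?_ ?_
    (fun x _ => (hd x).differentiableAt)
    (fun x _ => hB.differentiable (by norm_num) x)
  · rw [this, ← integral_neg, ← integral_const_mul]
    congr 1; funext x; rw [hd']; ring
  · simp only [hd']
    exact Continuous.integrable_of_hasCompactSupport (by fun_prop) hasCompactSupport_kerB.mul_left
  · exact Continuous.integrable_of_hasCompactSupport (by fun_prop)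
      ((hasCompactSupport_kerB.fderiv ℝ).comp_left (g := fun L : ℂ →L[ℝ] ℝ => L v)
          (by simp)).mul_left
  · exact Continuous.integrable_of_hasCompactSupport (by fun_prop) hasCompactSupport_kerB.mul_left

lemma hasDerivAt_avg {F : ℂ → ℝ} (hF : ContDiff ℝ 2 F) (z : ℂ) (s : ℝ) :
    HasDerivAt (fun s : ℝ => ∫ x, F (z - s • x) * kerW x)
      (s * ∫ x, lap F (z - s • x) * kerB x) s := by
  convert hasDerivAt_avg_aux hF z s using 1
  have hx := contDiff_dx hF one_add_one_le_two
  have hy := contDiff_dy hF one_add_one_le_two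
  have hxx := (contDiff_dx hx (m := 0) (by norm_num)).continuous
  have hyy := (contDiff_dy hy (m := 0) (by norm_num)).continuous
  have hB := contDiff_kerB.continuous
  have hB' : Continuous (fderiv ℝ kerB) := contDiff_kerB.continuous_fderiv (by norm_num)
  have e : ∀ x, -(fderiv ℝ F (z - s • x) x) * kerW x =
      dx F (z - s • x) * fderiv ℝ kerB x 1 + dy F (z - s • x) * fderiv ℝ kerB x Complex.I := by
    intro x
    have h1 : fderiv ℝ kerB x 1 = - x.re * kerW x := dx_kerB x
    have h2 : fderiv ℝ kerB x Complex.I = - x.im * kerW x := dy_kerB x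
    have h3 : fderiv ℝ F (z - s • x) x = x.re * dx F (z - s • x) + x.im * dy F (z - s • x) := by
      conv_lhs => rw [show x = x.re • (1 : ℂ) + x.im • Complex.I by
        simp [Complex.re_add_im]]
      rw [map_add, map_smul, map_smul]
      simp [dx, dy, Complex.re_add_im]
    rw [h1, h2, h3]; ring
  have cB : ∀ v, HasCompactSupport fun x => fderiv ℝ kerB x v := fun v =>
    ((hasCompactSupport_kerB.fderiv ℝ).comp_left (g := fun L : ℂ →L[ℝ] ℝ => L v) (by simp))
  have hxc := hx.continuous
  have hyc := hy.continuous
  simp only [e]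
  rw [integral_add, integral_comp_mul_kerB hx, integral_comp_mul_kerB hy, ← mul_add,
    ← integral_add]
  · congr 2; funext x; rw [← add_mul]; rfl
  · exact Continuous.integrable_of_hasCompactSupport
      (f := fun x => dx (dx F) (z - s • x) * kerB x) (by fun_prop) hasCompactSupport_kerB.mul_left
  · exact Continuous.integrable_of_hasCompactSupport
      (f := fun x => dy (dy F) (z - s • x) * kerB x) (by fun_prop) hasCompactSupport_kerB.mul_left
  · exact Continuous.integrable_of_hasCompactSupport (by fun_prop) (cB 1).mul_left
  · exact Continuous.integrable_of_hasCompactSupport (by fun_prop) (cB Complex.I).mul_left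

/-- The difference between a weighted average and the value at the centre. -/
lemma avg_sub_eq {F : ℂ → ℝ} (hF : ContDiff ℝ 2 F) (z : ℂ) (T : ℝ) :
    (∫ x, F (z - T • x) * kerW x) - F z * ∫ x, kerW x =
      ∫ s in (0 : ℝ)..T, s * ∫ x, lap F (z - s • x) * kerB x := by
  have hl := continuous_lap hF
  have hc : Continuous fun s : ℝ => s * ∫ x, lap F (z - s • x) * kerB x := by
    refine continuous_id.mul (continuous_integral_mul_ker (f := fun s x => lap F (z - s • x)) ?_
      contDiff_kerB.continuous fun x => kerB_eq_zero)
    unfold Function.uncurry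
    fun_prop
  rw [intervalIntegral.integral_eq_sub_of_hasDerivAt (fun s _ => hasDerivAt_avg hF z s)
    (hc.intervalIntegrable _ _)]
  simp [integral_const_mul]


lemma circleMap_eq_polarCoord_symm (z : ℂ) (T : ℝ) (p : ℝ × ℝ) :
    z + T • Complex.polarCoord.symm p = circleMap z (T * p.1) p.2 := by
  rw [Complex.polarCoord_symm_apply, circleMap, Complex.exp_mul_I]
  simp; ring

lemma integral_ball_mul_kerW_nonneg {v : ℂ → ℝ} {z : ℂ} {T : ℝ} (hT : 0 < T)
    (h : ∀ R, 0 < R → R < T → 0 ≤ ∫ θ in (0 : ℝ)..(2 * Real.pi), v (circleMap z R θ)) :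
    0 ≤ ∫ x, v (z + T • x) * kerW x := by
  rw [← Complex.integral_comp_polarCoord_symm]
  by_cases hi : IntegrableOn (fun p : ℝ × ℝ => p.1 • (v (z + T • Complex.polarCoord.symm p) *
      kerW (Complex.polarCoord.symm p))) polarCoord.target
  swap
  · rw [IntegrableOn] at hi
    rw [integral_undef hi]
  rw [polarCoord_target] at hi ⊢
  rw [Measure.volume_eq_prod] at hi ⊢
  rw [setIntegral_prod _ hi]
  refine setIntegral_nonneg measurableSet_Ioi fun R hR => ?_
  have hR : 0 < R := hR
  have hn : ∀ θ : ℝ, kerW (Complex.polarCoord.symm (R, θ)) = kerW R := by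
    intro θ
    simp only [kerW, sqd_eq, sub_zero, Complex.norm_polarCoord_symm, Complex.norm_real,
      Real.norm_eq_abs]
  simp only [hn, circleMap_eq_polarCoord_symm, smul_eq_mul]
  rw [integral_const_mul, integral_mul_const]
  refine mul_nonneg hR.le ?_
  by_cases h1 : 1 ≤ R
  · rw [kerW_eq_zero (by simpa [abs_of_pos hR] using h1), mul_zero]
  refine mul_nonneg ?_ (kerW_nonneg _)
  have hp : Function.Periodic (fun θ => v (circleMap z (T * R) θ)) (2 * Real.pi) := fun θ => by
    simp only [periodic_circleMap z (T * R) θ]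
  have e := hp.intervalIntegral_add_eq (-Real.pi) 0
  rw [zero_add, show -Real.pi + 2 * Real.pi = Real.pi by ring,
    intervalIntegral.integral_of_le (by linarith [Real.pi_pos]), integral_Ioc_eq_integral_Ioo] at e
  rw [e]
  exact h _ (mul_pos hT hR) (by nlinarith [not_le.1 h1])

lemma integral_sub_mul_kerW (v : ℂ → ℝ) (z : ℂ) (T : ℝ) :
    ∫ x, v (z - T • x) * kerW x = ∫ x, v (z + T • x) * kerW x := by
  rw [← integral_neg_eq_self]
  simp [kerW_neg]

/-- The area sub-mean value inequality follows from the circular one. -/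
lemma mul_integral_kerW_le {u : ℂ → ℝ} (hu : Measurable u) {A : ℝ} (hA : ∀ x, |u x| ≤ A)
    {z : ℂ} {T : ℝ} (hT : 0 < T)
    (h : ∀ R, 0 < R → R < T →
      2 * Real.pi * u z ≤ ∫ θ in (0 : ℝ)..(2 * Real.pi), u (circleMap z R θ)) :
    u z * ∫ x, kerW x ≤ ∫ x, u (z + T • x) * kerW x := by
  have hW := contDiff_kerW.continuous.integrable_of_hasCompactSupport hasCompactSupport_kerW
    (μ := volume)
  have hi : Integrable fun x => u (z + T • x) * kerW x := by
    refine hW.bdd_mul (c := A) (Measurable.aestronglyMeasurable (by fun_prop))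
      (Eventually.of_forall fun x => by simpa using hA _)
  have := integral_ball_mul_kerW_nonneg (v := fun y => u y - u z) (z := z) hT fun R h0 hR => by
    have hm : ∀ R : ℝ, Measurable fun θ => u (circleMap z R θ) := fun R =>
      hu.comp (continuous_circleMap z R).measurable
    rw [intervalIntegral.integral_sub _ (by simp)]
    · have := h R h0 hR
      simp; linarith
    · rw [intervalIntegrable_iff]
      exact Measure.integrableOn_of_bounded (M := A) (by simp [ENNReal.mul_eq_top])
          (hm R).aestronglyMeasurable
        (Eventually.of_forall fun x => by simpa using hA _)
  simp only [sub_mul] at this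
  rw [integral_sub hi (hW.const_mul _), integral_const_mul] at this
  linarith

lemma lap_nonneg_of_circle {u : ℂ → ℝ} (hu : ContDiff ℝ 2 u) {z : ℂ} {T : ℝ} (hT : 0 < T)
    (h : ∀ R, 0 < R → R < T →
      2 * Real.pi * u z ≤ ∫ θ in (0 : ℝ)..(2 * Real.pi), u (circleMap z R θ)) :
    0 ≤ lap u z := by
  by_contra! hneg
  have hl := continuous_lap hu
  obtain ⟨ε, hε, hb⟩ := Metric.mem_nhds_iff.1
    ((hl.tendsto z).eventually (Iio_mem_nhds (show lap u z < lap u z / 2 by linarith)))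
  set t := min (ε / 2) (T / 2) with ht
  have t0 : 0 < t := by positivity
  have te : t < ε := (min_le_left _ _).trans_lt (by linarith)
  have tT : t < T := (min_le_right _ _).trans_lt (by linarith)
  have h1 := integral_ball_mul_kerW_nonneg (v := fun y => u y - u z) (z := z) t0 fun R h0 hR => by
    have := hu.continuous
    rw [intervalIntegral.integral_sub _ (by simp)]
    · have := h R h0 (hR.trans tT)
      simp; linarith
    · exact Continuous.intervalIntegrable (by fun_prop) _ _
  have hW := contDiff_kerW.continuous.integrable_of_hasCompactSupport hasCompactSupport_kerW
    (μ := volume)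
  have huc := hu.continuous
  have hWc := contDiff_kerW.continuous
  have hBc := contDiff_kerB.continuous
  have hi : Integrable fun x => u (z + t • x) * kerW x :=
    Continuous.integrable_of_hasCompactSupport (by fun_prop) hasCompactSupport_kerW.mul_left
  simp only [sub_mul] at h1
  rw [integral_sub hi (hW.const_mul _), integral_const_mul, ← integral_sub_mul_kerW,
    avg_sub_eq hu] at h1
  have h2 : ∫ s in (0 : ℝ)..t, s * ∫ x, lap u (z - s • x) * kerB x ≤
      ∫ s in (0 : ℝ)..t, s * (lap u z / 2 * ∫ x, kerB x) := by
    refine intervalIntegral.integral_mono_on t0.le ?_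
        (Continuous.intervalIntegrable (by fun_prop) _ _)
      fun s hs => mul_le_mul_of_nonneg_left ?_ hs.1
    · refine Continuous.intervalIntegrable (continuous_id.mul
        (continuous_integral_mul_ker (f := fun s x => lap u (z - s • x)) ?_
        hBc fun x => kerB_eq_zero)) _ _
      unfold Function.uncurry
      fun_prop
    · rw [← integral_const_mul]
      refine integral_mono (Continuous.integrable_of_hasCompactSupport (by fun_prop)
        hasCompactSupport_kerB.mul_left) (Continuous.integrable_of_hasCompactSupport (by fun_prop)
        hasCompactSupport_kerB.mul_left) fun x => ?_
      by_cases hx : 1 ≤ ‖x‖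
      · simp [kerB_eq_zero hx]
      · refine mul_le_mul_of_nonneg_right (le_of_lt (hb ?_)) (kerB_nonneg x)
        rw [mem_ball, dist_eq_norm, show z - s • x - z = -(s • x) by ring, norm_neg, norm_smul,
          Real.norm_of_nonneg hs.1]
        have := hs.1; have := hs.2
        have := norm_nonneg x
        nlinarith [not_le.1 hx]
  rw [intervalIntegral.integral_mul_const, integral_id] at h2
  have h3 := integral_kerB_pos
  have : (t ^ 2 - 0 ^ 2) / 2 * (lap u z / 2 * ∫ x, kerB x) < 0 := by
    apply mul_neg_of_pos_of_neg
    · have := pow_pos t0 2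
      linarith
    · exact mul_neg_of_neg_of_pos (by linarith) h3
  linarith


/-- Mollification of `g` by the bump function `φ`. -/
noncomputable def moll (φ : ContDiffBump (0 : ℂ)) (g : ℂ → ℝ) : ℂ → ℝ :=
  convolution (φ.normed volume) g (ContinuousLinearMap.lsmul ℝ ℝ) volume

lemma moll_apply (φ : ContDiffBump (0 : ℂ)) (g : ℂ → ℝ) (z : ℂ) :
    moll φ g z = ∫ y, φ.normed volume y * g (z - y) := rfl

lemma locallyIntegrable_of_bound {g : ℂ → ℝ} (hg : Measurable g) {A : ℝ} (hA : ∀ x, |g x| ≤ A) :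
    LocallyIntegrable g := by
  intro x
  refine ⟨ball x 1, ball_mem_nhds x one_pos, ?_⟩
  exact Measure.integrableOn_of_bounded (M := A) measure_ball_lt_top.ne hg.aestronglyMeasurable
    (Eventually.of_forall fun x => by simpa using hA x)

section

variable {φ : ContDiffBump (0 : ℂ)} {g : ℂ → ℝ} {A : ℝ}

lemma contDiff_moll (hg : Measurable g) (hA : ∀ x, |g x| ≤ A) {n : ℕ∞} :
    ContDiff ℝ n (moll φ g) :=
  φ.hasCompactSupport_normed.contDiff_convolution_left _ φ.contDiff_normed
    (locallyIntegrable_of_bound hg hA)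

variable (φ) in
lemma integrable_normed : Integrable (φ.normed volume) (volume : Measure ℂ) :=
  Continuous.integrable_of_hasCompactSupport φ.continuous_normed φ.hasCompactSupport_normed

lemma abs_moll_le (hA : ∀ x, |g x| ≤ A) (z : ℂ) : |moll φ g z| ≤ A := by
  rw [moll_apply, ← Real.norm_eq_abs]
  calc ‖∫ y, φ.normed volume y * g (z - y)‖ ≤ ∫ y, φ.normed volume y * A := by
        refine norm_integral_le_of_norm_le ((integrable_normed φ).mul_const A)
          (Eventually.of_forall fun y => ?_)
        rw [norm_mul, Real.norm_of_nonneg (φ.nonneg_normed y)]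
        exact mul_le_mul_of_nonneg_left (hA _) (φ.nonneg_normed y)
    _ = A := by rw [integral_mul_const, φ.integral_normed, one_mul]

lemma moll_eq {c : ℝ} {z : ℂ} (h : ∀ x ∈ ball z φ.rOut, g x = c) : moll φ g z = c := by
  have hz := h z (mem_ball_self φ.rOut_pos)
  rw [← hz]
  exact φ.normed_convolution_eq_right fun x hx => by rw [h x hx, hz]

lemma circle_moll (hg : Measurable g) (hA : ∀ x, |g x| ≤ A) {z : ℂ} {R : ℝ}
    (h : ∀ x ∈ ball z φ.rOut,
      2 * Real.pi * g x ≤ ∫ θ in (0 : ℝ)..(2 * Real.pi), g (circleMap x R θ)) :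
    2 * Real.pi * moll φ g z ≤ ∫ θ in (0 : ℝ)..(2 * Real.pi), moll φ g (circleMap z R θ) := by
  have hpi := Real.two_pi_pos.le
  have hm : Measurable fun p : ℝ × ℂ => φ.normed volume p.2 * g (circleMap z R p.1 - p.2) := by
    have h1 : Measurable fun p : ℝ × ℂ => φ.normed volume p.2 :=
      φ.continuous_normed.measurable.comp measurable_snd
    have h2 : Measurable fun p : ℝ × ℂ => circleMap z R p.1 - p.2 :=
      Continuous.measurable (by
        have := continuous_circleMap z R
        fun_prop)
    exact h1.mul (hg.comp h2)
  have hi : Integrable (fun p : ℝ × ℂ => φ.normed volume p.2 * g (circleMap z R p.1 - p.2))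
      ((volume.restrict (Ioc 0 (2 * Real.pi))).prod volume) := by
    have : Integrable (fun p : ℝ × ℂ => (1 : ℝ) * (φ.normed volume p.2 * A))
        ((volume.restrict (Ioc 0 (2 * Real.pi))).prod volume) :=
      Integrable.mul_prod (integrable_const 1) ((integrable_normed φ).mul_const A)
    refine this.mono' hm.aestronglyMeasurable (Eventually.of_forall fun p => ?_)
    rw [norm_mul, Real.norm_of_nonneg (φ.nonneg_normed _), one_mul]
    exact mul_le_mul_of_nonneg_left (hA _) (φ.nonneg_normed _)
  rw [intervalIntegral.integral_of_le hpi]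
  simp only [moll_apply]
  rw [integral_integral_swap (f := fun θ y => φ.normed volume y * g (circleMap z R θ - y)) hi,
    ← integral_const_mul]
  refine integral_mono ?_ hi.swap.integral_prod_left fun y => ?_
  · have hfi : Integrable (fun y => φ.normed volume y * g (z - y)) := by
      refine ((integrable_normed φ).mul_const A).mono' ?_ (Eventually.of_forall fun y => ?_)
      · have h1 : Measurable (φ.normed (volume : Measure ℂ)) :=
          (φ.continuous_normed (μ := volume)).measurable
        exact (h1.mul (hg.comp (by fun_prop))).aestronglyMeasurable
      · rw [norm_mul, Real.norm_of_nonneg (φ.nonneg_normed _)]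
        exact mul_le_mul_of_nonneg_left (hA _) (φ.nonneg_normed _)
    exact hfi.const_mul _
  · simp only
    rw [integral_const_mul]
    by_cases hy : y ∈ ball (0 : ℂ) φ.rOut
    · have := h (z - y) (by simpa [dist_eq_norm] using hy)
      rw [intervalIntegral.integral_of_le hpi] at this
      have e : ∀ θ, circleMap (z - y) R θ = circleMap z R θ - y := by
        intro θ; simp only [circleMap]; ring
      simp only [e] at this
      have := mul_le_mul_of_nonneg_left this (φ.nonneg_normed (μ := volume) y)
      linarith
    · rw [← φ.support_normed_eq (μ := volume), Function.notMem_support] at hy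
      simp [hy]

/-- Moving the mollification from one factor of a pairing to the other. -/
lemma integral_moll_mul (hg : Measurable g) (hA : ∀ x, |g x| ≤ A) {η : ℂ → ℝ}
    (hη : Continuous η) (hc : HasCompactSupport η) :
    ∫ z, moll φ g z * η z = ∫ y, φ.normed volume y * ∫ x, g x * η (x + y) := by
  have hηi := hη.integrable_of_hasCompactSupport hc (μ := volume)
  have hm : Measurable fun p : ℂ × ℂ => φ.normed volume p.2 * g (p.1 - p.2) * η p.1 := by
    have h1 : Measurable fun p : ℂ × ℂ => φ.normed volume p.2 :=
      φ.continuous_normed.measurable.comp measurable_snd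
    exact (h1.mul (hg.comp (by fun_prop))).mul (hη.measurable.comp measurable_fst)
  have hi : Integrable (fun p : ℂ × ℂ => φ.normed volume p.2 * g (p.1 - p.2) * η p.1)
      (volume.prod volume) := by
    have : Integrable (fun p : ℂ × ℂ => |η p.1| * (φ.normed volume p.2 * A))
        (volume.prod volume) :=
      Integrable.mul_prod hηi.norm ((integrable_normed φ).mul_const A)
    refine this.mono' hm.aestronglyMeasurable (Eventually.of_forall fun p => ?_)
    rw [norm_mul, norm_mul, Real.norm_of_nonneg (φ.nonneg_normed _), mul_comm]
    exact mul_le_mul_of_nonneg_left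
      (mul_le_mul_of_nonneg_left (hA _) (φ.nonneg_normed _)) (abs_nonneg _)
  simp only [moll_apply, ← integral_mul_const]
  rw [integral_integral_swap (f := fun z y => φ.normed volume y * g (z - y) * η z) hi]
  congr 1; funext y
  rw [← integral_const_mul, ← integral_add_right_eq_self _ y]
  congr 1; funext x
  rw [add_sub_cancel_right]; ring

end

/-- A sequence of bump functions shrinking to the origin. -/
noncomputable def bumpSeq (n : ℕ) : ContDiffBump (0 : ℂ) :=
  ⟨1 / (n + 1) / 2, 1 / (n + 1), by positivity, half_lt_self (by positivity)⟩

lemma tendsto_bumpSeq : Tendsto (fun n => (bumpSeq n).rOut) atTop (nhds 0) :=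
  tendsto_one_div_add_atTop_nhds_zero_nat

lemma ae_tendsto_moll {g : ℂ → ℝ} {A : ℝ} (hg : Measurable g) (hA : ∀ x, |g x| ≤ A) :
    ∀ᵐ z, Tendsto (fun n => moll (bumpSeq n) g z) atTop (nhds (g z)) := by
  refine ContDiffBump.ae_convolution_tendsto_right_of_locallyIntegrable (K := 2) tendsto_bumpSeq
    (Eventually.of_forall fun n => ?_) (locallyIntegrable_of_bound hg hA)
  simp only [bumpSeq]
  linarith

lemma tendsto_integral_moll_mul {g η : ℂ → ℝ} {A : ℝ} (hg : Measurable g) (hA : ∀ x, |g x| ≤ A)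
    (hη : Integrable η) :
    Tendsto (fun n => ∫ z, moll (bumpSeq n) g z * η z) atTop (nhds (∫ z, g z * η z)) := by
  refine tendsto_integral_of_dominated_convergence (fun z => A * ‖η z‖) (fun n => ?_)
    (hη.norm.const_mul A) (fun n => Eventually.of_forall fun z => ?_) ?_
  · exact (contDiff_moll (n := 0) hg hA).continuous.aestronglyMeasurable.mul hη.aestronglyMeasurable
  · rw [norm_mul]
    exact mul_le_mul_of_nonneg_right (abs_moll_le hA z) (norm_nonneg _)
  · filter_upwards [ae_tendsto_moll hg hA] with z hz
    exact hz.mul_const _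


lemma laplacian_eq_lap {f : ℂ → ℝ} (hf : ContDiff ℝ 2 f) (z : ℂ) :
    Laplacian.laplacian f z = lap f z := by
  have hd : DifferentiableAt ℝ (fderiv ℝ f) z :=
    ((hf.fderiv_right (m := 1) one_add_one_le_two).differentiable (by norm_num)) z
  rw [InnerProductSpace.laplacian_eq_iteratedFDeriv_complexPlane]
  simp only [iteratedFDeriv_two_apply, Matrix.cons_val_zero, Matrix.cons_val_one]
  have h1 : ∀ v : ℂ, fderiv ℝ (fun z => fderiv ℝ f z v) z v = fderiv ℝ (fderiv ℝ f) z v v := by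
    intro v
    rw [fderiv_clm_apply hd (differentiableAt_const v)]
    simp
  simp only [lap, dx, dy]
  rw [← h1 1, ← h1 Complex.I]
  rfl

lemma eqOn_ball_of_lap_eq_zero {f : ℂ → ℝ} (hf : ContDiff ℝ 2 f) {q v : ℂ} {ε c : ℝ}
    (h : ∀ z ∈ ball q ε, lap f z = 0) (hv : v ∈ ball q ε) (hc : ∀ᶠ z in nhds v, f z = c) :
    ∀ z ∈ ball q ε, f z = c := by
  have hA : AnalyticOnNhd ℝ f (ball q ε) := fun z hz => by
    refine HarmonicAt.analyticAt ⟨hf.contDiffAt, ?_⟩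
    filter_upwards [isOpen_ball.mem_nhds hz] with y hy
    rw [laplacian_eq_lap hf, h y hy]; rfl
  exact hA.eqOn_of_preconnected_of_eventuallyEq (g := fun _ => c) analyticOnNhd_const
    (convex_ball q ε).isPreconnected hv hc

lemma lap_comp_add (f : ℂ → ℝ) (y x : ℂ) : lap (fun x => f (x + y)) x = lap f (x + y) := by
  have h : ∀ (g : ℂ → ℝ) (v : ℂ), (fun x => fderiv ℝ (fun x => g (x + y)) x v)
      = fun x => fderiv ℝ g (x + y) v := by
    intro g v; funext x; rw [fderiv_comp_add_right]
  have hx : dx (fun x => f (x + y)) = fun x => dx f (x + y) := h f 1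
  have hy : dy (fun x => f (x + y)) = fun x => dy f (x + y) := h f Complex.I
  have hxx : dx (fun x => dx f (x + y)) = fun x => dx (dx f) (x + y) := h (dx f) 1
  have hyy : dy (fun x => dy f (x + y)) = fun x => dy (dy f) (x + y) := h (dy f) Complex.I
  simp only [lap, hx, hy, hxx, hyy]

/-- A real-valued, locally bounded subharmonic function on an open set. -/
structure IsSub (D : Set ℂ) (r : ℂ → ℝ) : Prop where
  isOpen : IsOpen D
  meas : Measurable r
  bdd : ∀ K ⊆ D, IsCompact K → ∃ A, ∀ z ∈ K, |r z| ≤ A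
  usc : UpperSemicontinuousOn r D
  circle : ∀ z R, 0 < R → closedBall z R ⊆ D →
    2 * Real.pi * r z ≤ ∫ θ in (0 : ℝ)..(2 * Real.pi), r (circleMap z R θ)

section

variable {D K : Set ℂ} {r : ℂ → ℝ}

lemma IsSub.indicator_bdd (h : IsSub D r) (hK : IsCompact K) (hKD : K ⊆ D) :
    Measurable (K.indicator r) ∧ ∃ A, ∀ x, |K.indicator r x| ≤ A := by
  refine ⟨h.meas.indicator hK.measurableSet, ?_⟩
  obtain ⟨A, hA⟩ := h.bdd K hKD hK
  refine ⟨max A 0, fun x => ?_⟩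
  by_cases hx : x ∈ K
  · rw [indicator_of_mem hx]; exact (hA x hx).trans (le_max_left _ _)
  · rw [indicator_of_notMem hx]; simp

lemma IsSub.circle_indicator (h : IsSub D r) (hKD : K ⊆ D) {x : ℂ} {R : ℝ} (hR : 0 < R)
    (hx : closedBall x R ⊆ K) :
    2 * Real.pi * K.indicator r x
      ≤ ∫ θ in (0 : ℝ)..(2 * Real.pi), K.indicator r (circleMap x R θ) := by
  rw [indicator_of_mem (hx (mem_closedBall_self hR.le))]
  refine (h.circle x R hR (hx.trans hKD)).trans_eq ?_
  congr 1; funext θ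
  rw [indicator_of_mem (hx (circleMap_mem_closedBall x hR.le θ))]

lemma IsSub.lap_moll_nonneg (h : IsSub D r) (hK : IsCompact K) (hKD : K ⊆ D)
    {φ : ContDiffBump (0 : ℂ)} {z : ℂ} {δ : ℝ} (hδ : 0 < δ) (hz : ball z (φ.rOut + δ) ⊆ K) :
    0 ≤ lap (moll φ (K.indicator r)) z := by
  obtain ⟨hm, A, hA⟩ := h.indicator_bdd hK hKD
  refine lap_nonneg_of_circle (contDiff_moll (n := 2) hm hA) hδ fun R hR hRδ => ?_
  refine circle_moll hm hA fun x hx => h.circle_indicator hKD hR fun y hy => hz ?_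
  rw [mem_ball] at hx ⊢
  rw [mem_closedBall] at hy
  linarith [dist_triangle y x z]

lemma IsSub.eqOn_of_ae (h : IsSub D r) {q : ℂ} {ε c : ℝ} (hε : 0 < ε)
    (hq : closedBall q (2 * ε) ⊆ D)
    (hae : ∀ᵐ z, z ∈ ball q (2 * ε) → r z = c) : ∀ z ∈ ball q ε, r z = c := by
  intro z hz
  have hzD : ball z ε ⊆ ball q (2 * ε) := by
    intro y hy
    rw [mem_ball] at *
    linarith [dist_triangle y z q]
  apply le_antisymm
  · obtain ⟨hm, A, hA⟩ := h.indicator_bdd (isCompact_closedBall q (2 * ε)) hq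
    have h1 := mul_integral_kerW_le hm hA (z := z) hε fun R hR hRε =>
      h.circle_indicator hq hR
        ((closedBall_subset_ball hRε).trans (hzD.trans ball_subset_closedBall))
    have hmap : ∀ᵐ x : ℂ, z + ε • x ∈ ball q (2 * ε) → r (z + ε • x) = c := by
      have := (measurePreserving_add_left (volume : Measure ℂ) z).quasiMeasurePreserving.comp
        (Measure.quasiMeasurePreserving_smul (volume : Measure ℂ) hε.ne')
      exact this.ae hae
    have h2 : ∫ x, (closedBall q (2 * ε)).indicator r (z + ε • x) * kerW x
        = c * ∫ x, kerW x := by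
      rw [← integral_const_mul]
      refine integral_congr_ae ?_
      filter_upwards [hmap] with x hx
      by_cases hx1 : 1 ≤ ‖x‖
      · simp [kerW_eq_zero hx1]
      · have : z + ε • x ∈ ball q (2 * ε) := hzD (by
          rw [mem_ball, dist_eq_norm, add_sub_cancel_left, norm_smul, Real.norm_of_nonneg hε.le]
          nlinarith [not_le.1 hx1])
        rw [indicator_of_mem (ball_subset_closedBall this), hx this]
    rw [h2, indicator_of_mem (ball_subset_closedBall (hzD (mem_ball_self hε)))] at h1
    exact le_of_mul_le_mul_right h1 integral_kerW_pos
  · by_contra! hlt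
    have hzD' : z ∈ D := hq (ball_subset_closedBall (hzD (mem_ball_self hε)))
    have h1 := h.usc z hzD' c hlt
    rw [h.isOpen.nhdsWithin_eq hzD'] at h1
    have h2 : ∀ᶠ y in nhds z, y ∈ ball q (2 * ε) := isOpen_ball.mem_nhds (hzD (mem_ball_self hε))
    obtain ⟨O, hO, hOo, hzO⟩ := _root_.eventually_nhds_iff.1 (h1.and h2)
    have h3 : volume O = 0 := by
      refine measure_mono_null ?_ hae
      intro y hy hy'
      exact (hO y hy).1.ne (hy' (hO y hy).2)
    exact (hOo.measure_pos volume ⟨z, hzO⟩).ne' h3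

end


lemma lap_congr {f g : ℂ → ℝ} {z : ℂ} (h : f =ᶠ[nhds z] g) : lap f z = lap g z := by
  have hd : ∀ {f g : ℂ → ℝ}, f =ᶠ[nhds z] g → ∀ v : ℂ,
      (fun z => fderiv ℝ f z v) =ᶠ[nhds z] (fun z => fderiv ℝ g z v) := by
    intro f g hg v
    filter_upwards [hg.fderiv (𝕜 := ℝ)] with z hz
    rw [hz]
  exact congrArg₂ (· + ·) (hd (hd h 1) 1).eq_of_nhds (hd (hd h Complex.I) Complex.I).eq_of_nhds

lemma lap_const (c : ℝ) (z : ℂ) : lap (fun _ => c) z = 0 := by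
  have hx : dx (fun _ => c) = fun _ => (0 : ℝ) := by funext; simp [dx]
  have hy : dy (fun _ => c) = fun _ => (0 : ℝ) := by funext; simp [dy]
  rw [lap, hx, hy]
  simp [dx, dy]

lemma lap_eq_zero_of_notMem_tsupport {f : ℂ → ℝ} {z : ℂ} (h : z ∉ tsupport f) : lap f z = 0 :=
  (lap_congr (notMem_tsupport_iff_eventuallyEq.1 h)).trans (lap_const 0 z)

lemma integral_translate {φ : ContDiffBump (0 : ℂ)} {g η : ℂ → ℝ} {A : ℝ}
    (hg : Measurable g) (hA : ∀ x, |g x| ≤ A) (hη : ContDiff ℝ 2 η) (hc : HasCompactSupport η) :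
    ∫ z, η z * lap (moll φ g) z
      = ∫ y, φ.normed volume y * ∫ x, g x * lap (fun x => η (x + y)) x := by
  rw [← integral_mul_lap (contDiff_moll (n := 2) hg hA) hη hc,
    integral_moll_mul hg hA (continuous_lap hη) (hasCompactSupport_lap hc)]
  simp only [lap_comp_add]

lemma lap_eq_zero_of_integral_nonpos {u : ℂ → ℝ} (hu : ContDiff ℝ 2 u) {q : ℂ} {ε : ℝ}
    (h0 : ∀ z ∈ ball q ε, 0 ≤ lap u z)
    (h : ∀ η : ℂ → ℝ, ContDiff ℝ 2 η → (∀ x, 0 ≤ η x) → HasCompactSupport η →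
      (∀ x, x ∉ ball q ε → η x = 0) → ∫ z, η z * lap u z ≤ 0) :
    ∀ z ∈ ball q ε, lap u z = 0 := by
  intro z hz
  refine le_antisymm ?_ (h0 z hz)
  by_contra! hpos
  obtain ⟨δ, hδ, hδε⟩ := Metric.isOpen_iff.1 isOpen_ball z hz
  let η : ContDiffBump z := ⟨δ / 2, δ, half_pos hδ, half_lt_self hδ⟩
  have hη0 : ∀ x, x ∉ ball q ε → η x = 0 := fun x hx => by
    have : x ∉ Function.support η := by rw [η.support_eq]; exact fun h => hx (hδε h)
    simpa using this
  have hnn : ∀ x, 0 ≤ η x * lap u x := fun x => by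
    by_cases hx : x ∈ ball q ε
    · exact mul_nonneg η.nonneg (h0 x hx)
    · simp [hη0 x hx]
  have hcont : Continuous fun x => η x * lap u x := η.continuous.mul (continuous_lap hu)
  have := hcont.integral_pos_of_hasCompactSupport_nonneg_nonzero (μ := volume) (x := z)
    (η.hasCompactSupport.mul_right) hnn (by
      have : η z = 1 := η.one_of_mem_closedBall (mem_closedBall_self η.rIn_pos.le)
      rw [this, one_mul]; exact hpos.ne')
  exact absurd this (not_lt.2 (h η η.contDiff (fun x => η.nonneg) η.hasCompactSupport hη0))

/-- Around a boundary point of the set where a non-constant subharmonic function is locally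
constant, its distributional Laplacian does not vanish. -/
lemma IsSub.exists_test {D : Set ℂ} {r : ℂ → ℝ} (h : IsSub D r) (hconn : IsPreconnected D)
    {w : ℂ} (hw : w ∈ D) {c : ℝ} (hwc : ∀ᶠ z in nhds w, r z = c) (hne : ∃ z ∈ D, r z ≠ c) :
    ∃ q ε, 0 < ε ∧ closedBall q (10 * ε) ⊆ D ∧ ∃ η : ℂ → ℝ, ContDiff ℝ 2 η ∧ (∀ x, 0 ≤ η x) ∧
      HasCompactSupport η ∧ (∀ x, x ∉ ball q ε → η x = 0) ∧ 0 < ∫ x, r x * lap η x := by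
  obtain ⟨V, hV⟩ : ∃ V, V = interior {z | r z = c} := ⟨_, rfl⟩
  have hwV : w ∈ V := by rw [hV]; exact mem_interior_iff_mem_nhds.2 hwc
  have hVo : IsOpen V := hV ▸ isOpen_interior
  have hVc : ∀ z ∈ V, r z = c := fun z hz =>
    interior_subset (s := {z | r z = c}) (by rwa [← hV])
  obtain ⟨q, hqD, hqV, hqn⟩ : ∃ q ∈ D, q ∈ closure V ∧ q ∉ V := by
    by_contra! hcon
    have hsub : D ⊆ V := by
      have := hconn.subset_of_closure_inter_subset hVo ⟨w, hw, hwV⟩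
        (fun q hq => hcon q hq.2 hq.1)
      exact this
    obtain ⟨z, hz, hzc⟩ := hne
    exact hzc (hVc z (hsub hz))
  obtain ⟨ε₀, hε₀, hε₀D⟩ := Metric.isOpen_iff.1 h.isOpen q hqD
  obtain ⟨ε, hε, hε2⟩ : ∃ ε > 0, 10 * ε < ε₀ := ⟨ε₀ / 20, by positivity, by linarith⟩
  have hKD : closedBall q (10 * ε) ⊆ D := (closedBall_subset_ball hε2).trans hε₀D
  refine ⟨q, ε, hε, hKD, ?_⟩
  by_contra! hcon
  obtain ⟨K, hK⟩ : ∃ K, K = closedBall q (10 * ε) := ⟨_, rfl⟩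
  have hKc : IsCompact K := hK ▸ isCompact_closedBall _ _
  rw [← hK] at hKD
  obtain ⟨hm, A, hA⟩ := h.indicator_bdd hKc hKD
  obtain ⟨v, hvV, hvq⟩ : ∃ v ∈ V, v ∈ ball q (ε / 2) := by
    obtain ⟨v, hv, hvV⟩ := Metric.mem_closure_iff.1 hqV (ε / 2) (half_pos hε)
    exact ⟨v, hv, by rwa [mem_ball, dist_comm]⟩
  obtain ⟨δ, hδ, hδV⟩ := Metric.isOpen_iff.1 (hVo.inter isOpen_ball) v ⟨hvV, hvq⟩
  have key : ∀ φ : ContDiffBump (0 : ℂ), φ.rOut < ε / 2 → φ.rOut < δ / 2 →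
      ∀ z ∈ ball q (ε / 2), moll φ (K.indicator r) z = c := by
    intro φ hφε hφδ
    have hu : ContDiff ℝ 2 (moll φ (K.indicator r)) := contDiff_moll (n := 2) hm hA
    refine eqOn_ball_of_lap_eq_zero hu (v := v) ?_ hvq ?_
    · refine lap_eq_zero_of_integral_nonpos hu ?_ ?_
      · intro z hz
        refine h.lap_moll_nonneg hKc hKD hε ?_
        rw [hK]
        intro y hy
        rw [mem_ball] at *
        rw [mem_closedBall]
        linarith [dist_triangle y z q]
      · intro η hη hη0 hηc hηs
        rw [integral_translate hm hA hη hηc]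
        refine integral_nonpos fun y => ?_
        by_cases hy : y ∈ ball (0 : ℂ) φ.rOut
        · refine mul_nonpos_of_nonneg_of_nonpos (φ.nonneg_normed y) ?_
          have hs : ∀ x, x ∉ ball q ε → η (x + y) = 0 := by
            intro x hx
            refine hηs _ fun hxy => hx ?_
            rw [mem_ball, dist_zero_right] at hy
            rw [mem_ball, dist_eq_norm] at *
            have : x - q = (x + y - q) - y := by ring
            rw [this]
            linarith [norm_sub_le (x + y - q) y]
          have h1 := hcon (fun x => η (x + y)) (hη.comp (contDiff_id.add contDiff_const))
            (fun x => hη0 _) (hηc.comp_homeomorph (Homeomorph.addRight y)) hs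
          refine le_trans (le_of_eq (integral_congr_ae (Eventually.of_forall fun x => ?_))) h1
          by_cases hx : x ∈ K
          · simp only [indicator_of_mem hx]
          · have : lap (fun x => η (x + y)) x = 0 := by
              rw [lap_comp_add]
              have hxy : x + y ∉ tsupport η := by
                intro hmem
                have : tsupport η ⊆ closedBall q ε :=
                  closure_minimal (fun t ht => by
                    by_contra hn
                    exact ht (hηs t fun h' => hn (ball_subset_closedBall
                      (ball_subset_ball (by linarith) h')))) isClosed_closedBall
                have := this hmem
                apply hx
                rw [hK]
                rw [mem_ball, dist_zero_right] at hy
                rw [mem_closedBall, dist_eq_norm] at *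
                have e : x - q = (x + y - q) - y := by ring
                rw [e]
                linarith [norm_sub_le (x + y - q) y]
              exact lap_eq_zero_of_notMem_tsupport hxy
            simp only [this, mul_zero]
        · rw [← φ.support_normed_eq (μ := volume), Function.notMem_support] at hy
          simp [hy]
    · filter_upwards [ball_mem_nhds v (half_pos hδ)] with z hz
      refine moll_eq fun x hx => ?_
      have : x ∈ ball v δ := by
        rw [mem_ball] at *
        linarith [dist_triangle x z v]
      have := hδV this
      rw [indicator_of_mem, hVc x this.1]
      rw [hK]
      exact ball_subset_closedBall (ball_subset_ball (by linarith) this.2)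
  have hae : ∀ᵐ z, z ∈ ball q (2 * (ε / 4)) → r z = c := by
    filter_upwards [ae_tendsto_moll hm hA] with z hz hzq
    have hzq' : z ∈ ball q (ε / 2) := by
      rwa [show 2 * (ε / 4) = ε / 2 by ring] at hzq
    have h1 : ∀ᶠ n in atTop, moll (bumpSeq n) (K.indicator r) z = c := by
      filter_upwards [tendsto_bumpSeq.eventually_lt_const (half_pos hε),
        tendsto_bumpSeq.eventually_lt_const (half_pos hδ)] with n h1 h2
      exact key _ h1 h2 z hzq'
    have h2 := tendsto_nhds_unique (hz.congr' h1) tendsto_const_nhds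
    rw [indicator_of_mem] at h2
    · exact h2
    · rw [hK]; exact ball_subset_closedBall (ball_subset_ball (by linarith) hzq')
  have hqc : ∀ z ∈ ball q (ε / 4), r z = c := by
    refine h.eqOn_of_ae (by positivity) ?_ hae
    refine subset_trans ?_ hKD
    rw [hK]; exact closedBall_subset_closedBall (by linarith)
  refine hqn ?_
  rw [hV]
  exact mem_interior_iff_mem_nhds.2 (mem_of_superset (ball_mem_nhds q (by positivity)) hqc)


/-- The measure whose convolution inverts `lap` up to averaging against `kerW` at scale `T`. -/
noncomputable def greenMeasure (T : ℝ) : Measure ℂ :=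
  Measure.map (fun p : ℝ × ℂ => p.1 • p.2)
    (((volume.restrict (Ioc 0 T)).prod volume).withDensity
      fun p => ENNReal.ofReal (p.1 * kerB p.2))

lemma integrable_greenDensity (T : ℝ) :
    Integrable (fun p : ℝ × ℂ => p.1 * kerB p.2) ((volume.restrict (Ioc 0 T)).prod volume) :=
  Integrable.mul_prod (f := fun s : ℝ => s) (continuous_id.integrableOn_Ioc)
    (contDiff_kerB.continuous.integrable_of_hasCompactSupport hasCompactSupport_kerB)

lemma measurable_greenDensity :
    Measurable fun p : ℝ × ℂ => ENNReal.ofReal (p.1 * kerB p.2) :=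
  (measurable_fst.mul (contDiff_kerB.continuous.measurable.comp measurable_snd)).ennreal_ofReal

instance (T : ℝ) : IsFiniteMeasure (greenMeasure T) := by
  have : IsFiniteMeasure (((volume.restrict (Ioc 0 T)).prod (volume : Measure ℂ)).withDensity
      fun p => ENNReal.ofReal (p.1 * kerB p.2)) :=
    isFiniteMeasure_withDensity_ofReal (integrable_greenDensity T).2
  unfold greenMeasure
  infer_instance

lemma integral_greenMeasure {T : ℝ} (hT : 0 ≤ T) {G : ℂ → ℝ} (hG : Continuous G) {C : ℝ}
    (hC : ∀ x, |G x| ≤ C) :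
    ∫ y, G y ∂(greenMeasure T) = ∫ s in (0 : ℝ)..T, s * ∫ x, G (s • x) * kerB x := by
  have hcont : Continuous fun p : ℝ × ℂ => p.1 • p.2 := by fun_prop
  rw [greenMeasure, integral_map hcont.aemeasurable hG.aestronglyMeasurable,
    integral_withDensity_eq_integral_toReal_smul measurable_greenDensity
      (Eventually.of_forall fun p => ENNReal.ofReal_lt_top)]
  have hae : ∀ᵐ p : ℝ × ℂ ∂((volume.restrict (Ioc 0 T)).prod volume), 0 ≤ p.1 := by
    have : ∀ᵐ s ∂(volume.restrict (Ioc 0 T)), 0 ≤ s := by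
      filter_upwards [ae_restrict_mem measurableSet_Ioc] with s hs using hs.1.le
    exact Measure.quasiMeasurePreserving_fst.ae this
  have e : ∫ p : ℝ × ℂ, (ENNReal.ofReal (p.1 * kerB p.2)).toReal • G (p.1 • p.2)
        ∂((volume.restrict (Ioc 0 T)).prod volume)
      = ∫ p : ℝ × ℂ, p.1 * kerB p.2 * G (p.1 • p.2) ∂((volume.restrict (Ioc 0 T)).prod volume) := by
    refine integral_congr_ae ?_
    filter_upwards [hae] with p hp
    rw [ENNReal.toReal_ofReal (mul_nonneg hp (kerB_nonneg _)), smul_eq_mul]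
  rw [e, integral_prod, intervalIntegral.integral_of_le hT]
  · refine integral_congr_ae (Eventually.of_forall fun s => ?_)
    simp only
    rw [← integral_const_mul]
    congr 1; funext x; ring
  · refine (integrable_greenDensity T).mul_bdd (c := C) (hG.comp hcont).aestronglyMeasurable
      (Eventually.of_forall fun p => hC _)

/-- `u` is a smooth approximation of the subharmonic function under consideration, with
Laplacian of mass at least `m` with respect to the test function `η`. -/
structure Adm (q : ℂ) (ε A m : ℝ) (η u : ℂ → ℝ) : Prop where
  smooth : ContDiff ℝ 4 u
  lap_nonneg : ∀ z ∈ ball q (9 * ε), 0 ≤ lap u z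
  bound : ∀ z ∈ ball q (9 * ε), |u z| ≤ A
  mass : m ≤ ∫ x, η x * lap u x

/-- Near `p` the Laplacian of admissible functions can be made uniformly positive by adding the
Laplacian of a uniformly bounded function. -/
def Corr (q : ℂ) (ε A m : ℝ) (η : ℂ → ℝ) (p : ℂ) : Prop :=
  ∃ s > 0, ∃ k ≥ 0, ∃ C : ℝ, ∀ u, Adm q ε A m η u → ∃ ψ : ℂ → ℝ, ContDiff ℝ 2 ψ ∧
    (∀ z, |ψ z| ≤ C) ∧ ∀ z, 0 ≤ lap u z → 0 ≤ k * lap u z + lap ψ z ∧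
      (z ∈ ball p s → 1 ≤ k * lap u z + lap ψ z)

lemma contDiff_two_lap {u : ℂ → ℝ} (hu : ContDiff ℝ 4 u) : ContDiff ℝ 2 (lap u) := by
  have h1 : (3 : WithTop ℕ∞) + 1 ≤ 4 := by norm_num
  have h2 : (2 : WithTop ℕ∞) + 1 ≤ 3 := by norm_num
  exact (contDiff_dx (contDiff_dx hu h1) h2).add (contDiff_dy (contDiff_dy hu h1) h2)

lemma kerW_ge {x : ℂ} (hx : ‖x‖ ≤ 1 / 2) : 3 ≤ kerW x := by
  have h1 : sqd 0 0 x ≤ 1 / 4 := by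
    rw [sqd_eq, sub_zero, add_zero]
    nlinarith [norm_nonneg x]
  have h2 : (3 / 4 : ℝ) ≤ max (1 - sqd 0 0 x) 0 := le_max_of_le_left (by linarith)
  have h3 : (3 / 4 : ℝ) ^ 3 ≤ max (1 - sqd 0 0 x) 0 ^ 3 := by gcongr
  rw [kerW]
  norm_num at h3 ⊢
  linarith

lemma integral_comp_sub_smul {F : ℂ → ℝ} (z : ℂ) {T : ℝ} :
    ∫ x, F (z - T • x) = (T ^ 2)⁻¹ * ∫ x, F x := by
  rw [Measure.integral_comp_smul volume (fun x => F (z - x)) T,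
    integral_sub_left_eq_self, Complex.finrank_real_complex, smul_eq_mul, abs_of_nonneg
        (by positivity)]


lemma integrable_mul_kerW {f : ℂ → ℝ} (hf : Continuous f) : Integrable fun x => f x * kerW x :=
  (hf.mul contDiff_kerW.continuous).integrable_of_hasCompactSupport
    (hasCompactSupport_kerW.mul_left)

lemma integrable_mul_kerB {f : ℂ → ℝ} (hf : Continuous f) : Integrable fun x => f x * kerB x :=
  (hf.mul contDiff_kerB.continuous).integrable_of_hasCompactSupport
    (hasCompactSupport_kerB.mul_left)

lemma continuous_mul_integral_kerB {F : ℂ → ℝ} (hF : Continuous F) (z : ℂ) :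
    Continuous fun s : ℝ => s * ∫ x, F (z - s • x) * kerB x := by
  refine continuous_id.mul (continuous_integral_mul_ker (f := fun s x => F (z - s • x)) ?_
    contDiff_kerB.continuous fun x => kerB_eq_zero)
  unfold Function.uncurry
  fun_prop

lemma lap_lin {f g : ℂ → ℝ} (hf : ContDiff ℝ 2 f) (hg : ContDiff ℝ 2 g) (a b : ℝ) (z : ℂ) :
    lap (fun z => a * f z + b * g z) z = a * lap f z + b * lap g z := by
  have h : ∀ f g : ℂ → ℝ, ContDiff ℝ 1 f → ContDiff ℝ 1 g → ∀ w,
      (fun z => fderiv ℝ (fun z => a * f z + b * g z) z w)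
        = fun z => a * fderiv ℝ f z w + b * fderiv ℝ g z w := by
    intro f g hf hg w; funext z
    have h1 := (hf.differentiable one_ne_zero) z
    have h2 := (hg.differentiable one_ne_zero) z
    rw [fderiv_fun_add (h1.const_mul a) (h2.const_mul b), fderiv_const_mul h1, fderiv_const_mul h2]
    simp
  have e : ∀ (w : ℂ), ContDiff ℝ 1 fun z => fderiv ℝ f z w := fun w =>
    (hf.fderiv_right one_add_one_le_two).clm_apply contDiff_const
  have e' : ∀ (w : ℂ), ContDiff ℝ 1 fun z => fderiv ℝ g z w := fun w =>
    (hg.fderiv_right one_add_one_le_two).clm_apply contDiff_const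
  have hf1 : ContDiff ℝ 1 f := hf.of_le (by norm_num)
  have hg1 : ContDiff ℝ 1 g := hg.of_le (by norm_num)
  have e1 : dx (fun z => a * f z + b * g z) = fun z => a * dx f z + b * dx g z := h f g hf1 hg1 1
  have e2 : dy (fun z => a * f z + b * g z) = fun z => a * dy f z + b * dy g z :=
    h f g hf1 hg1 Complex.I
  have e3 : dx (fun z => a * dx f z + b * dx g z) = fun z => a * dx (dx f) z + b * dx (dx g) z :=
    h _ _ (e 1) (e' 1) 1
  have e4 : dy (fun z => a * dy f z + b * dy g z) = fun z => a * dy (dy f) z + b * dy (dy g) z :=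
    h _ _ (e Complex.I) (e' Complex.I) Complex.I
  rw [lap, e1, e2, e3, e4, lap, lap]
  ring

lemma corr_base {q : ℂ} {ε A m : ℝ} (hε : 0 < ε) (hm : 0 < m) {η : ℂ → ℝ}
    (hη : ContDiff ℝ 2 η) (hη0 : ∀ x, 0 ≤ η x) (hc : HasCompactSupport η)
    (hs : ∀ x, x ∉ ball q ε → η x = 0) : Corr q ε A m η q := by
  obtain ⟨E, hE⟩ := hη.continuous.bounded_above_of_compact_support hc
  have hE' : ∀ x, η x ≤ E := fun x => (le_abs_self _).trans (hE x)
  have hE0 : 0 ≤ E := (hη0 0).trans (hE' 0)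
  obtain ⟨W, hW⟩ : ∃ W, W = ∫ x, kerW x := ⟨_, rfl⟩
  have hWpos : 0 < W := hW ▸ integral_kerW_pos
  obtain ⟨T, hT⟩ : ∃ T, T = 4 * ε := ⟨_, rfl⟩
  have hTpos : 0 < T := by rw [hT]; positivity
  obtain ⟨a, ha⟩ : ∃ a, a = T ^ 2 / (3 * m) := ⟨_, rfl⟩
  have hapos : 0 < a := by rw [ha]; positivity
  refine ⟨ε, hε, a * (E * W), by positivity, a * (E * (2 * (|A| * W))), fun u hu => ?_⟩
  have hlu : ContDiff ℝ 2 (lap u) := contDiff_two_lap hu.smooth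
  have hu2 : ContDiff ℝ 2 u := hu.smooth.of_le (by norm_num)
  obtain ⟨F, hF⟩ : ∃ F : ℂ → ℝ, F = fun z => η z * lap u z := ⟨_, rfl⟩
  have hFd : ContDiff ℝ 2 F := hF ▸ hη.mul hlu
  have hFc : HasCompactSupport F := hF ▸ hc.mul_right
  have hFz : ∀ x, x ∉ ball q ε → F x = 0 := fun x hx => by rw [hF]; simp [hs x hx]
  have hF0 : ∀ x, 0 ≤ F x := fun x => by
    by_cases hx : x ∈ ball q ε
    · rw [hF]; exact mul_nonneg (hη0 x) (hu.lap_nonneg x (ball_subset_ball (by linarith) hx))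
    · rw [hFz x hx]
  have hFE : ∀ x, 0 ≤ lap u x → F x ≤ E * lap u x := fun x hx => by
    rw [hF]; exact mul_le_mul_of_nonneg_right (hE' x) hx
  have hFm : m ≤ ∫ x, F x := by rw [hF]; exact hu.mass
  clear hF
  obtain ⟨v, hv⟩ : ∃ v : ℂ → ℝ, v = fun z => ∫ y, F (z - y) ∂(greenMeasure T) := ⟨_, rfl⟩
  have hvd : ContDiff ℝ 2 v := hv ▸ contDiff_two_integral_sub hFd hFc
  have hgr : ∀ {G : ℂ → ℝ}, Continuous G → HasCompactSupport G → ∀ z,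
      ∫ y, G (z - y) ∂(greenMeasure T) = ∫ s in (0 : ℝ)..T, s * ∫ x, G (z - s • x) * kerB x := by
    intro G hG hGc z
    obtain ⟨C, hC⟩ := hG.bounded_above_of_compact_support hGc
    exact integral_greenMeasure hTpos.le (G := fun y => G (z - y)) (by fun_prop) fun x => hC _
  have hvz : ∀ z, v z = ∫ s in (0 : ℝ)..T, s * ∫ x, F (z - s • x) * kerB x := fun z => by
    rw [hv]; exact hgr hFd.continuous hFc z
  have hlv : ∀ z, lap v z = (∫ x, F (z - T • x) * kerW x) - F z * W := fun z => by
    rw [hW, avg_sub_eq hFd, hv, lap_integral_sub hFd hFc]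
    exact hgr (continuous_lap hFd) (hasCompactSupport_lap hFc) z
  have hsm : ∀ {s : ℝ}, s ∈ Icc 0 T → ∀ z x : ℂ, ‖x‖ < 1 → dist (z - s • x) z < T := by
    intro s hs z x hx
    rw [dist_eq_norm, sub_sub_cancel_left, norm_neg, norm_smul, Real.norm_of_nonneg hs.1]
    nlinarith [hs.2, norm_nonneg x, hs.1]
  have hv0 : ∀ z, 0 ≤ v z := fun z => by
    rw [hvz]
    exact intervalIntegral.integral_nonneg hTpos.le fun s hs => mul_nonneg hs.1
      (integral_nonneg fun x => mul_nonneg (hF0 _) (kerB_nonneg x))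
  have hvb : ∀ z, v z ≤ E * (2 * (|A| * W)) := fun z => by
    by_cases hz : z ∈ ball q (5 * ε)
    · rw [mem_ball] at hz
      have hlo : ∀ {s : ℝ}, s ∈ Icc 0 T → ∀ x : ℂ, ‖x‖ < 1 → z - s • x ∈ ball q (9 * ε) := by
        intro s hs x hx
        rw [mem_ball]
        linarith [dist_triangle (z - s • x) z q, hsm hs z x hx]
      have h1 : v z ≤ ∫ s in (0 : ℝ)..T, E * (s * ∫ x, lap u (z - s • x) * kerB x) := by
        rw [hvz]
        refine intervalIntegral.integral_mono_on hTpos.le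
          ((continuous_mul_integral_kerB hFd.continuous z).intervalIntegrable _ _)
          ((continuous_const.mul (continuous_mul_integral_kerB hlu.continuous
              z)).intervalIntegrable _ _)
          fun s hs => ?_
        rw [← mul_assoc, mul_comm E s, mul_assoc, ← integral_const_mul E]
        refine mul_le_mul_of_nonneg_left ?_ hs.1
        have hFcont := hFd.continuous
        have hlcont := hlu.continuous
        refine integral_mono (integrable_mul_kerB (by fun_prop))
          ((integrable_mul_kerB (by fun_prop)).const_mul _) fun x => ?_
        simp only
        by_cases hx : ‖x‖ < 1
        · rw [← mul_assoc]
          exact mul_le_mul_of_nonneg_right (hFE _ (hu.lap_nonneg _ (hlo hs x hx))) (kerB_nonneg x)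
        · simp [kerB_eq_zero (not_lt.1 hx)]
      rw [intervalIntegral.integral_const_mul, ← avg_sub_eq hu2, ← hW] at h1
      refine h1.trans (mul_le_mul_of_nonneg_left ?_ hE0)
      have h2 : ∫ x, u (z - T • x) * kerW x ≤ |A| * W := by
        rw [hW, ← integral_const_mul]
        have hucont := hu2.continuous
        refine integral_mono (integrable_mul_kerW (by fun_prop))
          (integrable_mul_kerW continuous_const) fun x => ?_
        simp only
        by_cases hx : ‖x‖ < 1
        · refine mul_le_mul_of_nonneg_right ?_ (kerW_nonneg x)
          exact (le_abs_self _).trans ((hu.bound _ (hlo ⟨hTpos.le, le_rfl⟩ x hx)).trans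
            (le_abs_self A))
        · simp [kerW_eq_zero (not_lt.1 hx)]
      have h3 : -(u z * W) ≤ |A| * W := by
        rw [← neg_mul]
        refine mul_le_mul_of_nonneg_right ?_ hWpos.le
        exact (neg_le_abs _).trans ((hu.bound z (by rw [mem_ball]; linarith)).trans (le_abs_self A))
      linarith
    · have : v z = 0 := by
        rw [hvz]
        refine (intervalIntegral.integral_congr (g := fun _ => 0) fun s hs => ?_).trans
          intervalIntegral.integral_zero
        rw [uIcc_of_le hTpos.le] at hs
        have : ∀ x, F (z - s • x) * kerB x = 0 := fun x => by
          by_cases hx : ‖x‖ < 1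
          · rw [hFz, zero_mul]
            intro hmem
            rw [mem_ball] at hmem hz
            apply hz
            linarith [dist_triangle z (z - s • x) q, hsm hs z x hx, dist_comm z (z - s • x)]
          · simp [kerB_eq_zero (not_lt.1 hx)]
        simp only [this, integral_zero, mul_zero]
      rw [this]; positivity
  have hFW : ∀ z, 0 ≤ ∫ x, F (z - T • x) * kerW x := fun z =>
    integral_nonneg fun x => mul_nonneg (hF0 _) (kerW_nonneg x)
  have hFWm : ∀ z ∈ ball q ε, 3 * ((T ^ 2)⁻¹ * m) ≤ ∫ x, F (z - T • x) * kerW x := by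
    intro z hz
    have hFcont := hFd.continuous
    have hFi : Integrable fun x => F (z - T • x) := by
      have h1 : Integrable fun x => F (z - x) :=
        (hFcont.integrable_of_hasCompactSupport hFc).comp_sub_left z
      exact h1.comp_smul hTpos.ne'
    calc 3 * ((T ^ 2)⁻¹ * m) ≤ 3 * ((T ^ 2)⁻¹ * ∫ x, F x) := by gcongr
      _ = ∫ x, 3 * F (z - T • x) := by rw [integral_const_mul, integral_comp_sub_smul]
      _ ≤ ∫ x, F (z - T • x) * kerW x := by
        refine integral_mono (hFi.const_mul 3) (integrable_mul_kerW (by fun_prop)) fun x => ?_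
        simp only
        by_cases hx : ‖x‖ ≤ 1 / 2
        · nlinarith [hF0 (z - T • x), kerW_ge hx]
        · rw [hFz]
          · simp
          · intro hmem
            apply hx
            rw [mem_ball] at hz hmem
            have h1 : dist (z - T • x) z < 2 * ε := by
              linarith [dist_triangle (z - T • x) q z, dist_comm z q]
            rw [dist_eq_norm, sub_sub_cancel_left, norm_neg, norm_smul,
              Real.norm_of_nonneg hTpos.le, hT] at h1
            have : ε * (4 * ‖x‖) < ε * 2 := by linarith
            have := lt_of_mul_lt_mul_left this hε.le
            linarith
  refine ⟨fun z => a * v z, contDiff_const.mul hvd, fun z => ?_, fun z hz => ?_⟩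
  · rw [abs_of_nonneg (mul_nonneg hapos.le (hv0 z))]
    exact mul_le_mul_of_nonneg_left (hvb z) hapos.le
  · have hlav : lap (fun z => a * v z) z = a * lap v z := by
      simpa using lap_lin hvd (contDiff_const (c := (0 : ℝ))) a 0 z
    have hmain : ∫ x, F (z - T • x) * kerW x ≤ E * W * lap u z + lap v z := by
      rw [hlv]
      have := mul_le_mul_of_nonneg_right (hFE z hz) hWpos.le
      linarith
    have he : a * (E * W) * lap u z + lap (fun z => a * v z) z
        = a * (E * W * lap u z + lap v z) := by rw [hlav]; ring
    rw [he]
    refine ⟨mul_nonneg hapos.le ((hFW z).trans hmain), fun hzs => ?_⟩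
    have h1 := mul_le_mul_of_nonneg_left ((hFWm z hzs).trans hmain) hapos.le
    refine le_trans (le_of_eq ?_) h1
    rw [ha]; field_simp


lemma lap_max_pow (q : ℂ) (S : ℝ) (n : ℕ) (z : ℂ) :
    lap (fun z => max (S - sqd q 0 z) 0 ^ (n + 3)) z
      = 4 * (n + 3) * max (S - sqd q 0 z) 0 ^ (n + 1) *
        ((n + 2) * sqd q 0 z - max (S - sqd q 0 z) 0) := by
  have h1 : ∀ t : ℝ, HasDerivAt (fun t : ℝ => max (S - t) 0 ^ (n + 3))
      (-((n + 3) * max (S - t) 0 ^ (n + 2))) t := fun t => by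
    have := (hasDerivAt_max_pow (n + 1) (S - t)).comp t ((hasDerivAt_id t).const_sub S)
    exact this.congr_deriv (by push_cast; ring)
  have h2 : ∀ t : ℝ, HasDerivAt (fun t : ℝ => -((n + 3) * max (S - t) 0 ^ (n + 2)))
      ((n + 3) * ((n + 2) * max (S - t) 0 ^ (n + 1))) t := fun t => by
    have := ((hasDerivAt_max_pow n (S - t)).comp t ((hasDerivAt_id t).const_sub S)).const_mul
      (-((n : ℝ) + 3))
    refine (this.congr_deriv (by ring)).congr_of_eventuallyEq (Eventually.of_forall fun x => ?_)
    simp only [Function.comp_apply]; ring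
  rw [lap_radial (h := fun t => max (S - t) 0 ^ (n + 3))
    (h' := fun t => -((n + 3) * max (S - t) 0 ^ (n + 2))) (Eventually.of_forall fun y => h1 _)
        (h2 _)]
  ring

lemma Corr.transport {q : ℂ} {ε A m : ℝ} {η : ℂ → ℝ} {p : ℂ} (hp : Corr q ε A m η p) (w : ℂ) :
    Corr q ε A m η w := by
  obtain ⟨s, hs, k, hk, C, hC⟩ := hp
  obtain ⟨R, hR⟩ : ∃ R, R = dist w p + 2 := ⟨_, rfl⟩
  have hRpos : 2 ≤ R := by rw [hR]; linarith [dist_nonneg (x := w) (y := p)]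
  obtain ⟨n, hn⟩ := exists_nat_gt (R ^ 2 / s ^ 2)
  have hn' : R ^ 2 < n * s ^ 2 := (div_lt_iff₀ (by positivity)).1 hn
  obtain ⟨θ, hθ⟩ : ∃ θ : ℂ → ℝ, θ = fun z => max (R ^ 2 - sqd p 0 z) 0 ^ (n + 3) := ⟨_, rfl⟩
  have hθd : ContDiff ℝ 2 θ := by
    rw [hθ]
    exact ((contDiff_max_pow (n + 2)).comp (contDiff_const.sub (contDiff_sqd p 0))).of_le
      (by norm_cast; omega)
  have hsq : ∀ z, sqd p 0 z = dist z p ^ 2 := fun z => by rw [sqd_eq, dist_eq_norm, add_zero]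
  have hmax : ∀ z, max (R ^ 2 - sqd p 0 z) 0 ≤ R ^ 2 := fun z =>
    max_le (by rw [hsq]; nlinarith [sq_nonneg (dist z p)]) (by positivity)
  obtain ⟨B, hB⟩ : ∃ B, B = 4 * (n + 3) * (R ^ 2) ^ (n + 1) * R ^ 2 := ⟨_, rfl⟩
  have hB0 : 0 ≤ B := by rw [hB]; positivity
  obtain ⟨b, hb⟩ : ∃ b, b = 4 * (n + 3) * (R ^ 2 - (R - 1) ^ 2) ^ (n + 1) * (n * s ^ 2 - R ^ 2) :=
    ⟨_, rfl⟩
  have hb0 : 0 < b := by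
    rw [hb]
    have h1 : 0 < R ^ 2 - (R - 1) ^ 2 := by nlinarith
    have h2 : 0 < n * s ^ 2 - R ^ 2 := by linarith
    positivity
  have hlow : ∀ z, -B ≤ lap θ z := fun z => by
    rw [hθ, lap_max_pow]
    have h0 := le_max_right (R ^ 2 - sqd p 0 z) 0
    have h1 : max (R ^ 2 - sqd p 0 z) 0 ^ (n + 1) ≤ (R ^ 2) ^ (n + 1) :=
      pow_le_pow_left₀ h0 (hmax z) _
    have h2 : 0 ≤ ((n : ℝ) + 2) * sqd p 0 z := by rw [hsq]; positivity
    have h3 : max (R ^ 2 - sqd p 0 z) 0 ^ (n + 1) * max (R ^ 2 - sqd p 0 z) 0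
        ≤ (R ^ 2) ^ (n + 1) * R ^ 2 := mul_le_mul h1 (hmax z) h0 (by positivity)
    have h4 : 0 ≤ max (R ^ 2 - sqd p 0 z) 0 ^ (n + 1) := by positivity
    rw [hB]
    have h5 : 0 ≤ 4 * ((n : ℝ) + 3) := by positivity
    nlinarith [mul_nonneg h4 h2, mul_le_mul_of_nonneg_left h3 h5,
      mul_nonneg h5 (mul_nonneg h4 h2)]
  have hfac : ∀ z, z ∉ ball p s → n * s ^ 2 - R ^ 2 ≤
      (n + 2) * sqd p 0 z - max (R ^ 2 - sqd p 0 z) 0 := fun z hz => by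
    rw [mem_ball, not_lt] at hz
    have h1 : s ^ 2 ≤ sqd p 0 z := by rw [hsq]; gcongr
    have h2 : (n : ℝ) * s ^ 2 ≤ n * sqd p 0 z := by gcongr
    nlinarith [hmax z, sq_nonneg s]
  have hoff : ∀ z, z ∉ ball p s → 0 ≤ lap θ z := fun z hz => by
    rw [hθ, lap_max_pow]
    have := hfac z hz
    exact mul_nonneg (by positivity) (by linarith)
  have hbig : ∀ z, z ∉ ball p s → z ∈ ball w 1 → b ≤ lap θ z := fun z hz hzw => by
    rw [hθ, lap_max_pow, hb]
    have h1 : R ^ 2 - (R - 1) ^ 2 ≤ max (R ^ 2 - sqd p 0 z) 0 := by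
      refine le_max_of_le_left ?_
      have : dist z p ≤ R - 1 := by
        rw [mem_ball] at hzw
        rw [hR]; linarith [dist_triangle z w p]
      have : dist z p ^ 2 ≤ (R - 1) ^ 2 := pow_le_pow_left₀ dist_nonneg this 2
      rw [hsq]; linarith
    have h2 : 0 ≤ R ^ 2 - (R - 1) ^ 2 := by nlinarith
    have h3 : 0 ≤ n * s ^ 2 - R ^ 2 := by linarith
    have := hfac z hz
    gcongr
  obtain ⟨e, he⟩ : ∃ e, e = b⁻¹ := ⟨_, rfl⟩
  have he0 : 0 < e := he ▸ inv_pos.2 hb0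
  obtain ⟨a, ha⟩ : ∃ a, a = 1 + e * B := ⟨_, rfl⟩
  have ha0 : 0 < a := by rw [ha]; positivity
  refine ⟨1, one_pos, a * k, by positivity, a * C + e * (R ^ 2) ^ (n + 3), fun u hu => ?_⟩
  obtain ⟨ψ, hψ, hψC, hψl⟩ := hC u hu
  refine ⟨fun z => a * ψ z + e * θ z, (contDiff_const.mul hψ).add (contDiff_const.mul hθd),
    fun z => ?_, fun z hz => ?_⟩
  · have h0 : 0 ≤ θ z := by rw [hθ]; positivity
    have h1 : θ z ≤ (R ^ 2) ^ (n + 3) := by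
      rw [hθ]; exact pow_le_pow_left₀ (le_max_right _ _) (hmax z) _
    calc |a * ψ z + e * θ z| ≤ |a * ψ z| + |e * θ z| := abs_add_le _ _
      _ = a * |ψ z| + e * θ z := by
        rw [abs_mul, abs_of_pos ha0, abs_of_nonneg (mul_nonneg he0.le h0)]
      _ ≤ _ := by gcongr; exact hψC z
  · rw [lap_lin hψ hθd]
    obtain ⟨h1, h2⟩ := hψl z hz
    have hre : a * k * lap u z + (a * lap ψ z + e * lap θ z)
        = a * (k * lap u z + lap ψ z) + e * lap θ z := by ring
    rw [hre]
    by_cases hzp : z ∈ ball p s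
    · have h3 := mul_le_mul_of_nonneg_left (h2 hzp) ha0.le
      have h4 := mul_le_mul_of_nonneg_left (hlow z) he0.le
      have : 1 ≤ a * (k * lap u z + lap ψ z) + e * lap θ z := by rw [ha] at h3 ⊢; linarith
      exact ⟨by linarith, fun _ => this⟩
    · have h3 := mul_nonneg ha0.le h1
      refine ⟨add_nonneg h3 (mul_nonneg he0.le (hoff z hzp)), fun hzw => ?_⟩
      have h4 := mul_le_mul_of_nonneg_left (hbig z hzp hzw) he0.le
      rw [he, inv_mul_cancel₀ hb0.ne', ← he] at h4
      linarith


/-- The derivative of `logCut`. -/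
noncomputable def logCut' (t : ℝ) : ℝ := max (1 - t) 0 ^ 2 / t

/-- A `C²` function on `(0, ∞)` behaving like `log` at `0` and vanishing on `[1, ∞)`. -/
noncomputable def logCut (t : ℝ) : ℝ := ∫ x in (1 : ℝ)..t, logCut' x

lemma continuousOn_logCut' : ContinuousOn logCut' (Ioi 0) :=
  ContinuousOn.div (by fun_prop) continuousOn_id fun x hx => (ne_of_gt hx)

lemma uIcc_one_subset {t : ℝ} (ht : 0 < t) : uIcc 1 t ⊆ Ioi 0 := fun _ hx =>
  lt_of_lt_of_le (lt_min one_pos ht) hx.1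

lemma hasDerivAt_logCut {t : ℝ} (ht : 0 < t) : HasDerivAt logCut (logCut' t) t := by
  have hc : ContinuousAt logCut' t := continuousOn_logCut'.continuousAt (Ioi_mem_nhds ht)
  exact intervalIntegral.integral_hasDerivAt_right
    ((continuousOn_logCut'.mono (uIcc_one_subset ht)).intervalIntegrable)
    (continuousOn_logCut'.stronglyMeasurableAtFilter isOpen_Ioi t ht) hc

lemma hasDerivAt_logCut' {t : ℝ} (ht : 0 < t) :
    HasDerivAt logCut' (-(2 * max (1 - t) 0) / t - max (1 - t) 0 ^ 2 / t ^ 2) t := by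
  have h1 : HasDerivAt (fun t : ℝ => max (1 - t) 0 ^ 2) (-(2 * max (1 - t) 0)) t := by
    have := (hasDerivAt_max_pow 0 (1 - t)).comp t ((hasDerivAt_id t).const_sub 1)
    exact this.congr_deriv (by simp)
  refine (h1.div (hasDerivAt_id t) ht.ne').congr_deriv ?_
  simp only [id]
  field_simp

lemma contDiffOn_logCut : ContDiffOn ℝ 2 logCut (Ioi 0) := by
  have h1 : ContDiffOn ℝ 1 logCut' (Ioi 0) :=
    (((contDiff_max_pow 1).comp (contDiff_const.sub contDiff_id)).contDiffOn).div contDiffOn_id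
      fun x hx => ne_of_gt hx
  rw [show (2 : WithTop ℕ∞) = 1 + 1 by norm_num, contDiffOn_succ_iff_deriv_of_isOpen isOpen_Ioi]
  refine ⟨fun t ht => (hasDerivAt_logCut ht).differentiableAt.differentiableWithinAt, by simp, ?_⟩
  exact h1.congr fun t ht => (hasDerivAt_logCut ht).deriv

lemma logCut'_nonneg {t : ℝ} (ht : 0 < t) : 0 ≤ logCut' t := by
  unfold logCut'; positivity

lemma monotoneOn_logCut : MonotoneOn logCut (Ioi 0) :=
  monotoneOn_of_deriv_nonneg (convex_Ioi 0)
    (fun t ht => (hasDerivAt_logCut ht).continuousAt.continuousWithinAt)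
    (fun t ht => (hasDerivAt_logCut (by simpa using ht)).differentiableAt.differentiableWithinAt)
    fun t ht => by
      have ht' : 0 < t := by simpa using ht
      rw [(hasDerivAt_logCut ht').deriv]
      exact logCut'_nonneg ht'

lemma logCut_one : logCut 1 = 0 := intervalIntegral.integral_same

lemma logCut_of_one_le {t : ℝ} (ht : 1 ≤ t) : logCut t = 0 := by
  refine (intervalIntegral.integral_congr (g := fun _ => 0) fun x hx => ?_).trans
    intervalIntegral.integral_zero
  rw [uIcc_of_le ht] at hx
  simp [logCut', max_eq_right (sub_nonpos.2 hx.1)]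

lemma logCut_nonpos {t : ℝ} (ht : 0 < t) : logCut t ≤ 0 := by
  rcases le_total t 1 with h | h
  · exact (monotoneOn_logCut ht (mem_Ioi.2 one_pos) h).trans_eq logCut_one
  · exact (logCut_of_one_le h).le

lemma logCut_le {t : ℝ} (ht : 0 < t) (h1 : t ≤ 1) : logCut t ≤ Real.log t + 2 := by
  have hd : ∀ t ∈ Ioi (0 : ℝ), HasDerivAt (fun t => Real.log t - 2 * t - logCut t)
      (t⁻¹ - 2 - logCut' t) t := fun t ht =>
    (((Real.hasDerivAt_log (ne_of_gt ht)).sub ((hasDerivAt_id t).const_mul 2)).sub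
      (hasDerivAt_logCut ht)).congr_deriv (by simp)
  have hm : AntitoneOn (fun t => Real.log t - 2 * t - logCut t) (Ioc 0 1) := by
    refine antitoneOn_of_deriv_nonpos (convex_Ioc 0 1)
      (fun t ht => (hd t ht.1).continuousAt.continuousWithinAt) (fun t ht => ?_) fun t ht => ?_
    · rw [interior_Ioc] at ht
      exact (hd t ht.1).differentiableAt.differentiableWithinAt
    · rw [interior_Ioc] at ht
      have h0 : 0 < t := ht.1
      rw [(hd t ht.1).deriv, logCut', max_eq_left (by linarith [ht.2])]
      have : t⁻¹ - 2 - (1 - t) ^ 2 / t = -t := by field_simp; ring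
      rw [this]; linarith
  have h2 := hm ⟨ht, h1⟩ (right_mem_Ioc.2 one_pos) h1
  simp only [Real.log_one, logCut_one] at h2
  linarith

/-- A regularized logarithmic pole at `w`. -/
noncomputable def pole (w : ℂ) (b τ : ℝ) (z : ℂ) : ℝ := logCut (sqd w τ z / b)

lemma sqd_pos (w z : ℂ) {τ : ℝ} (hτ : 0 < τ) : 0 < sqd w τ z := by
  rw [sqd_eq]; positivity

lemma contDiff_pole (w : ℂ) {b τ : ℝ} (hb : 0 < b) (hτ : 0 < τ) : ContDiff ℝ 2 (pole w b τ) :=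
  contDiff_iff_contDiffAt.2 fun z =>
    (contDiffOn_logCut.contDiffAt (Ioi_mem_nhds (div_pos (sqd_pos w z hτ) hb))).comp z
      (((contDiff_sqd w τ).div_const b).contDiffAt)

lemma lap_pole (w : ℂ) {b τ : ℝ} (hb : 0 < b) (hτ : 0 < τ) (z : ℂ) :
    lap (pole w b τ) z = 4 * τ * max (1 - sqd w τ z / b) 0 ^ 2 / sqd w τ z ^ 2
      - 8 / b * max (1 - sqd w τ z / b) 0 * ((sqd w τ z - τ) / sqd w τ z) := by
  have hx := sqd_pos w z hτ
  have h1 : ∀ x : ℝ, 0 < x → HasDerivAt (fun x => logCut (x / b)) (logCut' (x / b) / b) x := by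
    intro x hx
    refine ((hasDerivAt_logCut (div_pos hx hb)).comp x ((hasDerivAt_id x).div_const b)).congr_deriv
        ?_
    simp [div_eq_mul_inv]
  have h2 := ((hasDerivAt_logCut' (div_pos hx hb)).comp (sqd w τ z)
    ((hasDerivAt_id (sqd w τ z)).div_const b)).div_const b
  unfold pole
  rw [lap_radial (h := fun x => logCut (x / b)) (h' := fun x => logCut' (x / b) / b)
    (Eventually.of_forall fun y => h1 _ (sqd_pos w y hτ)) h2]
  simp only [logCut']
  field_simp
  ring

lemma lap_pole_ge (w : ℂ) {b τ : ℝ} (hb : 0 < b) (hτ : 0 < τ) (z : ℂ) :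
    -(8 / b) ≤ lap (pole w b τ) z := by
  rw [lap_pole w hb hτ]
  have hx := sqd_pos w z hτ
  have h1 : 0 ≤ 4 * τ * max (1 - sqd w τ z / b) 0 ^ 2 / sqd w τ z ^ 2 := by positivity
  have h2 : max (1 - sqd w τ z / b) 0 ≤ 1 := max_le (by linarith [div_pos hx hb]) zero_le_one
  have h3 : (sqd w τ z - τ) / sqd w τ z ≤ 1 := by
    rw [div_le_one hx]; linarith
  have h4 : 0 ≤ (sqd w τ z - τ) / sqd w τ z :=
    div_nonneg (by rw [sqd_eq]; simp) hx.le
  have h5 : max (1 - sqd w τ z / b) 0 * ((sqd w τ z - τ) / sqd w τ z) ≤ 1 :=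
    mul_le_one₀ h2 h4 h3
  have h6 := mul_le_mul_of_nonneg_left h5 (div_pos (by norm_num : (0:ℝ) < 8) hb).le
  linarith

lemma lap_pole_nonneg (w : ℂ) {b τ : ℝ} (hb : 0 < b) (hτ : 0 < τ) {z : ℂ}
    (hz : b ≤ ‖z - w‖ ^ 2) : 0 ≤ lap (pole w b τ) z := by
  rw [lap_pole w hb hτ]
  have : 1 - sqd w τ z / b ≤ 0 := by
    rw [sub_nonpos, one_le_div hb, sqd_eq]; linarith
  simp [max_eq_right this]


/-- Twice the Cauchy-Riemann operator. -/
noncomputable def dbar (f : ℂ → ℂ) (z : ℂ) : ℂ :=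
  fderiv ℝ f z 1 + Complex.I * fderiv ℝ f z Complex.I

lemma contDiff_dbar {f : ℂ → ℂ} {n m : WithTop ℕ∞} (hf : ContDiff ℝ n f) (h : m + 1 ≤ n) :
    ContDiff ℝ m (dbar f) :=
  ((hf.fderiv_right h).clm_apply contDiff_const).add
    (contDiff_const.mul ((hf.fderiv_right h).clm_apply contDiff_const))

lemma hasCompactSupport_dbar {f : ℂ → ℂ} (hf : HasCompactSupport f) : HasCompactSupport (dbar f) :=
  (hf.fderiv ℝ).comp_left (g := fun L : ℂ →L[ℝ] ℂ => L 1 + Complex.I * L Complex.I) (by simp)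

lemma norm_dbar_sq {f : ℂ → ℂ} {z : ℂ} (hf : DifferentiableAt ℝ f z) :
    ‖dbar f z‖ ^ 2 = (dx (fun z => (f z).re) z - dy (fun z => (f z).im) z) ^ 2
      + (dy (fun z => (f z).re) z + dx (fun z => (f z).im) z) ^ 2 := by
  have hre : HasFDerivAt (fun z => (f z).re) (Complex.reCLM.comp (fderiv ℝ f z)) z :=
    Complex.reCLM.hasFDerivAt.comp z hf.hasFDerivAt
  have him : HasFDerivAt (fun z => (f z).im) (Complex.imCLM.comp (fderiv ℝ f z)) z :=
    Complex.imCLM.hasFDerivAt.comp z hf.hasFDerivAt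
  rw [← Complex.normSq_eq_norm_sq, Complex.normSq_apply, dx, dx, dy, dy, hre.fderiv, him.fderiv,
    dbar]
  simp
  ring

lemma integral_lap_mul_norm_le {β : ℂ → ℂ} {φ : ℂ → ℝ} (hβ : ContDiff ℝ 2 β)
    (hφ : ContDiff ℝ 2 φ) (hc : HasCompactSupport β) :
    ∫ z, lap φ z * ‖β z‖ ^ 2 * Real.exp (φ z) ≤ ∫ z, ‖dbar β z‖ ^ 2 * Real.exp (φ z) := by
  have hp : ContDiff ℝ 2 fun z => (β z).re := Complex.reCLM.contDiff.comp hβ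
  have hq : ContDiff ℝ 2 fun z => (β z).im := Complex.imCLM.contDiff.comp hβ
  have hpc : HasCompactSupport fun z => (β z).re := hc.comp_left (g := Complex.re) rfl
  have hqc : HasCompactSupport fun z => (β z).im := hc.comp_left (g := Complex.im) rfl
  have key := integral_lap_mul_le hp hq hφ hpc hqc
  have e1 : ∀ z, ‖β z‖ ^ 2 = (β z).re ^ 2 + (β z).im ^ 2 := fun z => by
    rw [← Complex.normSq_eq_norm_sq, Complex.normSq_apply]; ring
  have e2 : ∀ z, ‖dbar β z‖ ^ 2 = _ := fun z =>
    norm_dbar_sq ((hβ.differentiable (by norm_num)) z)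
  simp only [e1, e2]
  exact key

lemma norm_integral_mul_sq_le {f g : ℂ → ℂ} {φ : ℂ → ℝ} (hf : Continuous f) (hg : Continuous g)
    (hφ : Continuous φ) (hfc : HasCompactSupport f) (hgc : HasCompactSupport g) {S : Set ℂ}
    (hS : ∀ x, x ∉ S → f x = 0) :
    ‖∫ z, f z * g z‖ ^ 2 ≤ (∫ z, ‖f z‖ ^ 2 * Real.exp (-φ z)) *
      ∫ z in S, ‖g z‖ ^ 2 * Real.exp (φ z) := by
  obtain ⟨a, ha⟩ : ∃ a : ℂ → ℝ, a = fun z => ‖f z‖ * Real.exp (-φ z / 2) := ⟨_, rfl⟩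
  obtain ⟨b, hb⟩ : ∃ b : ℂ → ℝ, b = fun z => ‖g z‖ * Real.exp (φ z / 2) := ⟨_, rfl⟩
  have hac : Continuous a := by rw [ha]; fun_prop
  have hbc : Continuous b := by rw [hb]; fun_prop
  have haK : HasCompactSupport a := by rw [ha]; exact hfc.norm.mul_right
  have hbK : HasCompactSupport b := by rw [hb]; exact hgc.norm.mul_right
  have ha0 : ∀ z, 0 ≤ a z := fun z => by rw [ha]; positivity
  have hb0 : ∀ z, 0 ≤ b z := fun z => by rw [hb]; positivity
  have ha2 : ∀ z, a z ^ 2 = ‖f z‖ ^ 2 * Real.exp (-φ z) := fun z => by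
    rw [ha]; simp only [mul_pow, ← Real.exp_nat_mul]; congr 2; push_cast; ring
  have hb2 : ∀ z, b z ^ 2 = ‖g z‖ ^ 2 * Real.exp (φ z) := fun z => by
    rw [hb]; simp only [mul_pow, ← Real.exp_nat_mul]; congr 2; push_cast; ring
  have hab : ∀ z, ‖f z * g z‖ = a z * b z := fun z => by
    rw [ha, hb, norm_mul]
    have : Real.exp (-φ z / 2) * Real.exp (φ z / 2) = 1 := by
      rw [← Real.exp_add, ← Real.exp_zero]; congr 1; ring
    calc ‖f z‖ * ‖g z‖ = ‖f z‖ * ‖g z‖ * (Real.exp (-φ z / 2) * Real.exp (φ z / 2)) := by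
          rw [this, mul_one]
      _ = _ := by ring
  have h1 : ‖∫ z, f z * g z‖ ≤ ∫ z in S, a z * b z := by
    rw [setIntegral_eq_integral_of_forall_compl_eq_zero fun x hx => by rw [← hab, hS x hx]; simp]
    simp only [← hab]
    exact norm_integral_le_integral_norm _
  have h2 : ∫ z in S, a z * b z ≤ (∫ z in S, a z ^ (2 : ℝ)) ^ ((1 : ℝ) / 2) *
      (∫ z in S, b z ^ (2 : ℝ)) ^ ((1 : ℝ) / 2) :=
    integral_mul_le_Lp_mul_Lq_of_nonneg Real.HolderConjugate.two_two
      (Eventually.of_forall ha0) (Eventually.of_forall hb0)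
      ((hac.memLp_of_hasCompactSupport haK).restrict S)
      ((hbc.memLp_of_hasCompactSupport hbK).restrict S)
  simp only [Real.rpow_two] at h2
  rw [← Real.sqrt_eq_rpow, ← Real.sqrt_eq_rpow] at h2
  have h3 : ‖∫ z, f z * g z‖ ^ 2 ≤ (∫ z in S, a z ^ 2) * ∫ z in S, b z ^ 2 := by
    calc _ ≤ (√(∫ z in S, a z ^ 2) * √(∫ z in S, b z ^ 2)) ^ 2 :=
          pow_le_pow_left₀ (norm_nonneg _) (h1.trans h2) 2
      _ = _ := by
        rw [mul_pow, Real.sq_sqrt (integral_nonneg fun x => sq_nonneg _),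
          Real.sq_sqrt (integral_nonneg fun x => sq_nonneg _)]
  simp only [← ha2, ← hb2]
  refine h3.trans_eq ?_
  rw [setIntegral_eq_integral_of_forall_compl_eq_zero (f := fun z => a z ^ 2)]
  intro x hx
  rw [ha2, hS x hx]; simp


lemma weighted_ineq {β g : ℂ → ℂ} {φ : ℂ → ℝ} (hβ : ContDiff ℝ 2 β) (hβc : HasCompactSupport β)
    (hg : Continuous g) (hgc : HasCompactSupport g) (hφ : ContDiff ℝ 2 φ) {S : Set ℂ}
    (hSm : MeasurableSet S) (hS : ∀ x, x ∉ S → g x = 0) (h1 : ∀ x ∈ S, 1 ≤ lap φ x)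
    (h0 : ∀ x ∈ tsupport β, 0 ≤ lap φ x) :
    ‖∫ z, g z * β z‖ ^ 2 ≤ (∫ z, ‖g z‖ ^ 2 * Real.exp (-φ z)) *
      ∫ z, ‖dbar β z‖ ^ 2 * Real.exp (φ z) := by
  refine (norm_integral_mul_sq_le hg hβ.continuous hφ.continuous hgc hβc hS).trans ?_
  refine mul_le_mul_of_nonneg_left ?_ (integral_nonneg fun x => by positivity)
  refine le_trans ?_ (integral_lap_mul_norm_le hβ hφ hβc)
  have hcl := continuous_lap hφ
  have hcβ := hβ.continuous
  have hcφ := hφ.continuous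
  have hi : Integrable fun z => lap φ z * ‖β z‖ ^ 2 * Real.exp (φ z) := by
    refine Continuous.integrable_of_hasCompactSupport (by fun_prop) ?_
    refine HasCompactSupport.mul_right (HasCompactSupport.mul_left ?_)
    exact hβc.comp_left (g := fun z : ℂ => ‖z‖ ^ 2) (by simp)
  have hi2 : Integrable fun z => ‖β z‖ ^ 2 * Real.exp (φ z) := by
    refine Continuous.integrable_of_hasCompactSupport (by fun_prop) ?_
    refine HasCompactSupport.mul_right ?_
    exact hβc.comp_left (g := fun z : ℂ => ‖z‖ ^ 2) (by simp)
  calc ∫ z in S, ‖β z‖ ^ 2 * Real.exp (φ z)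
      ≤ ∫ z in S, lap φ z * ‖β z‖ ^ 2 * Real.exp (φ z) := by
        refine setIntegral_mono_on hi2.integrableOn hi.integrableOn hSm fun x hx => ?_
        have := h1 x hx
        gcongr
        exact le_mul_of_one_le_left (by positivity) this
    _ ≤ ∫ z, lap φ z * ‖β z‖ ^ 2 * Real.exp (φ z) := by
        refine setIntegral_le_integral hi (Eventually.of_forall fun x => ?_)
        by_cases hx : x ∈ tsupport β
        · have := h0 x hx
          simp only [Pi.zero_apply]
          positivity
        · simp [image_eq_zero_of_notMem_tsupport hx]

lemma dbar_eq_zero_of_notMem_tsupport {β : ℂ → ℂ} {z : ℂ} (h : z ∉ tsupport β) : dbar β z = 0 := by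
  have : fderiv ℝ β z = 0 := by
    by_contra hne
    exact h (support_fderiv_subset ℝ hne)
  simp [dbar, this]

lemma abs_moll_le_of_ball {φ : ContDiffBump (0 : ℂ)} {g : ℂ → ℝ} {A : ℝ} {z : ℂ}
    (hA : ∀ x ∈ ball z φ.rOut, |g x| ≤ A) : |moll φ g z| ≤ A := by
  rw [moll_apply, ← Real.norm_eq_abs]
  calc ‖∫ y, φ.normed volume y * g (z - y)‖ ≤ ∫ y, φ.normed volume y * A := by
        refine norm_integral_le_of_norm_le ((integrable_normed φ).mul_const A)
          (Eventually.of_forall fun y => ?_)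
        rw [norm_mul, Real.norm_of_nonneg (φ.nonneg_normed y)]
        by_cases hy : y ∈ ball (0 : ℂ) φ.rOut
        · exact mul_le_mul_of_nonneg_left (hA _ (by simpa [dist_eq_norm] using hy))
            (φ.nonneg_normed y)
        · rw [← φ.support_normed_eq (μ := volume), Function.notMem_support] at hy
          simp [hy]
    _ = A := by rw [integral_mul_const, φ.integral_normed, one_mul]

lemma tendsto_pole {w z : ℂ} (hz : z ≠ w) {b : ℝ} (hb : 0 < b) :
    Tendsto (fun n : ℕ => pole w b (1 / (n + 1)) z) atTop (nhds (logCut (‖z - w‖ ^ 2 / b))) := by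
  have h1 : 0 < ‖z - w‖ ^ 2 / b := by
    have : 0 < ‖z - w‖ := norm_pos_iff.2 (sub_ne_zero.2 hz)
    positivity
  have h2 : Tendsto (fun n : ℕ => (‖z - w‖ ^ 2 + 1 / ((n : ℝ) + 1)) / b) atTop
      (nhds ((‖z - w‖ ^ 2 + 0) / b)) :=
    (tendsto_const_nhds.add tendsto_one_div_add_atTop_nhds_zero_nat).div_const b
  rw [add_zero] at h2
  have := (hasDerivAt_logCut h1).continuousAt.tendsto.comp h2
  refine this.congr fun n => ?_
  simp only [Function.comp_apply, pole, sqd_eq]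

/-- If smooth functions approximate `r` inside a compact set, the weighted integrals against a
compactly supported function converge. -/
lemma tendsto_integral_exp {r : ℂ → ℝ} {A : ℝ} (hr : Measurable r) (hA : ∀ x, |r x| ≤ A) {w : ℂ}
    {b : ℝ} (hb : 0 < b) {f : ℂ → ℝ} (hf : Continuous f) (hfc : HasCompactSupport f) {L : ℝ}
    (hL : 0 ≤ L) :
    Tendsto (fun n : ℕ => ∫ z, f z * Real.exp (2 * L * moll (bumpSeq n) r z
        + pole w b (1 / (n + 1)) z)) atTop
      (nhds (∫ z, f z * Real.exp (2 * L * r z + logCut (‖z - w‖ ^ 2 / b)))) := by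
  have hn : ∀ n : ℕ, (0 : ℝ) < 1 / (n + 1) := fun n => by positivity
  refine tendsto_integral_of_dominated_convergence (fun z => ‖f z‖ * Real.exp (2 * L * A))
    (fun n => ?_) ((hf.integrable_of_hasCompactSupport hfc).norm.mul_const _)
    (fun n => Eventually.of_forall fun z => ?_) ?_
  · have h1 := (contDiff_moll (φ := bumpSeq n) (n := 0) hr hA).continuous
    have h2 := (contDiff_pole w hb (hn n)).continuous
    exact Continuous.aestronglyMeasurable (by fun_prop)
  · rw [norm_mul, Real.norm_of_nonneg (Real.exp_pos _).le]
    have h1 := (le_abs_self _).trans (abs_moll_le (φ := bumpSeq n) hA z)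
    have h2 : pole w b (1 / (n + 1)) z ≤ 0 := logCut_nonpos (div_pos (sqd_pos w z (hn n)) hb)
    gcongr
    nlinarith
  · have hne : ∀ᵐ z : ℂ, z ≠ w := by simp [ae_iff]
    filter_upwards [ae_tendsto_moll hr hA, hne] with z hz hzw
    exact tendsto_const_nhds.mul ((Real.continuous_exp.tendsto _).comp
      ((hz.const_mul _).add (tendsto_pole hzw hb)))


section

variable {D : Set ℂ} {r : ℂ → ℝ}

/-- Mollifications of a subharmonic function are eventually admissible. -/
lemma IsSub.eventually_adm (h : IsSub D r) {K : Set ℂ} (hK : IsCompact K) (hKD : K ⊆ D)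
    {q : ℂ} {ε A m : ℝ} {η : ℂ → ℝ} (hε : 0 < ε) (hqK : closedBall q (10 * ε) ⊆ K)
    (hA : ∀ z ∈ closedBall q (10 * ε), |r z| ≤ A) (hη : ContDiff ℝ 2 η)
    (hηc : HasCompactSupport η) (hηs : ∀ x, x ∉ ball q ε → η x = 0)
    (hm : m < ∫ x, r x * lap η x) :
    ∀ᶠ n in atTop, Adm q ε A m η (moll (bumpSeq n) (K.indicator r)) := by
  obtain ⟨hmeas, A', hA'⟩ := h.indicator_bdd hK hKD
  have hli : Integrable (lap η) :=
    (continuous_lap hη).integrable_of_hasCompactSupport (hasCompactSupport_lap hηc)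
  have hts : tsupport η ⊆ closedBall q ε := closure_minimal (fun t ht => by
    by_contra hn
    exact ht (hηs t fun h' => hn (ball_subset_closedBall h'))) isClosed_closedBall
  have hlim := tendsto_integral_moll_mul hmeas hA' hli
  have he : ∫ x, K.indicator r x * lap η x = ∫ x, r x * lap η x := by
    congr 1; funext x
    by_cases hx : x ∈ tsupport η
    · rw [indicator_of_mem (hqK (closedBall_subset_closedBall (by linarith) (hts hx)))]
    · rw [lap_eq_zero_of_notMem_tsupport hx]; simp
  rw [he] at hlim
  filter_upwards [hlim.eventually_const_le hm,
    tendsto_bumpSeq.eventually_lt_const (half_pos hε)] with n hn hnε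
  have hball : ∀ z ∈ ball q (9 * ε), ball z ((bumpSeq n).rOut + ε / 2) ⊆ closedBall q (10 * ε) := by
    intro z hz y hy
    rw [mem_ball] at *
    rw [mem_closedBall]
    linarith [dist_triangle y z q]
  refine ⟨contDiff_moll (n := 4) hmeas hA', fun z hz => ?_, fun z hz => ?_, ?_⟩
  · exact h.lap_moll_nonneg hK hKD (half_pos hε) ((hball z hz).trans hqK)
  · refine abs_moll_le_of_ball fun x hx => ?_
    have hx' := hball z hz (ball_subset_ball (by linarith) hx)
    rw [indicator_of_mem (hqK hx')]
    exact hA x hx'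
  · rw [← integral_mul_lap (contDiff_moll (n := 2) hmeas hA') hη hηc]
    exact hn

/-- The weighted a priori inequality for the Cauchy-Riemann operator. -/
lemma IsSub.key_ineq (h : IsSub D r) (hconn : IsPreconnected D) {w : ℂ} (hw : w ∈ D) {c : ℝ}
    (hwc : ∀ᶠ z in nhds w, r z = c) (hne : ∃ z ∈ D, r z ≠ c) :
    ∃ b > 0, ∃ χ : ContDiffBump w, closedBall w χ.rOut ⊆ D ∧ (∀ z ∈ closedBall w χ.rOut, r z = c) ∧
      ∃ M ≥ 0, ∃ L₀ : ℝ, ∀ L ≥ L₀, ∀ β : ℂ → ℂ, ContDiff ℝ 2 β → HasCompactSupport β →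
        tsupport β ⊆ D →
        ‖∫ z, dbar (fun z => (χ z : ℂ)) z * β z‖ ^ 2 ≤ M * Real.exp (-(2 * L * c)) *
          ∫ z, ‖dbar β z‖ ^ 2 * Real.exp (2 * L * r z + logCut (‖z - w‖ ^ 2 / b)) := by
  obtain ⟨q, ε, hε, hqD, η, hη, hη0, hηc, hηs, hηm⟩ := h.exists_test hconn hw hwc hne
  obtain ⟨A, hA⟩ := h.bdd _ hqD (isCompact_closedBall _ _)
  obtain ⟨m, hm⟩ : ∃ m, m = (∫ x, r x * lap η x) / 2 := ⟨_, rfl⟩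
  have hm0 : 0 < m := by rw [hm]; linarith
  have hmlt : m < ∫ x, r x * lap η x := by rw [hm]; linarith
  obtain ⟨s₁, hs₁, k, hk, C, hC⟩ := (corr_base (A := A) hε hm0 hη hη0 hηc hηs).transport w
  obtain ⟨s₂, hs₂, hs₂D⟩ := Metric.eventually_nhds_iff_ball.1 (hwc.and (h.isOpen.mem_nhds hw))
  obtain ⟨s, hs⟩ : ∃ s, s = min s₁ (s₂ / 2) := ⟨_, rfl⟩
  have hs0 : 0 < s := by rw [hs]; exact lt_min hs₁ (half_pos hs₂)
  have hss₁ : s ≤ s₁ := by rw [hs]; exact min_le_left _ _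
  have hss₂ : 2 * s ≤ s₂ := by
    have : s ≤ s₂ / 2 := by rw [hs]; exact min_le_right _ _
    linarith
  obtain ⟨b, hb⟩ : ∃ b, b = s ^ 2 := ⟨_, rfl⟩
  have hb0 : 0 < b := by rw [hb]; positivity
  let χ : ContDiffBump w := ⟨s / 4, s / 2, by positivity, by linarith⟩
  have hrOut : χ.rOut = s / 2 := rfl
  have hrIn : χ.rIn = s / 4 := rfl
  have hwsub : ball w (2 * s) ⊆ D := fun z hz => (hs₂D z (ball_subset_ball hss₂ hz)).2
  have hwcs : ∀ z ∈ ball w (2 * s), r z = c := fun z hz => (hs₂D z (ball_subset_ball hss₂ hz)).1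
  have hχ2 : closedBall w χ.rOut ⊆ ball w (2 * s) := closedBall_subset_ball (by linarith)
  obtain ⟨g, hg⟩ : ∃ g : ℂ → ℂ, g = dbar (fun z => (χ z : ℂ)) := ⟨_, rfl⟩
  have hχd : ContDiff ℝ 2 fun z => (χ z : ℂ) := Complex.ofRealCLM.contDiff.comp χ.contDiff
  have hgc : Continuous g := by
    rw [hg]; exact (contDiff_dbar hχd one_add_one_le_two).continuous
  have hgK : HasCompactSupport g := by
    rw [hg]
    exact hasCompactSupport_dbar
        (χ.hasCompactSupport.comp_left (g := fun x : ℝ => (x : ℂ)) (by simp))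
  have hgS : ∀ z, z ∉ ball w s → g z = 0 := fun z hz => by
    rw [hg]
    refine dbar_eq_zero_of_notMem_tsupport fun hmem => hz ?_
    have h1 : tsupport (fun z => (χ z : ℂ)) ⊆ tsupport χ :=
      closure_mono fun x hx hx' => hx (by simp [hx'])
    have := h1 hmem
    rw [χ.tsupport_eq] at this
    exact closedBall_subset_ball (by linarith) this
  have hgI : ∀ z ∈ ball w (s / 4), g z = 0 := fun z hz => by
    have h1 : (fun z => (χ z : ℂ)) =ᶠ[nhds z] fun _ => 1 := by
      filter_upwards [isOpen_ball.mem_nhds hz] with x hx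
      rw [χ.one_of_mem_closedBall (ball_subset_closedBall hx)]; simp
    rw [hg, dbar, h1.fderiv_eq]; simp
  obtain ⟨N, hN⟩ : ∃ N, N = (1 + 8 / b) / 2 := ⟨_, rfl⟩
  have hN0 : 0 < N := by rw [hN]; positivity
  obtain ⟨l₀, hl₀⟩ : ∃ l₀, l₀ = logCut ((s / 4) ^ 2 / b) := ⟨_, rfl⟩
  obtain ⟨M₁, hM₁⟩ : ∃ M₁, M₁ = (∫ z, ‖g z‖ ^ 2) * Real.exp (2 * N * C - l₀) := ⟨_, rfl⟩
  have hM₁0 : 0 ≤ M₁ := by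
    rw [hM₁]; exact mul_nonneg (integral_nonneg fun z => by positivity) (Real.exp_pos _).le
  refine ⟨b, hb0, χ, hχ2.trans hwsub, fun z hz => hwcs z (hχ2 hz), M₁ * Real.exp (2 * N * C),
    by positivity, N * k, fun L hL β hβ hβc hβD => ?_⟩
  rw [← hg]
  have hL0 : 0 ≤ L := le_trans (by positivity) hL
  obtain ⟨K₀, hK₀⟩ : ∃ K₀, K₀ = tsupport β ∪ closedBall q (10 * ε) ∪ closedBall w s := ⟨_, rfl⟩
  have hK₀c : IsCompact K₀ := by
    rw [hK₀]; exact (hβc.isCompact.union (isCompact_closedBall _ _)).union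
        (isCompact_closedBall _ _)
  have hK₀D : K₀ ⊆ D := by
    rw [hK₀]
    exact union_subset (union_subset hβD hqD) ((closedBall_subset_ball (by linarith)).trans hwsub)
  obtain ⟨δ, hδ, hδD⟩ := hK₀c.exists_cthickening_subset_open h.isOpen hK₀D
  obtain ⟨K, hK⟩ : ∃ K, K = cthickening δ K₀ := ⟨_, rfl⟩
  have hKc : IsCompact K := hK ▸ hK₀c.cthickening
  have hKD : K ⊆ D := hK ▸ hδD
  have hK₀K : K₀ ⊆ K := hK ▸ self_subset_cthickening K₀
  have hballK : ∀ z ∈ K₀, ball z δ ⊆ K := fun z hz y hy => by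
    rw [hK]; exact mem_cthickening_of_dist_le y z δ K₀ hz (mem_ball.1 hy).le
  have hqK : closedBall q (10 * ε) ⊆ K := fun z hz => hK₀K (by
    rw [hK₀]; exact Or.inl (Or.inr hz))
  have hwK₀ : ∀ z ∈ ball w s, z ∈ K₀ := fun z hz => by
    rw [hK₀]; exact Or.inr (ball_subset_closedBall hz)
  have hβK₀ : ∀ z ∈ tsupport β, z ∈ K₀ := fun z hz => by rw [hK₀]; exact Or.inl (Or.inl hz)
  obtain ⟨hmeas, A', hA'⟩ := h.indicator_bdd hKc hKD
  have hdc : Continuous fun z => ‖dbar β z‖ ^ 2 := by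
    have := (contDiff_dbar hβ one_add_one_le_two).continuous
    fun_prop
  have hdK : HasCompactSupport fun z => ‖dbar β z‖ ^ 2 :=
    (hasCompactSupport_dbar hβc).comp_left (g := fun z : ℂ => ‖z‖ ^ 2) (by simp)
  have hlim := tendsto_integral_exp hmeas hA' (w := w) hb0 hdc hdK hL0
  have he : ∫ z, ‖dbar β z‖ ^ 2 * Real.exp (2 * L * K.indicator r z + logCut (‖z - w‖ ^ 2 / b))
      = ∫ z, ‖dbar β z‖ ^ 2 * Real.exp (2 * L * r z + logCut (‖z - w‖ ^ 2 / b)) := by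
    congr 1; funext z
    by_cases hz : z ∈ tsupport β
    · rw [indicator_of_mem (hK₀K (hβK₀ z hz))]
    · simp [dbar_eq_zero_of_notMem_tsupport hz]
  rw [he] at hlim
  refine ge_of_tendsto (hlim.const_mul (M₁ * Real.exp (2 * N * C) * Real.exp (-(2 * L * c)))) ?_
  filter_upwards [h.eventually_adm hKc hKD hε hqK hA hη hηc hηs hmlt,
    tendsto_bumpSeq.eventually_lt_const (half_pos hδ),
    tendsto_bumpSeq.eventually_lt_const hs0] with n hadm hnδ hns
  obtain ⟨u, hu⟩ : ∃ u, u = moll (bumpSeq n) (K.indicator r) := ⟨_, rfl⟩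
  rw [← hu] at hadm ⊢
  have hud : ContDiff ℝ 2 u := hadm.smooth.of_le (by norm_num)
  have hlu : ∀ z ∈ K₀, 0 ≤ lap u z := fun z hz => by
    rw [hu]
    exact h.lap_moll_nonneg hKc hKD (half_pos hδ)
      ((ball_subset_ball (by linarith)).trans (hballK z hz))
  have huc : ∀ z ∈ ball w s, u z = c := fun z hz => by
    rw [hu]
    refine moll_eq fun x hx => ?_
    rw [indicator_of_mem (hballK z (hwK₀ z hz) (ball_subset_ball (by linarith) hx))]
    refine hwcs x ?_
    rw [mem_ball] at *
    linarith [dist_triangle x z w]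
  obtain ⟨ψ, hψ, hψC, hψl⟩ := hC u hadm
  obtain ⟨τ, hτ⟩ : ∃ τ : ℝ, τ = 1 / (n + 1) := ⟨_, rfl⟩
  have hτ0 : 0 < τ := by rw [hτ]; positivity
  rw [← hτ]
  have hσ := contDiff_pole w hb0 hτ0
  obtain ⟨φ, hφ⟩ : ∃ φ : ℂ → ℝ, φ = fun z => 1 * (2 * L * u z + 2 * N * ψ z) + 1 * pole w b τ z :=
    ⟨_, rfl⟩
  have hφ1 : ContDiff ℝ 2 fun z => 2 * L * u z + 2 * N * ψ z :=
    (contDiff_const.mul hud).add (contDiff_const.mul hψ)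
  have hφd : ContDiff ℝ 2 φ := by
    rw [hφ]; exact (contDiff_const.mul hφ1).add (contDiff_const.mul hσ)
  have hlφ : ∀ z, lap φ z = 2 * (L - N * k) * lap u z + 2 * N * (k * lap u z + lap ψ z)
      + lap (pole w b τ) z := fun z => by
    rw [hφ, lap_lin hφ1 hσ, lap_lin hud hψ]; ring
  have hLk : 0 ≤ L - N * k := by linarith
  have hl1 : ∀ z ∈ ball w s, 1 ≤ lap φ z := fun z hz => by
    have h1 := hlu z (hwK₀ z hz)
    have h2 := (hψl z h1).2 (ball_subset_ball hss₁ hz)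
    have h3 := lap_pole_ge w hb0 hτ0 z
    have h4 : 2 * N = 1 + 8 / b := by rw [hN]; ring
    rw [hlφ]
    have h5 := mul_nonneg (mul_nonneg zero_le_two hLk) h1
    have h6 := mul_le_mul_of_nonneg_left h2 (mul_nonneg zero_le_two hN0.le)
    linarith
  have hl0 : ∀ z ∈ tsupport β, 0 ≤ lap φ z := fun z hz => by
    by_cases hzw : z ∈ ball w s
    · exact zero_le_one.trans (hl1 z hzw)
    · have h1 := hlu z (hβK₀ z hz)
      have h2 := (hψl z h1).1
      have h3 : 0 ≤ lap (pole w b τ) z := by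
        refine lap_pole_nonneg w hb0 hτ0 ?_
        rw [mem_ball, not_lt, dist_eq_norm] at hzw
        rw [hb]; gcongr
      rw [hlφ]
      positivity
  have hmain := weighted_ineq hβ hβc hgc hgK hφd measurableSet_ball hgS hl1 hl0
  have hfirst : ∫ z, ‖g z‖ ^ 2 * Real.exp (-φ z) ≤ M₁ * Real.exp (-(2 * L * c)) := by
    have e : M₁ * Real.exp (-(2 * L * c))
        = ∫ z, ‖g z‖ ^ 2 * (Real.exp (2 * N * C - l₀) * Real.exp (-(2 * L * c))) := by
      rw [integral_mul_const, hM₁]; ring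
    rw [e]
    have hK1 : HasCompactSupport fun z => ‖g z‖ ^ 2 :=
      hgK.comp_left (g := fun z : ℂ => ‖z‖ ^ 2) (by simp)
    have hcφ := hφd.continuous
    refine integral_mono (Continuous.integrable_of_hasCompactSupport (by fun_prop) hK1.mul_right)
      (Continuous.integrable_of_hasCompactSupport (by fun_prop) hK1.mul_right) fun z => ?_
    simp only
    by_cases hzg : g z = 0
    · simp [hzg]
    · have hzs : z ∈ ball w s := by by_contra hn; exact hzg (hgS z hn)
      have hzi : s / 4 ≤ ‖z - w‖ := by
        by_contra! hn
        exact hzg (hgI z (by rwa [mem_ball, dist_eq_norm]))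
      have h1 : l₀ ≤ pole w b τ z := by
        rw [hl₀]
        refine monotoneOn_logCut (mem_Ioi.2 (by positivity))
          (mem_Ioi.2 (div_pos (sqd_pos w z hτ0) hb0)) ?_
        rw [sqd_eq]
        have : (s / 4) ^ 2 ≤ ‖z - w‖ ^ 2 := by gcongr
        gcongr
        linarith
      have h2 := (abs_le.1 (hψC z)).1
      rw [← Real.exp_add]
      gcongr
      rw [hφ]
      simp only [huc z hzs]
      nlinarith
  have hsecond : ∫ z, ‖dbar β z‖ ^ 2 * Real.exp (φ z) ≤
      Real.exp (2 * N * C) * ∫ z, ‖dbar β z‖ ^ 2 * Real.exp (2 * L * u z + pole w b τ z) := by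
    rw [← integral_const_mul]
    have hcφ := hφd.continuous
    have hcu := hud.continuous
    have hcσ := hσ.continuous
    refine integral_mono (Continuous.integrable_of_hasCompactSupport (by fun_prop) hdK.mul_right)
      (Continuous.integrable_of_hasCompactSupport (by fun_prop) hdK.mul_right.mul_left) fun z => ?_
    simp only
    have h2 := (abs_le.1 (hψC z)).2
    have : Real.exp (φ z) ≤ Real.exp (2 * N * C) * Real.exp (2 * L * u z + pole w b τ z) := by
      rw [← Real.exp_add]
      gcongr
      rw [hφ]
      nlinarith
    calc _ ≤ ‖dbar β z‖ ^ 2 * (Real.exp (2 * N * C) * Real.exp (2 * L * u z + pole w b τ z)) := by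
          gcongr
      _ = _ := by ring
  refine hmain.trans ?_
  calc _ ≤ (M₁ * Real.exp (-(2 * L * c))) * (Real.exp (2 * N * C) *
        ∫ z, ‖dbar β z‖ ^ 2 * Real.exp (2 * L * u z + pole w b τ z)) := by
        refine mul_le_mul hfirst hsecond (integral_nonneg fun z => by positivity) (by positivity)
    _ = _ := by ring

end


lemma exists_inner_eq {V H : Type*} [AddCommGroup V] [Module ℂ V] [NormedAddCommGroup H]
    [InnerProductSpace ℂ H] [CompleteSpace H] (A : V →ₗ[ℂ] H) (l : V →ₗ[ℂ] ℂ) {M : ℝ}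
    (hM : 0 ≤ M) (h : ∀ v, ‖l v‖ ^ 2 ≤ M * ‖A v‖ ^ 2) :
    ∃ U : H, ‖U‖ ^ 2 ≤ M ∧ ∀ v, l v = inner ℂ U (A v) := by
  obtain ⟨s, hs⟩ := A.rangeRestrict.exists_rightInverse_of_surjective A.range_rangeRestrict
  have hs' : ∀ p : A.range, A (s p) = p := fun p => by
    have := congrArg Subtype.val (LinearMap.congr_fun hs p)
    simpa using this
  have hls : ∀ p : A.range, ‖(l ∘ₗ s) p‖ ≤ √M * ‖p‖ := fun p => by
    have := h (s p)
    rw [hs'] at this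
    refine abs_le_of_sq_le_sq' ?_ (by positivity) |>.2
    rw [mul_pow, Real.sq_sqrt hM]
    exact this
  obtain ⟨g, hg, hgn⟩ := exists_extension_norm_eq A.range ((l ∘ₗ s).mkContinuous (√M) hls)
  refine ⟨(InnerProductSpace.toDual ℂ H).symm g, ?_, fun v => ?_⟩
  · rw [LinearIsometryEquiv.norm_map, hgn]
    calc _ ≤ (√M) ^ 2 := pow_le_pow_left₀ (norm_nonneg _)
          (LinearMap.mkContinuous_norm_le _ (Real.sqrt_nonneg M) hls) 2
      _ = M := Real.sq_sqrt hM
  · rw [InnerProductSpace.toDual_symm_apply]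
    have h1 := hg ⟨A v, v, rfl⟩
    simp only [LinearMap.mkContinuous_apply, LinearMap.comp_apply] at h1
    rw [h1, ← sub_eq_zero, ← map_sub, ← norm_eq_zero]
    have h2 := h (v - s ⟨A v, v, rfl⟩)
    rw [map_sub A, hs'] at h2
    simpa using h2

/-- The `C²` test functions on `D`. -/
def testSpace (D : Set ℂ) : Submodule ℂ (ℂ → ℂ) where
  carrier := {β | ContDiff ℝ 2 β ∧ HasCompactSupport β ∧ tsupport β ⊆ D}
  add_mem' := fun {a b} ha hb => ⟨ha.1.add hb.1, ha.2.1.add hb.2.1,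
    (closure_minimal ((Function.support_add _ _).trans (union_subset_union subset_closure
      subset_closure)) ((isClosed_tsupport a).union (isClosed_tsupport b))).trans
      (union_subset ha.2.2 hb.2.2)⟩
  zero_mem' := ⟨contDiff_const, HasCompactSupport.zero, by
    change tsupport (fun _ => (0 : ℂ)) ⊆ D
    simp [tsupport]⟩
  smul_mem' := fun c a ha => ⟨contDiff_const.smul ha.1, ha.2.1.smul_left (f := fun _ => c),
    (closure_mono (Function.support_const_smul_subset c a)).trans ha.2.2⟩

lemma dbar_add {f g : ℂ → ℂ} {z : ℂ} (hf : DifferentiableAt ℝ f z) (hg : DifferentiableAt ℝ g z) :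
    dbar (f + g) z = dbar f z + dbar g z := by
  simp only [dbar, fderiv_add hf hg, _root_.add_apply]; ring

lemma dbar_const_smul {f : ℂ → ℂ} {z : ℂ} (c : ℂ) (hf : DifferentiableAt ℝ f z) :
    dbar (c • f) z = c * dbar f z := by
  simp only [dbar, fderiv_const_smul hf, _root_.smul_apply, smul_eq_mul]; ring

lemma integrable_mul_of_locallyBounded {D : Set ℂ} {h : ℂ → ℝ}
    (hm : AEStronglyMeasurable h volume)
    (hb : ∀ K ⊆ D, IsCompact K → ∃ A, ∀ᵐ z, z ∈ K → ‖h z‖ ≤ A) {f : ℂ → ℂ} (hf : Continuous f)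
    (hc : HasCompactSupport f) (hs : tsupport f ⊆ D) :
    MemLp (fun z => f z * h z) 2 volume := by
  obtain ⟨A, hA⟩ := hb _ hs hc
  refine MemLp.of_le_mul (c := A) (hf.memLp_of_hasCompactSupport hc (p := 2)) ?_ ?_
  · exact hf.aestronglyMeasurable.mul (Complex.continuous_ofReal.comp_aestronglyMeasurable hm)
  · filter_upwards [hA] with z hz
    rw [norm_mul, mul_comm]
    by_cases hzs : z ∈ tsupport f
    · refine mul_le_mul_of_nonneg_right ?_ (norm_nonneg _)
      simpa using hz hzs
    · simp [image_eq_zero_of_notMem_tsupport hzs]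

/-- A weighted `L²` estimate for test functions yields a weak solution of a Cauchy-Riemann
equation. -/
lemma exists_weak_solution {D : Set ℂ} {h : ℂ → ℝ}
    (hm : AEStronglyMeasurable h volume) (hpos : ∀ z, 0 < h z)
    (hb : ∀ K ⊆ D, IsCompact K → ∃ A, ∀ᵐ z, z ∈ K → ‖h z‖ ≤ A) {g : ℂ → ℂ}
    (hg : Continuous g) (hgc : HasCompactSupport g) {M : ℝ} (hM : 0 ≤ M)
    (hineq : ∀ β ∈ testSpace D, ‖∫ z, g z * β z‖ ^ 2 ≤ M * ∫ z, ‖dbar β z‖ ^ 2 * h z ^ 2) :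
    ∃ u : ℂ → ℂ, AEStronglyMeasurable u volume ∧ Integrable (fun z => ‖u z‖ ^ 2 / h z ^ 2) ∧
      ∫ z, ‖u z‖ ^ 2 / h z ^ 2 ≤ M ∧
      ∀ β ∈ testSpace D, ∫ z, g z * β z = ∫ z, u z * dbar β z := by
  have hmem : ∀ β : testSpace D, MemLp (fun z => dbar β z * h z) 2 volume := fun β =>
    integrable_mul_of_locallyBounded hm hb
      (contDiff_dbar (m := 1) β.2.1 one_add_one_le_two).continuous
      (hasCompactSupport_dbar β.2.2.1) ((closure_minimal (fun z hz => by
        by_contra hn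
        exact hz (dbar_eq_zero_of_notMem_tsupport hn)) (isClosed_tsupport _)).trans β.2.2.2)
  have hdiff : ∀ β : testSpace D, Differentiable ℝ (β : ℂ → ℂ) := fun β =>
    β.2.1.differentiable (by norm_num)
  let A : testSpace D →ₗ[ℂ] Lp ℂ 2 (volume : Measure ℂ) :=
    { toFun := fun β => (hmem β).toLp
      map_add' := fun a b => by
        rw [← MemLp.toLp_add]
        congr 1; funext z
        simp only [Submodule.coe_add, dbar_add (hdiff a z) (hdiff b z), Pi.add_apply]
        ring
      map_smul' := fun c a => by
        rw [RingHom.id_apply, ← MemLp.toLp_const_smul]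
        congr 1; funext z
        simp only [Submodule.coe_smul, dbar_const_smul c (hdiff a z), Pi.smul_apply, smul_eq_mul]
        ring }
  have hgI : ∀ β : testSpace D, Integrable fun z => g z * (β : ℂ → ℂ) z := fun β =>
    (hg.mul β.2.1.continuous).integrable_of_hasCompactSupport hgc.mul_right
  let l : testSpace D →ₗ[ℂ] ℂ :=
    { toFun := fun β => ∫ z, g z * (β : ℂ → ℂ) z
      map_add' := fun a b => by
        rw [← integral_add (hgI a) (hgI b)]
        congr 1; funext z
        simp only [Submodule.coe_add, Pi.add_apply]; ring
      map_smul' := fun c a => by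
        rw [RingHom.id_apply, smul_eq_mul, ← integral_const_mul]
        congr 1; funext z
        simp only [Submodule.coe_smul, Pi.smul_apply, smul_eq_mul]; ring }
  have hA : ∀ β, (A β : ℂ → ℂ) =ᵐ[volume] fun z => dbar β z * h z := fun β =>
    MemLp.coeFn_toLp (hmem β)
  have hnorm : ∀ f : Lp ℂ 2 (volume : Measure ℂ), ‖f‖ ^ 2 = ∫ z, ‖f z‖ ^ 2 := fun f => by
    have h1 := inner_self_eq_norm_sq_to_K (𝕜 := ℂ) f
    rw [L2.inner_def] at h1
    simp only [inner_self_eq_norm_sq_to_K] at h1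
    have h2 : ∫ z, ((‖f z‖ : ℂ)) ^ 2 = ((∫ z, ‖f z‖ ^ 2 : ℝ) : ℂ) := by
      rw [← integral_complex_ofReal]; congr 1; funext z; push_cast; rfl
    have h3 : ((‖f‖ ^ 2 : ℝ) : ℂ) = ((∫ z, ‖f z‖ ^ 2 : ℝ) : ℂ) := by
      rw [← h2]; push_cast; exact h1.symm
    exact_mod_cast h3
  obtain ⟨U, hU, hUl⟩ := exists_inner_eq A l hM fun β => by
    refine (hineq β β.2).trans_eq ?_
    rw [hnorm]
    congr 1
    refine integral_congr_ae ?_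
    filter_upwards [hA β] with z hz
    rw [hz, norm_mul, mul_pow]
    simp
  have hUm : AEStronglyMeasurable U volume := Lp.aestronglyMeasurable U
  have hUh : ∀ z, ‖(starRingEnd ℂ) (U z) * h z‖ ^ 2 / h z ^ 2 = ‖U z‖ ^ 2 := fun z => by
    have := hpos z
    rw [norm_mul, mul_pow, RCLike.norm_conj, Complex.norm_real, Real.norm_of_nonneg this.le]
    field_simp
  refine ⟨fun z => (starRingEnd ℂ) (U z) * h z, ?_, ?_, ?_, fun β hβ => ?_⟩
  · exact (Complex.continuous_conj.comp_aestronglyMeasurable hUm).mul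
      (Complex.continuous_ofReal.comp_aestronglyMeasurable hm)
  · simp only [hUh]
    exact (memLp_two_iff_integrable_sq_norm hUm).1 (Lp.memLp U)
  · simp only [hUh]
    rw [← hnorm]; exact hU
  · have := hUl ⟨β, hβ⟩
    rw [L2.inner_def] at this
    refine this.trans (integral_congr_ae ?_)
    filter_upwards [hA ⟨β, hβ⟩] with z hz
    rw [hz, RCLike.inner_apply]
    ring


/-- A smooth nondecreasing step equal to `0` on `(-∞, 1]` and to `1` on `[2, ∞)`. -/
noncomputable def step (s : ℝ) : ℝ := Real.smoothTransition (s - 1)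

lemma contDiff_step {n : ℕ∞} : ContDiff ℝ n step :=
  Real.smoothTransition.contDiff.comp (contDiff_id.sub contDiff_const)

lemma monotone_step : Monotone step := fun _ _ h =>
  Real.smoothTransition.monotone (sub_le_sub_right h 1)

lemma step_of_le_one {s : ℝ} (h : s ≤ 1) : step s = 0 :=
  Real.smoothTransition.zero_of_nonpos (by linarith)

lemma step_of_two_le {s : ℝ} (h : 2 ≤ s) : step s = 1 :=
  Real.smoothTransition.one_of_one_le (by linarith)

lemma contDiff_deriv_step {n : ℕ} : ContDiff ℝ n (deriv step) := by
  have h : ContDiff ℝ ((n : WithTop ℕ∞) + 1) step := by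
    exact_mod_cast contDiff_step (n := (n + 1 : ℕ))
  exact (contDiff_succ_iff_deriv.1 h).2.2

lemma deriv_step_nonneg (s : ℝ) : 0 ≤ deriv step s := monotone_step.deriv_nonneg

lemma deriv_step_of_lt_one {s : ℝ} (h : s < 1) : deriv step s = 0 := by
  have : step =ᶠ[nhds s] fun _ => 0 := by
    filter_upwards [Iio_mem_nhds h] with x hx using step_of_le_one (le_of_lt hx)
  rw [this.deriv_eq, deriv_const]

lemma deriv_step_of_two_lt {s : ℝ} (h : 2 < s) : deriv step s = 0 := by
  have : step =ᶠ[nhds s] fun _ => 1 := by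
    filter_upwards [Ioi_mem_nhds h] with x hx using step_of_two_le (le_of_lt hx)
  rw [this.deriv_eq, deriv_const]

/-- A scaled radial bump. -/
noncomputable def annBump (t : ℝ) (z : ℂ) : ℝ := deriv step (‖z‖ ^ 2 / t ^ 2) / t ^ 2

lemma contDiff_annBump (t : ℝ) {n : ℕ} : ContDiff ℝ n (annBump t) :=
  (contDiff_deriv_step.comp ((contDiff_norm_sq ℝ).div_const _)).div_const _

lemma annBump_nonneg (t : ℝ) (z : ℂ) : 0 ≤ annBump t z :=
  div_nonneg (deriv_step_nonneg _) (sq_nonneg _)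

lemma annBump_eq_zero {t : ℝ} (ht : 0 < t) {z : ℂ} (hz : 2 * t < ‖z‖) : annBump t z = 0 := by
  rw [annBump, deriv_step_of_two_lt, zero_div]
  rw [lt_div_iff₀ (by positivity)]
  nlinarith

lemma hasCompactSupport_annBump {t : ℝ} (ht : 0 < t) : HasCompactSupport (annBump t) :=
  HasCompactSupport.of_support_subset_isCompact (isCompact_closedBall 0 (2 * t)) fun z hz => by
    by_contra hn
    exact hz (annBump_eq_zero ht (by simpa using hn))

lemma integrable_annBump {t : ℝ} (ht : 0 < t) : Integrable (annBump t) :=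
  ((contDiff_annBump t (n := 0)).continuous).integrable_of_hasCompactSupport
      (hasCompactSupport_annBump ht)

lemma integral_annBump_pos : 0 < ∫ z, annBump 1 z := by
  obtain ⟨s, hs, hs0⟩ : ∃ s : ℝ, 0 ≤ s ∧ deriv step s ≠ 0 := by
    by_contra! h
    have h1 : ∀ s, deriv step s = 0 := fun s => by
      rcases lt_or_ge s 0 with h0 | h0
      · exact deriv_step_of_lt_one (by linarith)
      · exact h s h0
    have h2 := is_const_of_deriv_eq_zero ((contDiff_step (n := 1)).differentiable (by simp)) h1 1 2
    rw [step_of_le_one le_rfl, step_of_two_le le_rfl] at h2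
    exact zero_ne_one h2
  refine ((contDiff_annBump 1 (n := 0)).continuous).integral_pos_of_hasCompactSupport_nonneg_nonzero
    (hasCompactSupport_annBump one_pos) (fun z => annBump_nonneg 1 z) (x := ((√s : ℝ) : ℂ)) ?_
  rw [annBump, Complex.norm_real, Real.norm_of_nonneg (Real.sqrt_nonneg s), Real.sq_sqrt hs]
  simpa using hs0

lemma integral_annBump {t : ℝ} (ht : 0 < t) : ∫ z, annBump t z = ∫ z, annBump 1 z := by
  have h := Measure.integral_comp_inv_smul_of_nonneg (volume : Measure ℂ) (annBump 1) ht.le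
  have h2 : ∀ z : ℂ, annBump 1 (t⁻¹ • z) = t ^ 2 * annBump t z := fun z => by
    rw [annBump, annBump, norm_smul, Real.norm_of_nonneg (inv_nonneg.2 ht.le)]
    have : (t⁻¹ * ‖z‖) ^ 2 / 1 ^ 2 = ‖z‖ ^ 2 / t ^ 2 := by field_simp
    rw [this]; field_simp
  simp only [h2] at h
  rw [integral_const_mul, Complex.finrank_real_complex, smul_eq_mul] at h
  exact mul_left_cancel₀ (by positivity) h

lemma exists_annBump_le : ∃ C, 0 ≤ C ∧ ∀ t z, annBump t z ≤ C / t ^ 2 := by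
  obtain ⟨C, hC⟩ := (isCompact_Icc (a := (1 : ℝ)) (b := 2)).exists_bound_of_continuousOn
    (contDiff_deriv_step (n := 0)).continuous.continuousOn
  refine ⟨max C 0, le_max_right _ _, fun t z => div_le_div_of_nonneg_right ?_ (sq_nonneg t)⟩
  rcases lt_or_ge (‖z‖ ^ 2 / t ^ 2) 1 with h | h
  · rw [deriv_step_of_lt_one h]; exact le_max_right _ _
  rcases lt_or_ge 2 (‖z‖ ^ 2 / t ^ 2) with h' | h'
  · rw [deriv_step_of_two_lt h']; exact le_max_right _ _
  · exact ((Real.le_norm_self _).trans (hC _ ⟨h, h'⟩)).trans (le_max_left _ _)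

/-- The Cauchy kernel with its singularity cut off at scale `t`. -/
noncomputable def cauchyCut (t : ℝ) (z : ℂ) : ℂ := step (‖z‖ ^ 2 / t ^ 2) * z⁻¹

lemma cauchyCut_eventually_zero {t : ℝ} (ht : 0 < t) : cauchyCut t =ᶠ[nhds 0] fun _ => 0 := by
  filter_upwards [ball_mem_nhds (0 : ℂ) ht] with z hz
  rw [cauchyCut, step_of_le_one]
  · simp
  · rw [div_le_one (by positivity)]
    exact pow_le_pow_left₀ (norm_nonneg _) (by simpa using (mem_ball.1 hz).le) 2

lemma contDiff_cauchyCut {t : ℝ} (ht : 0 < t) : ContDiff ℝ 2 (cauchyCut t) := by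
  rw [contDiff_iff_contDiffAt]
  intro z
  rcases eq_or_ne z 0 with rfl | hz
  · exact contDiffAt_const.congr_of_eventuallyEq (cauchyCut_eventually_zero ht)
  · refine ContDiffAt.mul ?_ (contDiffAt_inv ℝ hz)
    exact (Complex.ofRealCLM.contDiff.comp ((contDiff_step (n := 2)).comp
      ((contDiff_norm_sq ℝ).div_const _))).contDiffAt

lemma dbar_cauchyCut {t : ℝ} (ht : 0 < t) (z : ℂ) : dbar (cauchyCut t) z = 2 * annBump t z := by
  rcases eq_or_ne z 0 with rfl | hz
  · rw [dbar, (cauchyCut_eventually_zero ht).fderiv_eq, annBump, deriv_step_of_lt_one (by simp)]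
    simp
  · have h1 : HasFDerivAt (fun z : ℂ => ‖z‖ ^ 2 / t ^ 2)
        ((t ^ 2)⁻¹ • (2 • innerSL ℝ z)) z := by
      simpa [div_eq_inv_mul] using ((hasStrictFDerivAt_norm_sq z).hasFDerivAt).const_mul ((t ^ 2)⁻¹)
    have h2 : HasDerivAt step (deriv step (‖z‖ ^ 2 / t ^ 2)) (‖z‖ ^ 2 / t ^ 2) :=
      ((contDiff_step (n := 1)).differentiable (by simp) _).hasDerivAt
    have h3 := Complex.ofRealCLM.hasFDerivAt.comp z (h2.comp_hasFDerivAt z h1)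
    have h4 : HasFDerivAt (fun z : ℂ => z⁻¹) _ z := (hasDerivAt_inv hz).hasFDerivAt.restrictScalars
        ℝ
    have h5 : HasFDerivAt (cauchyCut t) _ z := h3.mul h4
    rw [dbar, h5.fderiv, annBump]
    simp
    field_simp
    linear_combination (-((step (‖z‖ ^ 2 / t ^ 2) : ℝ) : ℂ)) * Complex.I_sq
      + (z * ((deriv step (‖z‖ ^ 2 / t ^ 2) : ℝ) : ℂ) * 2 / t ^ 2) * Complex.re_add_im z

lemma cauchyCut_sub_eq_zero {s t : ℝ} (hs : 0 < s) (hst : s ≤ t) {z : ℂ} (hz : 2 * t < ‖z‖) :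
    cauchyCut s z - cauchyCut t z = 0 := by
  have h : ∀ x, 0 < x → x ≤ t → step (‖z‖ ^ 2 / x ^ 2) = 1 := fun x hx hxt => by
    refine step_of_two_le ?_
    rw [le_div_iff₀ (by positivity)]
    nlinarith
  rw [cauchyCut, cauchyCut, h s hs hst, h t (hs.trans_le hst) le_rfl, sub_self]

lemma dbar_comp_const_sub {f : ℂ → ℂ} (hf : Differentiable ℝ f) (a z : ℂ) :
    dbar (fun y => f (a - y)) z = -dbar f (a - z) := by
  have h : HasFDerivAt (fun y => f (a - y)) ((fderiv ℝ f (a - z)).comp (-.id ℝ ℂ)) z :=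
    (hf (a - z)).hasFDerivAt.comp z ((hasFDerivAt_id z).const_sub a)
  rw [dbar, h.fderiv, dbar]
  simp; ring

lemma tsupport_comp_const_sub_subset {f : ℂ → ℂ} {R : ℝ} (hf : ∀ z, R < ‖z‖ → f z = 0) (a : ℂ) :
    tsupport (fun y => f (a - y)) ⊆ closedBall a R :=
  closure_minimal (fun y hy => by
    by_contra hn
    refine hy (hf _ ?_)
    rw [mem_closedBall, dist_comm, dist_eq_norm] at hn
    exact not_le.1 hn) isClosed_closedBall

lemma mem_testSpace_comp_const_sub {D : Set ℂ} {f : ℂ → ℂ} {R : ℝ} (hf : ∀ z, R < ‖z‖ → f z = 0)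
    (hf2 : ContDiff ℝ 2 f) {a : ℂ} (ha : closedBall a R ⊆ D) :
    (fun y => f (a - y)) ∈ testSpace D :=
  ⟨hf2.comp (contDiff_const.sub contDiff_id),
    HasCompactSupport.of_support_subset_isCompact (isCompact_closedBall a R)
      (subset_closure.trans (tsupport_comp_const_sub_subset hf a)),
    (tsupport_comp_const_sub_subset hf a).trans ha⟩

/-- Regularization of `F` at scale `t`. -/
noncomputable def annMoll (F : ℂ → ℂ) (t : ℝ) (z : ℂ) : ℂ :=
  (∫ y, annBump 1 y)⁻¹ • ∫ y, annBump t (z - y) • F y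

/-- Weakly holomorphic functions. -/
structure WeakHol (D : Set ℂ) (F : ℂ → ℂ) : Prop where
  isOpen : IsOpen D
  loc : LocallyIntegrableOn F D
  weak : ∀ β ∈ testSpace D, ∫ y, F y * dbar β y = 0

lemma integrable_annBump_smul {F : ℂ → ℂ} {t : ℝ} (ht : 0 < t) {z : ℂ}
    (hF : IntegrableOn F (closedBall z (2 * t))) :
    Integrable fun y => annBump t (z - y) • F y := by
  have h1 : Integrable ((closedBall z (2 * t)).indicator F) :=
    (integrable_indicator_iff measurableSet_closedBall).2 hF
  obtain ⟨C, hC, hC'⟩ := exists_annBump_le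
  have h2 := h1.bdd_mul (c := C / t ^ 2) (f := fun y => (annBump t (z - y) : ℂ))
    (Continuous.aestronglyMeasurable (by
      have := (contDiff_annBump t (n := 0)).continuous
      fun_prop)) (Eventually.of_forall fun y => by
      rw [Complex.norm_real, Real.norm_of_nonneg (annBump_nonneg _ _)]
      exact hC' t _)
  refine h2.congr (Eventually.of_forall fun y => ?_)
  by_cases hy : y ∈ closedBall z (2 * t)
  · simp [indicator_of_mem hy]
  · rw [mem_closedBall, dist_comm, dist_eq_norm] at hy
    simp [annBump_eq_zero ht (not_le.1 hy)]

lemma WeakHol.annMoll_eq {D : Set ℂ} {F : ℂ → ℂ} (h : WeakHol D F) {s t : ℝ} (hs : 0 < s)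
    (hst : s ≤ t) {z : ℂ} (hz : closedBall z (2 * t) ⊆ D) : annMoll F s z = annMoll F t z := by
  have ht := hs.trans_le hst
  have hgI : IntegrableOn F (closedBall z (2 * t)) :=
    h.loc.integrableOn_compact_subset hz (isCompact_closedBall _ _)
  have h1 := h.weak _ (mem_testSpace_comp_const_sub (f := fun z => cauchyCut s z - cauchyCut t z)
    (fun y hy => cauchyCut_sub_eq_zero hs hst hy)
    ((contDiff_cauchyCut hs).sub (contDiff_cauchyCut ht)) hz)
  have h2 : ∀ y, F y * dbar (fun y => cauchyCut s (z - y) - cauchyCut t (z - y)) y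
      = (-2) * (annBump s (z - y) • F y - annBump t (z - y) • F y) := fun y => by
    rw [dbar_comp_const_sub (f := fun z => cauchyCut s z - cauchyCut t z)
      ((((contDiff_cauchyCut hs).sub (contDiff_cauchyCut ht))).differentiable (by norm_num))]
    have : dbar (fun z => cauchyCut s z - cauchyCut t z) (z - y)
        = dbar (cauchyCut s) (z - y) - dbar (cauchyCut t) (z - y) := by
      rw [dbar, fderiv_fun_sub (((contDiff_cauchyCut hs).differentiable (by norm_num)) _)
        (((contDiff_cauchyCut ht).differentiable (by norm_num)) _), dbar, dbar]
      simp; ring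
    rw [this, dbar_cauchyCut hs, dbar_cauchyCut ht, Complex.real_smul, Complex.real_smul]
    ring
  simp only [h2] at h1
  rw [integral_const_mul, integral_sub] at h1
  · rw [annMoll, annMoll, sub_eq_zero.1 ((mul_eq_zero.1 h1).resolve_left (by norm_num))]
  · exact integrable_annBump_smul hs (hgI.mono_set (closedBall_subset_closedBall (by linarith)))
  · exact integrable_annBump_smul ht hgI


lemma integral_annBump_sub {t : ℝ} (ht : 0 < t) (z : ℂ) :
    ∫ y, annBump t (z - y) = ∫ y, annBump 1 y := by
  rw [integral_sub_left_eq_self (annBump t), integral_annBump ht]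

lemma norm_annMoll_sq_le {F : ℂ → ℂ} {t : ℝ} (ht : 0 < t) {z : ℂ}
    (h2 : Integrable fun y => annBump t (z - y) * ‖F y‖ ^ 2) :
    ‖annMoll F t z‖ ^ 2 ≤ (∫ y, annBump 1 y)⁻¹ * ∫ y, annBump t (z - y) * ‖F y‖ ^ 2 := by
  have hm := integral_annBump_pos
  obtain ⟨P, hP⟩ : ∃ P, P = (∫ y, annBump 1 y)⁻¹ * ∫ y, annBump t (z - y) * ‖F y‖ ^ 2 := ⟨_, rfl⟩
  have key : ∀ s > 0, ‖annMoll F t z‖ ≤ s / 2 + P / (2 * s) := fun s hs => by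
    have h3 : ‖∫ y, annBump t (z - y) • F y‖
        ≤ ∫ y, (s / 2 * annBump t (z - y) + (2 * s)⁻¹ * (annBump t (z - y) * ‖F y‖ ^ 2)) := by
      refine norm_integral_le_of_norm_le
          ((((integrable_annBump ht).comp_sub_left z).const_mul _).add
        (h2.const_mul _)) (Eventually.of_forall fun y => ?_)
      have ha := annBump_nonneg t (z - y)
      rw [norm_smul, Real.norm_of_nonneg ha]
      have : ‖F y‖ ≤ s / 2 + (2 * s)⁻¹ * ‖F y‖ ^ 2 := by
        field_simp
        nlinarith [sq_nonneg (‖F y‖ - s)]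
      calc _ ≤ annBump t (z - y) * (s / 2 + (2 * s)⁻¹ * ‖F y‖ ^ 2) :=
            mul_le_mul_of_nonneg_left this ha
        _ = _ := by ring
    rw [integral_add (((integrable_annBump ht).comp_sub_left z).const_mul _) (h2.const_mul _),
      integral_const_mul, integral_const_mul, integral_annBump_sub ht] at h3
    rw [annMoll, norm_smul, Real.norm_of_nonneg (by positivity)]
    calc _ ≤ _ := mul_le_mul_of_nonneg_left h3 (by positivity)
      _ = _ := by rw [hP]; field_simp
  rw [← hP]
  rcases (norm_nonneg (annMoll F t z)).eq_or_lt with h0 | h0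
  · have : 0 ≤ P := by
      rw [hP]
      exact mul_nonneg (by positivity) (integral_nonneg fun y =>
        mul_nonneg (annBump_nonneg _ _) (sq_nonneg _))
    rw [← h0]; simpa using this
  · have := key _ h0
    rw [← sub_le_iff_le_add', le_div_iff₀ (by positivity)] at this
    nlinarith

/-- The holomorphic representative of a weakly holomorphic function. -/
noncomputable def holRep (F : ℂ → ℂ) (z : ℂ) : ℂ :=
  limUnder (nhdsWithin 0 (Ioi 0)) fun t => annMoll F t z

section

variable {D : Set ℂ} {F : ℂ → ℂ}

lemma WeakHol.eventually_eq (h : WeakHol D F) {t : ℝ} (ht : 0 < t) {z : ℂ}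
    (hz : closedBall z (2 * t) ⊆ D) :
    ∀ᶠ s in nhdsWithin 0 (Ioi 0), annMoll F s z = annMoll F t z := by
  filter_upwards [Ioc_mem_nhdsGT ht] with s hs
  exact h.annMoll_eq hs.1 hs.2 hz

lemma WeakHol.holRep_eq (h : WeakHol D F) {t : ℝ} (ht : 0 < t) {z : ℂ}
    (hz : closedBall z (2 * t) ⊆ D) : holRep F z = annMoll F t z :=
  Tendsto.limUnder_eq (tendsto_const_nhds.congr' ((h.eventually_eq ht hz).mono fun _ h => h.symm))

lemma exists_closedBall_subset (hD : IsOpen D) {z : ℂ} (hz : z ∈ D) :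
    ∃ t > 0, ∀ y ∈ ball z t, closedBall y (2 * t) ⊆ closedBall z (4 * t) ∧ closedBall z (4 * t) ⊆ D
        := by
  obtain ⟨ε, hε, h⟩ := Metric.isOpen_iff.1 hD z hz
  refine ⟨ε / 8, by positivity, fun y hy => ⟨fun x hx => ?_, fun x hx => h ?_⟩⟩
  · rw [mem_ball] at hy
    rw [mem_closedBall] at *
    linarith [dist_triangle x y z]
  · rw [mem_closedBall] at hx
    rw [mem_ball]
    linarith

lemma annMoll_indicator {t : ℝ} (ht : 0 < t) {z : ℂ} {K : Set ℂ} (hK : closedBall z (2 * t) ⊆ K) :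
    annMoll (K.indicator F) t z = annMoll F t z := by
  rw [annMoll, annMoll]
  congr 2; funext y
  by_cases hy : y ∈ closedBall z (2 * t)
  · rw [indicator_of_mem (hK hy)]
  · rw [mem_closedBall, dist_comm, dist_eq_norm] at hy
    simp [annBump_eq_zero ht (not_le.1 hy)]

lemma hasFDerivAt_annMoll (hF : Integrable F) {t : ℝ} (ht : 0 < t) (z : ℂ) :
    HasFDerivAt (annMoll F t) ((∫ y, annBump 1 y)⁻¹ •
      ∫ y, (fderiv ℝ (annBump t) (z - y)).smulRight (F y)) z := by
  have h1 := (hasCompactSupport_annBump ht).hasFDerivAt_convolution_left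
    (ContinuousLinearMap.lsmul ℝ ℝ) (contDiff_annBump t (n := 1)) hF.locallyIntegrable z
  have h2 := h1.const_smul (∫ y, annBump 1 y)⁻¹
  have h3 : annMoll F t = (∫ y, annBump 1 y)⁻¹ •
      convolution (annBump t) F (ContinuousLinearMap.lsmul ℝ ℝ) volume := by
    funext x
    rw [Pi.smul_apply, convolution_eq_swap]; rfl
  rw [h3]
  refine h2.congr_fderiv ?_
  rw [convolution_eq_swap]
  congr 2

lemma WeakHol.differentiableOn_holRep (h : WeakHol D F) : DifferentiableOn ℂ (holRep F) D := by
  intro z hz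
  obtain ⟨t, ht, hb⟩ := exists_closedBall_subset h.isOpen hz
  have hbz := hb z (mem_ball_self ht)
  obtain ⟨K, hK⟩ : ∃ K, K = closedBall z (4 * t) := ⟨_, rfl⟩
  have hev : holRep F =ᶠ[nhds z] annMoll (K.indicator F) t := by
    filter_upwards [ball_mem_nhds z ht] with y hy
    rw [annMoll_indicator ht (hK ▸ (hb y hy).1),
      h.holRep_eq ht ((hb y hy).1.trans (hb y hy).2)]
  refine DifferentiableAt.differentiableWithinAt ?_
  refine DifferentiableAt.congr_of_eventuallyEq ?_ hev
  have hgI : Integrable (K.indicator F) := by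
    rw [hK, integrable_indicator_iff measurableSet_closedBall]
    exact h.loc.integrableOn_compact_subset hbz.2 (isCompact_closedBall _ _)
  have hd := hasFDerivAt_annMoll hgI ht z
  refine differentiableAt_complex_iff_differentiableAt_real.2 ⟨hd.differentiableAt, ?_⟩
  rw [hd.fderiv]
  have hfc : Continuous fun y => fderiv ℝ (annBump t) (z - y) := by
    have := (contDiff_annBump t (n := 1)).continuous_fderiv (by simp)
    fun_prop
  obtain ⟨C, hC⟩ := ((hasCompactSupport_annBump ht).fderiv ℝ).exists_bound_of_continuous
    ((contDiff_annBump t (n := 1)).continuous_fderiv (by simp))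
  have hi : Integrable fun y => (fderiv ℝ (annBump t) (z - y)).smulRight (K.indicator F y) := by
    refine (hgI.norm.const_mul C).mono' ?_ (Eventually.of_forall fun y => ?_)
    · exact (ContinuousLinearMap.smulRightL ℝ ℂ ℂ).aestronglyMeasurable_comp₂
        hfc.aestronglyMeasurable hgI.aestronglyMeasurable
    · rw [ContinuousLinearMap.norm_smulRight_apply]
      exact mul_le_mul_of_nonneg_right (hC _) (norm_nonneg _)
  have hw := h.weak _ (mem_testSpace_comp_const_sub (f := fun z => (annBump t z : ℂ))
    (fun y hy => by rw [annBump_eq_zero ht hy]; rfl)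
    (Complex.ofRealCLM.contDiff.comp (contDiff_annBump t (n := 2))) (hbz.1.trans hbz.2))
  have happ : ∀ v : ℂ, (∫ y, (fderiv ℝ (annBump t) (z - y)).smulRight (K.indicator F y)) v
      = ∫ y, (fderiv ℝ (annBump t) (z - y) v : ℂ) * K.indicator F y := fun v => by
    rw [ContinuousLinearMap.integral_apply hi]
    simp
  have hiv : ∀ v : ℂ, Integrable fun y => (fderiv ℝ (annBump t) (z - y) v : ℂ) * K.indicator F y :=
    fun v => by simpa using hi.apply_continuousLinearMap v
  have hdb : ∀ y, F y * dbar (fun y => (annBump t (z - y) : ℂ)) y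
      = -((fderiv ℝ (annBump t) (z - y) 1 : ℂ) * K.indicator F y
        + Complex.I * ((fderiv ℝ (annBump t) (z - y) Complex.I : ℂ) * K.indicator F y)) := fun y
            => by
    have hd1 : Differentiable ℝ (annBump t) := (contDiff_annBump t (n := 1)).differentiable
        (by simp)
    rw [dbar_comp_const_sub (f := fun z => (annBump t z : ℂ))
      (Complex.ofRealCLM.differentiable.comp hd1)]
    have h5 : HasFDerivAt (fun z => (annBump t z : ℂ))
      (Complex.ofRealCLM.comp (fderiv ℝ (annBump t) (z - y))) (z - y) :=
      Complex.ofRealCLM.hasFDerivAt.comp _ (hd1 _).hasFDerivAt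
    rw [dbar, h5.fderiv]
    by_cases hy : y ∈ K
    · rw [indicator_of_mem hy]; simp; ring
    · have : fderiv ℝ (annBump t) (z - y) = 0 := by
        refine image_eq_zero_of_notMem_tsupport fun hn => hy ?_
        have := closure_minimal (s := Function.support (annBump t)) (t := closedBall 0 (2 * t))
          (fun x hx => by
            by_contra hn
            exact hx (annBump_eq_zero ht (by simpa using hn))) isClosed_closedBall
          (tsupport_fderiv_subset ℝ hn)
        rw [hK]
        apply hbz.1
        rwa [mem_closedBall, dist_comm, dist_eq_norm, ← mem_closedBall_zero_iff]
      rw [this]; simp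
  simp only [hdb] at hw
  rw [integral_neg, neg_eq_zero, integral_add (hiv 1) ((hiv Complex.I).const_mul _),
    integral_const_mul] at hw
  simp only [_root_.smul_apply, happ, smul_eq_mul, Complex.real_smul]
  linear_combination ((((∫ y, annBump 1 y)⁻¹ : ℝ) : ℂ)) * (-Complex.I) * hw +
      (((∫ y, annBump 1 y)⁻¹ : ℝ) : ℂ) *
      (∫ y, (fderiv ℝ (annBump t) (z - y) Complex.I : ℂ) * K.indicator F y) * Complex.I_sq

lemma WeakHol.ae_eq (h : WeakHol D F) : ∀ᵐ z, z ∈ D → holRep F z = F z := by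
  have hmain : volume {z | z ∈ D ∧ holRep F z ≠ F z} = 0 := by
    refine measure_null_of_locally_null _ fun z hz => ?_
    obtain ⟨t, ht, hb⟩ := exists_closedBall_subset h.isOpen hz.1
    have hbz := hb z (mem_ball_self ht)
    obtain ⟨K, hK⟩ : ∃ K, K = closedBall z (4 * t) := ⟨_, rfl⟩
    have hgI : Integrable (K.indicator F) := by
      rw [hK, integrable_indicator_iff measurableSet_closedBall]
      exact h.loc.integrableOn_compact_subset hbz.2 (isCompact_closedBall _ _)
    refine ⟨ball z t ∩ {z | z ∈ D ∧ holRep F z ≠ F z},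
      inter_mem (mem_nhdsWithin_of_mem_nhds (ball_mem_nhds z ht)) self_mem_nhdsWithin, ?_⟩
    have hae := (Besicovitch.vitaliFamily (volume : Measure ℂ)).ae_tendsto_average_norm_sub
      hgI.locallyIntegrable
    refine measure_mono_null ?_ hae
    rintro y ⟨hy, hyD, hyne⟩ hlim
    refine hyne ?_
    have hyK : y ∈ K := by
      rw [hK]; exact (hb y hy).1 (mem_closedBall_self (by positivity))
    have hδ : Tendsto (fun s : ℝ => 2 * s) (nhdsWithin 0 (Ioi 0)) (nhdsWithin 0 (Ioi 0)) := by
      refine tendsto_nhdsWithin_iff.2 ⟨?_, ?_⟩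
      · have : Tendsto (fun s : ℝ => 2 * s) (nhds 0) (nhds (2 * 0)) := by
          exact (continuous_const.mul continuous_id).tendsto 0
        simpa using this.mono_left nhdsWithin_le_nhds
      · filter_upwards [self_mem_nhdsWithin] with s hs
        exact mul_pos (two_pos (α := ℝ)) hs
    have h1 := (hlim.comp (Besicovitch.tendsto_filterAt volume y)).comp hδ
    have hm := integral_annBump_pos
    obtain ⟨C, hC, hC'⟩ := exists_annBump_le
    have h2 := tendsto_integral_smul_of_tendsto_average_norm_sub
      (g := fun s x => (∫ y, annBump 1 y)⁻¹ * annBump s (y - x))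
      ((∫ y, annBump 1 y)⁻¹ * C * (4 * Real.pi)) h1
      (Eventually.of_forall fun i => hgI.integrableOn) ?_ ?_ ?_
    · rw [indicator_of_mem hyK] at h2
      refine tendsto_nhds_unique (tendsto_const_nhds.congr' ?_) h2
      filter_upwards [Ioc_mem_nhdsGT ht] with s hs
      rw [h.holRep_eq ht ((hb y hy).1.trans (hb y hy).2),
        ← h.annMoll_eq hs.1 hs.2 ((hb y hy).1.trans (hb y hy).2), ← annMoll_indicator hs.1 (K := K),
        annMoll, ← integral_smul]
      · simp only [smul_smul]
      · rw [hK]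
        exact (closedBall_subset_closedBall (by linarith [hs.2])).trans (hb y hy).1
    · refine tendsto_const_nhds.congr' ?_
      filter_upwards [self_mem_nhdsWithin] with s hs
      rw [integral_const_mul, integral_annBump_sub hs, inv_mul_cancel₀ hm.ne']
    · filter_upwards [self_mem_nhdsWithin] with s hs x hx
      by_contra hn
      simp only [mem_closedBall] at hn
      rw [dist_comm, dist_eq_norm] at hn
      exact hx (by simp [annBump_eq_zero hs (not_le.1 hn)])
    · filter_upwards [self_mem_nhdsWithin] with s hs x
      have hs' : 0 < s := hs
      rw [abs_of_nonneg (mul_nonneg (by positivity) (annBump_nonneg _ _))]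
      have hv : volume.real (closedBall y (2 * s)) = 4 * Real.pi * s ^ 2 := by
        simp [Measure.real, Complex.volume_closedBall, hs'.le]
        ring
      simp only [hv]
      calc _ ≤ (∫ y, annBump 1 y)⁻¹ * (C / s ^ 2) :=
            mul_le_mul_of_nonneg_left (hC' _ _) (by positivity)
        _ = _ := by field_simp
  filter_upwards [measure_eq_zero_iff_ae_notMem.1 hmain] with z hz hzD
  by_contra hn
  exact hz ⟨hzD, hn⟩

end


section

variable {D : Set ℂ}

lemma integral_mul_dbar {f g : ℂ → ℂ} (hf : ContDiff ℝ 1 f) (hg : ContDiff ℝ 1 g)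
    (hfc : HasCompactSupport f) :
    ∫ z, f z * dbar g z = -∫ z, dbar f z * g z := by
  have hdf := hf.continuous_fderiv (by simp)
  have hdg := hg.continuous_fderiv (by simp)
  have h1 : ∀ v : ℂ, Integrable fun z => fderiv ℝ f z v * g z := fun v =>
    ((hdf.clm_apply continuous_const).mul hg.continuous).integrable_of_hasCompactSupport
      ((hfc.fderiv_apply ℝ v).mul_right)
  have h2 : ∀ v : ℂ, Integrable fun z => f z * fderiv ℝ g z v := fun v =>
    (hf.continuous.mul (hdg.clm_apply continuous_const)).integrable_of_hasCompactSupport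
        hfc.mul_right
  have h3 : Integrable fun z => f z * g z :=
    (hf.continuous.mul hg.continuous).integrable_of_hasCompactSupport hfc.mul_right
  have h4 : ∀ v : ℂ, ∫ z, f z * fderiv ℝ g z v = -∫ z, fderiv ℝ f z v * g z := fun v =>
    integral_mul_fderiv_eq_neg_fderiv_mul_of_integrable (h1 v) (h2 v) h3
      (fun x _ => hf.differentiable (by simp) x) (fun x _ => hg.differentiable (by simp) x)
  have e1 : ∀ z, f z * dbar g z = f z * fderiv ℝ g z 1 + Complex.I * (f z * fderiv ℝ g z Complex.I)
      :=
    fun z => by rw [dbar]; ring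
  have e2 : ∀ z, dbar f z * g z = fderiv ℝ f z 1 * g z + Complex.I * (fderiv ℝ f z Complex.I * g z)
      :=
    fun z => by rw [dbar]; ring
  simp only [e1, e2]
  rw [integral_add (h2 1) ((h2 _).const_mul _), integral_add (h1 1) ((h1 _).const_mul _),
    integral_const_mul, integral_const_mul, h4, h4]
  ring

lemma integrable_mul_dbar {u : ℂ → ℂ} (hu : LocallyIntegrableOn u D) {β : ℂ → ℂ}
    (hβ : β ∈ testSpace D) : Integrable fun z => u z * dbar β z := by
  have hK : IsCompact (tsupport β) := hβ.2.1
  have h1 : Integrable ((tsupport β).indicator u) :=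
    (integrable_indicator_iff hK.measurableSet).2 (hu.integrableOn_compact_subset hβ.2.2 hK)
  have hc : Continuous (dbar β) := (contDiff_dbar (m := 1) hβ.1 one_add_one_le_two).continuous
  obtain ⟨C, hC⟩ := (hasCompactSupport_dbar hβ.2.1).exists_bound_of_continuous hc
  refine (h1.mul_bdd (c := C) hc.aestronglyMeasurable (Eventually.of_forall hC)).congr
    (Eventually.of_forall fun z => ?_)
  by_cases hz : z ∈ tsupport β
  · simp [indicator_of_mem hz]
  · simp [dbar_eq_zero_of_notMem_tsupport hz]

lemma weakHol_add (hD : IsOpen D) {g u : ℂ → ℂ} (hg : ContDiff ℝ 2 g)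
    (hu : LocallyIntegrableOn u D)
    (h : ∀ β ∈ testSpace D, ∫ z, dbar g z * β z = ∫ z, u z * dbar β z) :
    WeakHol D (fun z => g z + u z) := by
  have hgl : LocallyIntegrableOn g D := hg.continuous.locallyIntegrable.locallyIntegrableOn D
  refine ⟨hD, hgl.add hu, fun β hβ => ?_⟩
  simp only [add_mul]
  rw [integral_add (integrable_mul_dbar hgl hβ) (integrable_mul_dbar hu hβ), ← h β hβ]
  have := integral_mul_dbar (hβ.1.of_le (by norm_num)) (hg.of_le (by norm_num)) hβ.2.1
  simp only [mul_comm (β _), mul_comm (dbar β _)] at this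
  rw [this, add_neg_cancel]

lemma locallyIntegrableOn_of_weighted (hD : IsOpen D) {h : ℂ → ℝ} (hpos : ∀ z, 0 < h z)
    (hb : ∀ K ⊆ D, IsCompact K → ∃ A, ∀ᵐ z, z ∈ K → ‖h z‖ ≤ A) {u : ℂ → ℂ}
    (hum : AEStronglyMeasurable u volume) (hu : Integrable fun z => ‖u z‖ ^ 2 / h z ^ 2) :
    (∀ K ⊆ D, IsCompact K → IntegrableOn (fun z => ‖u z‖ ^ 2) K) ∧ LocallyIntegrableOn u D := by
  have h1 : ∀ K ⊆ D, IsCompact K → IntegrableOn (fun z => ‖u z‖ ^ 2) K := fun K hKD hK => by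
    obtain ⟨A, hA⟩ := hb K hKD hK
    refine Integrable.mono' (g := fun z => A ^ 2 * (‖u z‖ ^ 2 / h z ^ 2))
      (hu.const_mul _).integrableOn (hum.norm.pow 2).restrict ?_
    rw [ae_restrict_iff' hK.measurableSet]
    filter_upwards [hA] with z hz hzK
    have := hz hzK
    have hp := hpos z
    rw [Real.norm_of_nonneg hp.le] at this
    rw [Real.norm_of_nonneg (by positivity), mul_div_assoc', le_div_iff₀ (by positivity), mul_comm]
    exact mul_le_mul_of_nonneg_right (pow_le_pow_left₀ hp.le this 2) (by positivity)
  refine ⟨h1, (locallyIntegrableOn_iff hD.isLocallyClosed).2 fun K hKD hK => ?_⟩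
  have h2 : IntegrableOn (fun _ : ℂ => (1 : ℝ)) K := integrableOn_const hK.measure_lt_top.ne
  have h3 : IntegrableOn (fun z => 1 + ‖u z‖ ^ 2) K := h2.add (h1 K hKD hK)
  refine Integrable.mono' h3 hum.restrict (Eventually.of_forall fun z => ?_)
  nlinarith [sq_nonneg (‖u z‖ - 1)]

lemma integrable_annBump_mul {g : ℂ → ℝ} {t : ℝ} (ht : 0 < t) {z : ℂ}
    (hg : IntegrableOn g (closedBall z (2 * t))) :
    Integrable fun y => annBump t (z - y) * g y := by
  have h1 : Integrable ((closedBall z (2 * t)).indicator g) :=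
    (integrable_indicator_iff measurableSet_closedBall).2 hg
  obtain ⟨C, hC, hC'⟩ := exists_annBump_le
  have h2 := h1.bdd_mul (c := C / t ^ 2) (f := fun y => annBump t (z - y))
    (Continuous.aestronglyMeasurable (by
      have := (contDiff_annBump t (n := 0)).continuous
      fun_prop)) (Eventually.of_forall fun y => by
      rw [Real.norm_of_nonneg (annBump_nonneg _ _)]
      exact hC' t _)
  refine h2.congr (Eventually.of_forall fun y => ?_)
  by_cases hy : y ∈ closedBall z (2 * t)
  · simp [indicator_of_mem hy]
  · rw [mem_closedBall, dist_comm, dist_eq_norm] at hy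
    simp [annBump_eq_zero ht (not_le.1 hy)]

lemma exists_norm_annMoll_sq_le : ∃ K, 0 ≤ K ∧ ∀ (F : ℂ → ℂ) (t : ℝ) (z : ℂ), 0 < t →
    IntegrableOn (fun y => ‖F y‖ ^ 2) (closedBall z (2 * t)) →
    ‖annMoll F t z‖ ^ 2 ≤ K / t ^ 2 * ∫ y in closedBall z (2 * t), ‖F y‖ ^ 2 := by
  have hm := integral_annBump_pos
  obtain ⟨C, hC, hC'⟩ := exists_annBump_le
  refine ⟨(∫ y, annBump 1 y)⁻¹ * C, by positivity, fun F t z ht hF => ?_⟩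
  have hi := integrable_annBump_mul ht hF
  refine (norm_annMoll_sq_le ht hi).trans ?_
  rw [mul_div_assoc, mul_assoc]
  refine mul_le_mul_of_nonneg_left ?_ (by positivity)
  rw [← integral_const_mul, ← integral_indicator measurableSet_closedBall]
  refine integral_mono hi ((integrable_indicator_iff measurableSet_closedBall).2 (hF.const_mul _))
    fun y => ?_
  by_cases hy : y ∈ closedBall z (2 * t)
  · rw [indicator_of_mem hy]
    exact mul_le_mul_of_nonneg_right (hC' _ _) (by positivity)
  · rw [indicator_of_notMem hy]
    rw [mem_closedBall, dist_comm, dist_eq_norm] at hy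
    simp [annBump_eq_zero ht (not_le.1 hy)]

lemma annMoll_add {F G : ℂ → ℂ} {t : ℝ} (ht : 0 < t) {z : ℂ}
    (hF : IntegrableOn F (closedBall z (2 * t))) (hG : IntegrableOn G (closedBall z (2 * t))) :
    annMoll (fun z => F z + G z) t z = annMoll F t z + annMoll G t z := by
  rw [annMoll, annMoll, annMoll, ← smul_add,
    ← integral_add (integrable_annBump_smul ht hF) (integrable_annBump_smul ht hG)]
  simp only [smul_add]

lemma annMoll_one {F : ℂ → ℂ} {t : ℝ} (ht : 0 < t) {z : ℂ}
    (hF : ∀ y ∈ closedBall z (2 * t), F y = 1) : annMoll F t z = 1 := by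
  have h1 : ∀ y, annBump t (z - y) • F y = (annBump t (z - y) : ℂ) := fun y => by
    by_cases hy : y ∈ closedBall z (2 * t)
    · simp [hF y hy]
    · rw [mem_closedBall, dist_comm, dist_eq_norm] at hy
      simp [annBump_eq_zero ht (not_le.1 hy)]
  have hm := integral_annBump_pos.ne'
  rw [annMoll]
  simp only [h1]
  rw [integral_complex_ofReal, integral_annBump_sub ht, Complex.real_smul, ← Complex.ofReal_mul,
    inv_mul_cancel₀ hm, Complex.ofReal_one]

/-- Square integrability against `|y - w|⁻²` forces the regularizations to vanish at `w`. -/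
lemma tendsto_annMoll_zero {u : ℂ → ℂ} {w : ℂ} {G : ℂ → ℝ} (hG : Integrable G) {ε B : ℝ}
    (hε : 0 < ε) (hu : IntegrableOn (fun y => ‖u y‖ ^ 2) (closedBall w ε))
    (h : ∀ᵐ y, y ∈ closedBall w ε → ‖u y‖ ^ 2 ≤ B * ‖y - w‖ ^ 2 * G y) :
    Tendsto (fun t => annMoll u t w) (nhdsWithin 0 (Ioi 0)) (nhds 0) := by
  have hm := integral_annBump_pos
  obtain ⟨C, hC, hC'⟩ := exists_annBump_le
  have hvol : Tendsto (fun t => volume (closedBall w (2 * t))) (nhdsWithin 0 (Ioi 0)) (nhds 0) := by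
    have h1 : Tendsto (fun t : ℝ => ENNReal.ofReal (2 * t) ^ 2 * NNReal.pi) (nhds 0)
        (nhds (ENNReal.ofReal (2 * 0) ^ 2 * NNReal.pi)) := by
      refine ENNReal.Tendsto.mul_const ?_ (Or.inr ENNReal.coe_ne_top)
      exact ((ENNReal.continuous_pow 2).comp (ENNReal.continuous_ofReal.comp
        (continuous_const.mul continuous_id))).tendsto 0
    simp only [mul_zero, ENNReal.ofReal_zero, ne_eq, OfNat.ofNat_ne_zero, not_false_eq_true,
      zero_pow, zero_mul] at h1
    simpa only [Complex.volume_closedBall] using h1.mono_left nhdsWithin_le_nhds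
  have hlim := (hG.norm.tendsto_setIntegral_nhds_zero hvol).const_mul
    ((∫ y, annBump 1 y)⁻¹ * (C * 4 * |B|))
  rw [mul_zero] at hlim
  have hsq : Tendsto (fun t => ‖annMoll u t w‖ ^ 2) (nhdsWithin 0 (Ioi 0)) (nhds 0) := by
    refine tendsto_of_tendsto_of_tendsto_of_le_of_le' tendsto_const_nhds hlim
      (Eventually.of_forall fun t => by positivity) ?_
    filter_upwards [Ioc_mem_nhdsGT (half_pos hε)] with t ht
    have hsub : closedBall w (2 * t) ⊆ closedBall w ε :=
      closedBall_subset_closedBall (by linarith [ht.2])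
    have hi := integrable_annBump_mul ht.1 (hu.mono_set hsub)
    refine (norm_annMoll_sq_le ht.1 hi).trans ?_
    rw [mul_assoc]
    refine mul_le_mul_of_nonneg_left ?_ (by positivity)
    rw [← integral_const_mul, ← integral_indicator measurableSet_closedBall]
    refine integral_mono_ae hi ((integrable_indicator_iff measurableSet_closedBall).2
      (hG.norm.integrableOn.const_mul _)) ?_
    filter_upwards [h] with y hy
    by_cases hyt : y ∈ closedBall w (2 * t)
    · rw [indicator_of_mem hyt]
      have h1 := hy (hsub hyt)
      rw [mem_closedBall, dist_eq_norm] at hyt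
      have ht0 := ht.1
      have h2 : ‖y - w‖ ^ 2 ≤ 4 * t ^ 2 := by nlinarith [norm_nonneg (y - w)]
      calc annBump t (w - y) * ‖u y‖ ^ 2 ≤ C / t ^ 2 * (4 * t ^ 2 * (|B| * ‖G y‖)) := by
            refine mul_le_mul (hC' _ _) (h1.trans ?_) (by positivity) (by positivity)
            calc B * ‖y - w‖ ^ 2 * G y ≤ |B * ‖y - w‖ ^ 2 * G y| := le_abs_self _
              _ = ‖y - w‖ ^ 2 * (|B| * ‖G y‖) := by
                rw [abs_mul, abs_mul, abs_of_nonneg (sq_nonneg ‖y - w‖), Real.norm_eq_abs]; ring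
              _ ≤ _ := mul_le_mul_of_nonneg_right h2 (by positivity)
        _ = _ := by field_simp
    · rw [indicator_of_notMem hyt]
      rw [mem_closedBall, dist_comm, dist_eq_norm] at hyt
      simp [annBump_eq_zero ht.1 (not_le.1 hyt)]
  rw [tendsto_zero_iff_norm_tendsto_zero]
  have := (Real.continuous_sqrt.tendsto 0).comp hsq
  simpa [Function.comp_def, Real.sqrt_sq (norm_nonneg _)] using this

end


section

variable {D : Set ℂ} {r : ℂ → ℝ}

lemma exp_half_sq (x : ℝ) : Real.exp (x / 2) ^ 2 = Real.exp x := by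
  rw [← Real.exp_nat_mul]; congr 1; push_cast; ring

/-- The square root of the weight `exp (2 L r + logCut (|z - w|² / b))`. -/
noncomputable def rootWeight (r : ℂ → ℝ) (w : ℂ) (b L : ℝ) (z : ℂ) : ℝ :=
  Real.exp ((2 * L * r z + logCut (‖z - w‖ ^ 2 / b)) / 2)

lemma aestronglyMeasurable_rootWeight (hr : Measurable r) (w : ℂ) {b : ℝ} (hb : 0 < b) (L : ℝ) :
    AEStronglyMeasurable (rootWeight r w b L) volume := by
  have h1 : AEStronglyMeasurable (fun z : ℂ => logCut (‖z - w‖ ^ 2 / b)) volume := by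
    rw [← restrict_compl_singleton (μ := (volume : Measure ℂ)) w]
    refine ContinuousOn.aestronglyMeasurable ?_ (measurableSet_singleton w).compl
    refine contDiffOn_logCut.continuousOn.comp (by fun_prop) fun z hz => ?_
    have : 0 < ‖z - w‖ := norm_pos_iff.2 (sub_ne_zero.2 hz)
    exact mem_Ioi.2 (by positivity)
  refine Real.continuous_exp.comp_aestronglyMeasurable ?_
  have h2 := ((hr.const_mul (2 * L)).aestronglyMeasurable (μ := volume)).add h1
  simpa [div_eq_mul_inv] using h2.mul_const (2⁻¹)

lemma rootWeight_sq_le {w : ℂ} {b L : ℝ} (hb : 0 < b) {z : ℂ} (hz : z ≠ w) :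
    rootWeight r w b L z ^ 2 ≤ Real.exp (2 * L * r z) := by
  rw [rootWeight, exp_half_sq]
  have : 0 < ‖z - w‖ := norm_pos_iff.2 (sub_ne_zero.2 hz)
  have := logCut_nonpos (t := ‖z - w‖ ^ 2 / b) (by positivity)
  exact Real.exp_le_exp.2 (by linarith)

lemma rootWeight_sq_le_mul {w : ℂ} {b L : ℝ} (hb : 0 < b) {z : ℂ} (hz : z ≠ w)
    (hzb : ‖z - w‖ ^ 2 ≤ b) :
    rootWeight r w b L z ^ 2 ≤ Real.exp (2 * L * r z + 2) / b * ‖z - w‖ ^ 2 := by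
  rw [rootWeight, exp_half_sq]
  have h0 : 0 < ‖z - w‖ := norm_pos_iff.2 (sub_ne_zero.2 hz)
  have h1 : 0 < ‖z - w‖ ^ 2 / b := by positivity
  have := logCut_le h1 ((div_le_one hb).2 hzb)
  calc _ ≤ Real.exp (2 * L * r z + 2 + Real.log (‖z - w‖ ^ 2 / b)) :=
        Real.exp_le_exp.2 (by linarith)
    _ = _ := by rw [Real.exp_add, Real.exp_log h1]; ring

lemma ae_ne (w : ℂ) : ∀ᵐ z : ℂ, z ≠ w := by
  simp [ae_iff]

lemma IsSub.exists_holomorphic_of_ineq (h : IsSub D r) {w : ℂ} {c b M L : ℝ}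
    (hb : 0 < b) (hM : 0 ≤ M) (hL : 0 ≤ L) (χ : ContDiffBump w) (hχD : closedBall w χ.rOut ⊆ D)
    (hχc : ∀ z ∈ closedBall w χ.rOut, r z = c)
    (hineq : ∀ β : ℂ → ℂ, ContDiff ℝ 2 β → HasCompactSupport β → tsupport β ⊆ D →
        ‖∫ z, dbar (fun z => (χ z : ℂ)) z * β z‖ ^ 2 ≤ M * Real.exp (-(2 * L * c)) *
          ∫ z, ‖dbar β z‖ ^ 2 * Real.exp (2 * L * r z + logCut (‖z - w‖ ^ 2 / b)))
    {K : ℝ} (hK : ∀ (F : ℂ → ℂ) (t : ℝ) (z : ℂ), 0 < t →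
      IntegrableOn (fun y => ‖F y‖ ^ 2) (closedBall z (2 * t)) →
      ‖annMoll F t z‖ ^ 2 ≤ K / t ^ 2 * ∫ y in closedBall z (2 * t), ‖F y‖ ^ 2) :
    ∃ F : ℂ → ℂ, DifferentiableOn ℂ F D ∧ F w = 1 ∧
      IntegrableOn (fun z => ‖F z‖ ^ 2 * Real.exp (-(2 * L * r z))) D ∧
      ∫ z in D, ‖F z‖ ^ 2 * Real.exp (-(2 * L * r z)) ≤
        (2 * volume.real (closedBall w χ.rOut) + 2 * M) * Real.exp (-(2 * L * c)) ∧
      ∀ z t, 0 < t → closedBall z (2 * t) ⊆ D →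
        ‖F z‖ ^ 2 ≤ K / t ^ 2 * ∫ y in closedBall z (2 * t), ‖F y‖ ^ 2 := by
  obtain ⟨H, hH⟩ : ∃ H, H = rootWeight r w b L := ⟨_, rfl⟩
  have hpos : ∀ z, 0 < H z := fun z => by rw [hH]; exact Real.exp_pos _
  have hHb : ∀ K ⊆ D, IsCompact K → ∃ A, ∀ᵐ z, z ∈ K → ‖H z‖ ≤ A := fun K hKD hKc => by
    obtain ⟨A, hA⟩ := h.bdd K hKD hKc
    refine ⟨Real.exp (L * A), ?_⟩
    filter_upwards [ae_ne w] with z hz hzK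
    rw [Real.norm_of_nonneg (hpos z).le]
    refine (pow_le_pow_iff_left₀ (hpos z).le (Real.exp_pos _).le two_ne_zero).1 ?_
    rw [hH]
    refine (rootWeight_sq_le hb hz).trans ?_
    rw [← Real.exp_nat_mul]
    refine Real.exp_le_exp.2 ?_
    push_cast
    nlinarith [le_of_abs_le (hA z hzK)]
  have hχ : ContDiff ℝ 3 (fun z => (χ z : ℂ)) := Complex.ofRealCLM.contDiff.comp χ.contDiff
  have hχs : HasCompactSupport (fun z => (χ z : ℂ)) :=
    χ.hasCompactSupport.comp_left (g := fun x : ℝ => (x : ℂ)) Complex.ofReal_zero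
  obtain ⟨u, hum, hui, huM, huw⟩ := exists_weak_solution (D := D) (h := H)
    (by rw [hH]; exact aestronglyMeasurable_rootWeight h.meas w hb L) hpos hHb
    (g := dbar (fun z => (χ z : ℂ))) (contDiff_dbar (m := 2) hχ (by norm_num)).continuous
    (hasCompactSupport_dbar hχs) (M := M * Real.exp (-(2 * L * c))) (by positivity)
    (fun β hβ => by
      refine (hineq β hβ.1 hβ.2.1 hβ.2.2).trans (le_of_eq ?_)
      simp only [hH, rootWeight, exp_half_sq])
  obtain ⟨hu2, huloc⟩ := locallyIntegrableOn_of_weighted h.isOpen hpos hHb hum hui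
  have hW := weakHol_add h.isOpen (hχ.of_le (by norm_num)) huloc huw
  obtain ⟨F0, hF0⟩ : ∃ F0, F0 = fun z => (χ z : ℂ) + u z := ⟨_, rfl⟩
  rw [← hF0] at hW
  have hsq : ∀ z, ‖F0 z‖ ^ 2 ≤ 2 * ‖χ z‖ ^ 2 + 2 * ‖u z‖ ^ 2 := fun z => by
    have h1 : ‖F0 z‖ ≤ ‖χ z‖ + ‖u z‖ := by
      rw [hF0]
      refine (norm_add_le _ _).trans (le_of_eq ?_)
      rw [Complex.norm_real]
    nlinarith [norm_nonneg (F0 z), sq_nonneg (‖χ z‖ - ‖u z‖), norm_nonneg (χ z), norm_nonneg (u z)]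
  have hF0m : AEStronglyMeasurable F0 volume := by
    rw [hF0]; exact hχ.continuous.aestronglyMeasurable.add hum
  have hχ1 : ∀ z, ‖χ z‖ ≤ 1 := fun z => by
    rw [Real.norm_of_nonneg χ.nonneg]; exact χ.le_one
  have hF0i : ∀ K ⊆ D, IsCompact K → IntegrableOn (fun z => ‖F0 z‖ ^ 2) K := fun K hKD hKc => by
    have h1 : IntegrableOn (fun _ : ℂ => (2 : ℝ)) K := integrableOn_const hKc.measure_lt_top.ne
    have h2 : IntegrableOn (fun z => 2 + 2 * ‖u z‖ ^ 2) K := h1.add ((hu2 K hKD hKc).const_mul 2)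
    refine Integrable.mono' h2 (hF0m.norm.pow 2).restrict (Eventually.of_forall fun z => ?_)
    rw [Real.norm_of_nonneg (by positivity)]
    have := hsq z
    have := hχ1 z
    have := norm_nonneg (χ z)
    nlinarith
  have hdom : ∀ᵐ z, z ∈ D → ‖holRep F0 z‖ ^ 2 * Real.exp (-(2 * L * r z)) ≤
      (closedBall w χ.rOut).indicator (fun _ => 2 * Real.exp (-(2 * L * c))) z
        + 2 * (‖u z‖ ^ 2 / H z ^ 2) := by
    filter_upwards [hW.ae_eq, ae_ne w] with z hz hzw hzD
    rw [hz hzD]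
    have h1 : 2 * ‖u z‖ ^ 2 * Real.exp (-(2 * L * r z)) ≤ 2 * (‖u z‖ ^ 2 / H z ^ 2) := by
      rw [mul_assoc]
      refine mul_le_mul_of_nonneg_left ?_ two_pos.le
      rw [Real.exp_neg, ← div_eq_mul_inv]
      have := rootWeight_sq_le (r := r) (L := L) hb hzw
      rw [← hH] at this
      exact div_le_div_of_nonneg_left (by positivity) (by have := hpos z; positivity) this
    have h2 : 2 * ‖χ z‖ ^ 2 * Real.exp (-(2 * L * r z)) ≤
        (closedBall w χ.rOut).indicator (fun _ => 2 * Real.exp (-(2 * L * c))) z := by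
      by_cases hzc : z ∈ closedBall w χ.rOut
      · rw [indicator_of_mem hzc, hχc z hzc]
        have : ‖χ z‖ ^ 2 ≤ 1 := pow_le_one₀ (norm_nonneg _) (hχ1 z)
        have := Real.exp_pos (-(2 * L * c))
        nlinarith
      · rw [indicator_of_notMem hzc, χ.zero_of_le_dist (not_le.1 (by simpa using hzc)).le]
        simp
    calc _ ≤ (2 * ‖χ z‖ ^ 2 + 2 * ‖u z‖ ^ 2) * Real.exp (-(2 * L * r z)) :=
          mul_le_mul_of_nonneg_right (hsq z) (Real.exp_pos _).le
      _ ≤ _ := by linarith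
  have hdi1 : Integrable ((closedBall w χ.rOut).indicator
      (fun _ => 2 * Real.exp (-(2 * L * c)))) volume :=
    (integrable_indicator_iff measurableSet_closedBall).2
      (integrableOn_const (isCompact_closedBall _ _).measure_lt_top.ne)
  have hdi : Integrable (fun z => (closedBall w χ.rOut).indicator
      (fun _ => 2 * Real.exp (-(2 * L * c))) z + 2 * (‖u z‖ ^ 2 / H z ^ 2)) volume :=
    hdi1.add (hui.const_mul 2)
  have hdiff := hW.differentiableOn_holRep
  have hFi : IntegrableOn (fun z => ‖holRep F0 z‖ ^ 2 * Real.exp (-(2 * L * r z))) D := by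
    refine Integrable.mono' hdi.integrableOn ?_ ?_
    · refine AEStronglyMeasurable.mul ?_ ?_
      · exact ((hdiff.continuousOn.norm.pow 2).aestronglyMeasurable h.isOpen.measurableSet)
      · exact (Real.measurable_exp.comp (h.meas.const_mul (2 * L)).neg).aestronglyMeasurable
    · rw [ae_restrict_iff' h.isOpen.measurableSet]
      filter_upwards [hdom] with z hz hzD
      rw [Real.norm_of_nonneg (by positivity)]
      exact hz hzD
  refine ⟨holRep F0, hdiff, ?_, hFi, ?_, fun z t ht hz => ?_⟩
  · obtain ⟨ε, hε, hεlt⟩ : ∃ ε, 0 < ε ∧ ε ≤ χ.rIn ∧ ε ^ 2 ≤ b := by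
      refine ⟨min χ.rIn (Real.sqrt b), lt_min χ.rIn_pos (Real.sqrt_pos.2 hb), min_le_left _ _, ?_⟩
      calc _ ≤ Real.sqrt b ^ 2 := pow_le_pow_left₀ (le_min χ.rIn_pos.le (Real.sqrt_nonneg _))
            (min_le_right _ _) 2
        _ = b := Real.sq_sqrt hb.le
    have hεo : closedBall w ε ⊆ closedBall w χ.rOut :=
      closedBall_subset_closedBall (hεlt.1.trans χ.rIn_lt_rOut.le)
    have hlim : Tendsto (fun t => annMoll u t w) (nhdsWithin 0 (Ioi 0)) (nhds 0) := by
      refine tendsto_annMoll_zero (B := Real.exp (2 * L * c + 2) / b) hui hε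
        (hu2 _ (hεo.trans hχD) (isCompact_closedBall _ _)) ?_
      filter_upwards [ae_ne w] with y hyw hy
      have h1 := rootWeight_sq_le_mul (r := r) (L := L) hb hyw (by
        rw [mem_closedBall, dist_eq_norm] at hy
        exact (pow_le_pow_left₀ (norm_nonneg _) hy 2).trans hεlt.2)
      rw [← hH, hχc y (hεo hy)] at h1
      have h2 := hpos y
      rw [mul_div_assoc', le_div_iff₀ (by positivity), mul_comm]
      exact mul_le_mul_of_nonneg_right h1 (by positivity)
    have h3 : ∀ᶠ t in nhdsWithin 0 (Ioi 0), 1 + annMoll u t w = holRep F0 w := by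
      filter_upwards [Ioc_mem_nhdsGT (half_pos hε)] with t ht
      have hsub : closedBall w (2 * t) ⊆ closedBall w ε :=
        closedBall_subset_closedBall (by linarith [ht.2])
      have hsubD := hsub.trans (hεo.trans hχD)
      have hone : annMoll (fun z => (χ z : ℂ)) t w = 1 := annMoll_one ht.1 fun y hy => by
        rw [χ.one_of_mem_closedBall (closedBall_subset_closedBall hεlt.1 (hsub hy)),
          Complex.ofReal_one]
      rw [hW.holRep_eq ht.1 hsubD, hF0, annMoll_add ht.1
        (hχ.continuous.continuousOn.integrableOn_compact (isCompact_closedBall _ _))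
        (((locallyIntegrableOn_iff h.isOpen.isLocallyClosed).1 huloc) _ hsubD
          (isCompact_closedBall _ _)), hone]
    have h4 := (hlim.const_add 1).congr' h3
    rw [add_zero] at h4
    exact tendsto_nhds_unique tendsto_const_nhds h4
  · calc ∫ z in D, ‖holRep F0 z‖ ^ 2 * Real.exp (-(2 * L * r z))
        ≤ ∫ z in D, ((closedBall w χ.rOut).indicator
            (fun _ => 2 * Real.exp (-(2 * L * c))) z + 2 * (‖u z‖ ^ 2 / H z ^ 2)) := by
          refine setIntegral_mono_on_ae hFi hdi.integrableOn h.isOpen.measurableSet hdom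
      _ ≤ ∫ z, ((closedBall w χ.rOut).indicator
            (fun _ => 2 * Real.exp (-(2 * L * c))) z + 2 * (‖u z‖ ^ 2 / H z ^ 2)) := by
          refine setIntegral_le_integral hdi (Eventually.of_forall fun z => ?_)
          exact add_nonneg (indicator_nonneg (fun _ _ => by positivity) z) (by positivity)
      _ = 2 * Real.exp (-(2 * L * c)) * volume.real (closedBall w χ.rOut)
            + 2 * ∫ z, ‖u z‖ ^ 2 / H z ^ 2 := by
          rw [integral_add hdi1 (hui.const_mul 2), integral_indicator measurableSet_closedBall,
            setIntegral_const, integral_const_mul, smul_eq_mul]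
          ring
      _ ≤ _ := by linarith
  · rw [hW.holRep_eq ht hz]
    refine (hK F0 t z ht (hF0i _ hz (isCompact_closedBall _ _))).trans (le_of_eq ?_)
    congr 1
    refine setIntegral_congr_ae measurableSet_closedBall ?_
    filter_upwards [hW.ae_eq] with y hy hyz
    rw [hy (hz hyz)]

/-- Holomorphic functions with value one at `w` that are small in `L²(exp (-2 L r))`. -/
theorem IsSub.exists_holomorphic (h : IsSub D r) (hconn : IsPreconnected D) {w : ℂ} (hw : w ∈ D)
    {c : ℝ} (hwc : ∀ᶠ z in nhds w, r z = c) (hne : ∃ z ∈ D, r z ≠ c) :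
    ∃ C ≥ 0, ∃ K ≥ 0, ∃ L₀ : ℝ, ∀ L ≥ L₀, ∃ F : ℂ → ℂ, DifferentiableOn ℂ F D ∧ F w = 1 ∧
      IntegrableOn (fun z => ‖F z‖ ^ 2 * Real.exp (-(2 * L * r z))) D ∧
      ∫ z in D, ‖F z‖ ^ 2 * Real.exp (-(2 * L * r z)) ≤ C * Real.exp (-(2 * L * c)) ∧
      ∀ z t s, 0 < t → closedBall z (2 * t) ⊆ D → (∀ y ∈ closedBall z (2 * t), r y ≤ s) →
        ‖F z‖ ^ 2 ≤ K / t ^ 2 * Real.exp (2 * L * (s - c)) := by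
  obtain ⟨b, hb, χ, hχD, hχc, M, hM, L₀, hmain⟩ := h.key_ineq hconn hw hwc hne
  obtain ⟨K, hK0, hK⟩ := exists_norm_annMoll_sq_le
  obtain ⟨C, hC⟩ : ∃ C, C = 2 * volume.real (closedBall w χ.rOut) + 2 * M := ⟨_, rfl⟩
  have hC0 : 0 ≤ C := by rw [hC]; positivity
  refine ⟨C, hC0, K * C, by positivity, max L₀ 0, fun L hL => ?_⟩
  have hL0 : 0 ≤ L := (le_max_right _ _).trans hL
  obtain ⟨F, hF, hF1, hFi, hFC, hFs⟩ := h.exists_holomorphic_of_ineq hb hM hL0 χ hχD hχc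
    (hmain L ((le_max_left _ _).trans hL)) hK
  rw [← hC] at hFC
  refine ⟨F, hF, hF1, hFi, hFC, fun z t s ht hz hs => (hFs z t ht hz).trans ?_⟩
  rw [mul_div_right_comm, mul_assoc]
  refine mul_le_mul_of_nonneg_left ?_ (by positivity)
  have hpt : ∀ y ∈ closedBall z (2 * t), ‖F y‖ ^ 2 ≤
      Real.exp (2 * L * s) * (‖F y‖ ^ 2 * Real.exp (-(2 * L * r y))) := fun y hy => by
    rw [mul_left_comm, ← Real.exp_add]
    refine le_mul_of_one_le_right (by positivity) (Real.one_le_exp ?_)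
    nlinarith [hs y hy]
  calc ∫ y in closedBall z (2 * t), ‖F y‖ ^ 2
      ≤ ∫ y in closedBall z (2 * t),
          Real.exp (2 * L * s) * (‖F y‖ ^ 2 * Real.exp (-(2 * L * r y))) :=
        setIntegral_mono_on (((hF.continuousOn.norm.pow 2).mono hz).integrableOn_compact
          (isCompact_closedBall _ _)) ((hFi.mono_set hz).const_mul _) measurableSet_closedBall hpt
    _ = Real.exp (2 * L * s) *
          ∫ y in closedBall z (2 * t), ‖F y‖ ^ 2 * Real.exp (-(2 * L * r y)) :=
        integral_const_mul _ _
    _ ≤ Real.exp (2 * L * s) * (C * Real.exp (-(2 * L * c))) := by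
        refine mul_le_mul_of_nonneg_left (le_trans ?_ hFC) (Real.exp_pos _).le
        exact setIntegral_mono_set hFi (Eventually.of_forall fun y => by positivity)
          (Eventually.of_forall hz)
    _ = _ := by rw [mul_left_comm, ← Real.exp_add]; congr 2; ring

end


section

variable {D : Set ℂ} {r : ℂ → ℝ}

/-- A series of holomorphic functions with a summable bound on a ball is holomorphic. -/
lemma differentiableAt_tsum_of_bound {E : Type*} [NormedAddCommGroup E] [NormedSpace ℂ E]
    {T : ℕ → E → ℂ} {p : E} {δ : ℝ} (hδ : 0 < δ) {u : ℕ → ℝ} (hu : Summable u)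
    (hT : ∀ n, DifferentiableOn ℂ (T n) (ball p δ)) (hb : ∀ n, ∀ x ∈ ball p δ, ‖T n x‖ ≤ u n) :
    DifferentiableAt ℂ (fun x => ∑' n, T n x) p := by
  have hsub : ∀ x ∈ ball p (δ / 2), ball x (δ / 2) ⊆ ball p δ := fun x hx =>
    ball_subset_ball' (by rw [mem_ball] at hx; linarith)
  have hp : p ∈ ball p (δ / 2) := mem_ball_self (half_pos hδ)
  have h2 : ball p (δ / 2) ⊆ ball p δ := ball_subset_ball (by linarith)
  let _ : NormedSpace ℝ E := NormedSpace.restrictScalars ℝ ℂ E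
  refine (hasFDerivAt_tsum_of_isPreconnected (u := fun n => 2 * u n / (δ / 2))
    (f' := fun n x => fderiv ℂ (T n) x)
    ((hu.mul_left 2).div_const _) isOpen_ball (convex_ball p (δ / 2)).isPreconnected
    (fun n x hx => ((hT n).differentiableAt
      (isOpen_ball.mem_nhds (h2 hx))).hasFDerivAt) (fun n x hx => ?_) hp ?_ hp).differentiableAt
  · refine Complex.norm_fderiv_le_div_of_mapsTo_ball ((hT n).mono (hsub x hx)) (fun y hy => ?_)
      (half_pos hδ)
    rw [mem_closedBall, dist_eq_norm]
    refine (norm_sub_le _ _).trans ?_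
    linarith [hb n y (hsub x hx hy), hb n x (h2 hx)]
  · exact Summable.of_norm_bounded hu fun n => hb n p (h2 hp)

/-- The coefficients of a square integrable holomorphic function on the Hartogs domain. -/
theorem IsSub.exists_coeffs (h : IsSub D r) (hconn : IsPreconnected D) {w : ℂ} (hw : w ∈ D)
    {c : ℝ} (hwc : ∀ᶠ z in nhds w, r z = c) (hne : ∃ z ∈ D, r z ≠ c) :
    ∃ A : ℕ → ℂ → ℂ, ∃ C ≥ 0, ∃ K ≥ 0, (∀ j, DifferentiableOn ℂ (A j) D) ∧
      (∀ j : ℕ, IntegrableOn (fun z => ‖A j z‖ ^ 2 * Real.exp (-(2 * (j + 1) * r z))) D) ∧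
      (∀ j : ℕ, ∫ z in D, ‖A j z‖ ^ 2 * Real.exp (-(2 * (j + 1) * r z)) ≤ C / (j + 1) ^ 4) ∧
      (∀ j : ℕ, ∀ z t s, 0 < t → closedBall z (2 * t) ⊆ D → (∀ y ∈ closedBall z (2 * t), r y ≤ s) →
        ‖A j z‖ ≤ K / t * Real.exp ((j + 1) * s)) ∧
      ∀ᶠ j : ℕ in atTop, ‖A j w‖ = Real.exp ((j + 1) * c) / (j + 1) ^ 2 := by
  obtain ⟨C, hC, K, hK, L₀, hF⟩ := h.exists_holomorphic hconn hw hwc hne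
  have hex : ∀ j : ℕ, ∃ F : ℂ → ℂ, DifferentiableOn ℂ F D ∧ (L₀ ≤ j + 1 → F w = 1) ∧
      IntegrableOn (fun z => ‖F z‖ ^ 2 * Real.exp (-(2 * (j + 1) * r z))) D ∧
      ∫ z in D, ‖F z‖ ^ 2 * Real.exp (-(2 * (j + 1) * r z)) ≤ C * Real.exp (-(2 * (j + 1) * c)) ∧
      ∀ z t s, 0 < t → closedBall z (2 * t) ⊆ D → (∀ y ∈ closedBall z (2 * t), r y ≤ s) →
        ‖F z‖ ^ 2 ≤ K / t ^ 2 * Real.exp (2 * (j + 1) * (s - c)) := fun j => by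
    by_cases hj : L₀ ≤ j + 1
    · obtain ⟨F, h1, h2, h3, h4, h5⟩ := hF _ hj
      exact ⟨F, h1, fun _ => h2, h3, h4, h5⟩
    · refine ⟨0, differentiableOn_const 0, fun h => absurd h hj, by simp, ?_, fun z t s ht _ _
        => ?_⟩
      · simp; positivity
      · simp; positivity
  choose F h1 h2 h3 h4 h5 using hex
  obtain ⟨κ, hκ⟩ : ∃ κ : ℕ → ℝ, ∀ j, κ j = Real.exp ((j + 1) * c) / (j + 1) ^ 2 :=
    ⟨_, fun _ => rfl⟩
  have hκ0 : ∀ j, 0 ≤ κ j := fun j => by rw [hκ]; positivity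
  have hκ2 : ∀ j, κ j ^ 2 = Real.exp (2 * (j + 1) * c) / (j + 1) ^ 4 := fun j => by
    rw [hκ, div_pow, ← Real.exp_nat_mul, ← pow_mul]; push_cast; ring_nf
  have hA : ∀ j z, ‖(κ j : ℂ) * F j z‖ ^ 2 = κ j ^ 2 * ‖F j z‖ ^ 2 := fun j z => by
    rw [norm_mul, Complex.norm_real, Real.norm_of_nonneg (hκ0 j), mul_pow]
  refine ⟨fun j z => κ j * F j z, C, hC, Real.sqrt K, Real.sqrt_nonneg K,
    fun j => (h1 j).const_mul _, fun j => ?_, fun j => ?_, fun j z t s ht hz hs => ?_, ?_⟩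
  · simp only [hA, mul_assoc]
    have := (h3 j).const_mul (κ j ^ 2)
    simpa only [IntegrableOn, mul_assoc] using this
  · simp only [hA]
    have h6 : (0 : ℝ) < j + 1 := by positivity
    calc ∫ z in D, κ j ^ 2 * ‖F j z‖ ^ 2 * Real.exp (-(2 * (j + 1) * r z))
        = κ j ^ 2 * ∫ z in D, ‖F j z‖ ^ 2 * Real.exp (-(2 * (j + 1) * r z)) := by
          rw [← integral_const_mul]; simp only [mul_assoc]
      _ ≤ κ j ^ 2 * (C * Real.exp (-(2 * (j + 1) * c))) :=
          mul_le_mul_of_nonneg_left (h4 j) (sq_nonneg _)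
      _ = C / (j + 1) ^ 4 := by
          rw [hκ2, Real.exp_neg]
          have := (Real.exp_pos (2 * (j + 1) * c)).ne'
          field_simp
  · refine (pow_le_pow_iff_left₀ (norm_nonneg _) (by positivity) two_ne_zero).1 ?_
    rw [hA, mul_pow, div_pow, Real.sq_sqrt hK, ← Real.exp_nat_mul]
    have h6 : (1 : ℝ) ≤ (j + 1) ^ 4 := one_le_pow₀ (by simp)
    calc κ j ^ 2 * ‖F j z‖ ^ 2
        ≤ Real.exp (2 * (j + 1) * c) * (K / t ^ 2 * Real.exp (2 * (j + 1) * (s - c))) := by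
          refine mul_le_mul ?_ (h5 j z t s ht hz hs) (by positivity) (by positivity)
          rw [hκ2]
          exact div_le_self (by positivity) h6
      _ = _ := by
          rw [mul_left_comm, ← Real.exp_add]; push_cast; ring_nf
  · filter_upwards [eventually_ge_atTop ⌈L₀⌉₊] with j hj
    have : L₀ ≤ j + 1 := (Nat.le_ceil L₀).trans (by exact_mod_cast hj.trans (Nat.le_succ j))
    rw [h2 j this, mul_one, Complex.norm_real, Real.norm_of_nonneg (hκ0 j), hκ]

/-- The Hartogs domain of a real-valued function. -/
def hartogsReal (D : Set ℂ) (r : ℂ → ℝ) : Set (ℂ × ℂ) :=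
  {p | p.1 ∈ D ∧ ‖p.2‖ < Real.exp (-r p.1)}

/-- Near each point of the Hartogs domain there is a product neighbourhood. -/
lemma IsSub.exists_polydisc (h : IsSub D r) {p : ℂ × ℂ} (hp : p ∈ hartogsReal D r) :
    ∃ δ > 0, ∃ s R, 0 < R ∧ R < Real.exp (-s) ∧ ∀ q ∈ ball p δ, ‖q.2‖ ≤ R ∧
      closedBall q.1 (2 * δ) ⊆ D ∧ ∀ y ∈ closedBall q.1 (2 * δ), r y < s := by
  obtain ⟨R, hR1, hR2⟩ := exists_between hp.2
  have hR : 0 < R := (norm_nonneg _).trans_lt hR1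
  obtain ⟨s, hs1, hs2⟩ : ∃ s, r p.1 < s ∧ s < -Real.log R := by
    refine exists_between ?_
    have := (Real.log_lt_iff_lt_exp hR).2 hR2
    linarith
  have hev : ∀ᶠ y in nhds p.1, y ∈ D ∧ r y < s := by
    have h1 := h.usc p.1 hp.1 s hs1
    rw [h.isOpen.nhdsWithin_eq hp.1] at h1
    have h0 : ∀ᶠ y in nhds p.1, y ∈ D := h.isOpen.mem_nhds hp.1
    exact h0.and h1
  obtain ⟨ε, hε, hball⟩ := Metric.eventually_nhds_iff_ball.1 hev
  refine ⟨min (ε / 4) (R - ‖p.2‖), lt_min (by positivity) (by linarith), s, R, hR, ?_, fun q hq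
      => ?_⟩
  · rw [← Real.log_lt_iff_lt_exp hR]; linarith
  rw [mem_ball, Prod.dist_eq, max_lt_iff] at hq
  have hsub : closedBall q.1 (2 * min (ε / 4) (R - ‖p.2‖)) ⊆ ball p.1 ε := fun y hy => by
    rw [mem_closedBall] at hy
    rw [mem_ball]
    have := dist_triangle y q.1 p.1
    have := min_le_left (ε / 4) (R - ‖p.2‖)
    linarith [hq.1]
  refine ⟨?_, fun y hy => (hball y (hsub hy)).1, fun y hy => (hball y (hsub hy)).2⟩
  have h1 := hq.2.trans_le (min_le_right _ _)
  rw [dist_eq_norm] at h1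
  linarith [norm_le_norm_add_norm_sub' q.2 p.2]

lemma IsSub.isOpen_hartogsReal (h : IsSub D r) : IsOpen (hartogsReal D r) := by
  rw [Metric.isOpen_iff]
  intro p hp
  obtain ⟨δ, hδ, s, R, hR, hRs, hq⟩ := h.exists_polydisc hp
  refine ⟨δ, hδ, fun q hqp => ?_⟩
  obtain ⟨h1, h2, h3⟩ := hq q hqp
  have hm : q.1 ∈ closedBall q.1 (2 * δ) := mem_closedBall_self (by positivity)
  refine ⟨h2 hm, h1.trans_lt (hRs.trans_le (Real.exp_le_exp.2 ?_))⟩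
  linarith [h3 _ hm]

/-- The series built from coefficients of growth `r` converges to a holomorphic function. -/
lemma IsSub.hasSum_and_differentiableOn (h : IsSub D r) {A : ℕ → ℂ → ℂ} {K : ℝ}
    (hA : ∀ j, DifferentiableOn ℂ (A j) D)
    (hK : ∀ j : ℕ, ∀ z t s, 0 < t → closedBall z (2 * t) ⊆ D →
      (∀ y ∈ closedBall z (2 * t), r y ≤ s) → ‖A j z‖ ≤ K / t * Real.exp ((j + 1) * s)) :
    (∀ p ∈ hartogsReal D r, Summable fun j => A j p.1 * p.2 ^ j) ∧
      DifferentiableOn ℂ (fun p : ℂ × ℂ => ∑' j, A j p.1 * p.2 ^ j) (hartogsReal D r) := by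
  have key : ∀ p ∈ hartogsReal D r, ∃ δ > 0, ∃ u : ℕ → ℝ, Summable u ∧ ball p δ ⊆ {q | q.1 ∈ D} ∧
      ∀ j, ∀ q ∈ ball p δ, ‖A j q.1 * q.2 ^ j‖ ≤ u j := fun p hp => by
    obtain ⟨δ, hδ, s, R, hR, hRs, hq⟩ := h.exists_polydisc hp
    refine ⟨δ, hδ, fun j => K / δ * Real.exp s * (Real.exp s * R) ^ j,
      (summable_geometric_of_lt_one (by positivity) ?_).mul_left _,
      fun q hqp => (hq q hqp).2.1 (mem_closedBall_self (by positivity)), fun j q hqp => ?_⟩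
    · rw [Real.exp_neg] at hRs
      have := Real.exp_pos s
      calc _ < Real.exp s * (Real.exp s)⁻¹ := by gcongr
        _ = 1 := mul_inv_cancel₀ this.ne'
    · obtain ⟨h1, h2, h3⟩ := hq q hqp
      have h4 := hK j q.1 δ s hδ h2 fun y hy => (h3 y hy).le
      rw [norm_mul, norm_pow]
      calc _ ≤ K / δ * Real.exp ((j + 1) * s) * R ^ j :=
            mul_le_mul h4 (pow_le_pow_left₀ (norm_nonneg _) h1 _) (by positivity)
              ((norm_nonneg _).trans h4)
        _ = _ := by
            rw [add_mul, one_mul, Real.exp_add, Real.exp_nat_mul]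
            simp only [mul_pow]
            ring
  refine ⟨fun p hp => ?_, fun p hp => DifferentiableAt.differentiableWithinAt ?_⟩
  · obtain ⟨δ, hδ, u, hu, -, hb⟩ := key p hp
    exact Summable.of_norm_bounded hu fun j => hb j p (mem_ball_self hδ)
  · obtain ⟨δ, hδ, u, hu, hD, hb⟩ := key p hp
    refine differentiableAt_tsum_of_bound hδ hu (fun j => ?_) hb
    refine DifferentiableOn.mul ((hA j).comp differentiableOn_fst fun q hq => hD hq) ?_
    exact (differentiable_snd.pow j).differentiableOn

end


section

variable {D : Set ℂ} {r : ℂ → ℝ}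

lemma lintegral_hartogs_monomial_le (hD : MeasurableSet D) (hG : MeasurableSet (hartogsReal D r))
    (a : ℂ → ℂ) (j : ℕ) :
    ∫⁻ p in hartogsReal D r, ‖a p.1 * p.2 ^ j‖ₑ ^ 2 ≤
      NNReal.pi * ∫⁻ z in D, ENNReal.ofReal (‖a z‖ ^ 2 * Real.exp (-(2 * (j + 1) * r z))) := by
  rw [← lintegral_indicator hG, Measure.volume_eq_prod]
  refine (lintegral_prod_le _).trans ?_
  rw [← lintegral_const_mul' _ _ ENNReal.coe_ne_top, ← lintegral_indicator hD]
  refine lintegral_mono fun x => ?_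
  obtain ⟨R, hR⟩ : ∃ R, R = Real.exp (-r x) := ⟨_, rfl⟩
  have hR0 : 0 < R := hR ▸ Real.exp_pos _
  by_cases hx : x ∈ D
  · rw [indicator_of_mem hx]
    calc _ ≤ ∫⁻ y, (ball (0 : ℂ) R).indicator
          (fun _ => ENNReal.ofReal (‖a x‖ ^ 2 * R ^ (2 * j))) y := by
          refine lintegral_mono fun y => ?_
          by_cases hy : y ∈ ball (0 : ℂ) R
          · rw [indicator_of_mem hy]
            refine (indicator_le_self _ _ _).trans ?_
            rw [← ofReal_norm, ← ENNReal.ofReal_pow (norm_nonneg _)]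
            refine ENNReal.ofReal_le_ofReal ?_
            rw [norm_mul, norm_pow, mul_pow, ← pow_mul, mul_comm j 2]
            rw [mem_ball_zero_iff] at hy
            gcongr
          · rw [indicator_of_notMem hy, indicator_of_notMem]
            rintro ⟨-, h⟩
            exact hy (by rw [mem_ball_zero_iff, hR]; exact h)
      _ = ENNReal.ofReal (‖a x‖ ^ 2 * R ^ (2 * j)) * (ENNReal.ofReal R ^ 2 * NNReal.pi) := by
          rw [lintegral_indicator measurableSet_ball, setLIntegral_const, Complex.volume_ball]
      _ = NNReal.pi * ENNReal.ofReal (‖a x‖ ^ 2 * Real.exp (-(2 * (j + 1) * r x))) := by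
          rw [← ENNReal.ofReal_pow hR0.le, ← mul_assoc, ← ENNReal.ofReal_mul (by positivity),
            mul_comm]
          congr 2
          rw [mul_assoc, ← pow_add, hR, ← Real.exp_nat_mul]
          push_cast
          ring_nf
      _ ≤ _ := le_rfl
  · rw [indicator_of_notMem hx]
    refine le_of_eq ((lintegral_congr fun y => ?_).trans lintegral_zero)
    rw [indicator_of_notMem]
    exact fun h => hx h.1

lemma summable_inv_succ_sq : Summable fun j : ℕ => 1 / ((j : ℝ) + 1) ^ 2 := by
  have := (summable_nat_add_iff 1).2 (Real.summable_one_div_nat_pow.2 one_lt_two)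
  simpa using this

lemma enorm_tsum_sq_le {T : ℕ → ℂ} (hT : Summable T) :
    ‖∑' j, T j‖ₑ ^ 2 ≤ ENNReal.ofReal (∑' j : ℕ, 1 / ((j : ℝ) + 1) ^ 2) *
      ∑' j : ℕ, ENNReal.ofReal (((j : ℝ) + 1) ^ 2) * ‖T j‖ₑ ^ 2 := by
  have hlim := ((ENNReal.continuous_pow 2).tendsto _).comp hT.hasSum.tendsto_sum_nat.enorm
  refine le_of_tendsto' hlim fun N => ?_
  have hreal : ‖∑ j ∈ Finset.range N, T j‖ ^ 2 ≤ (∑' j : ℕ, 1 / ((j : ℝ) + 1) ^ 2) *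
      ∑ j ∈ Finset.range N, ((j : ℝ) + 1) ^ 2 * ‖T j‖ ^ 2 := by
    have h1 := Finset.sum_mul_sq_le_sq_mul_sq (Finset.range N) (fun j : ℕ => 1 / ((j : ℝ) + 1))
      fun j => ((j : ℝ) + 1) * ‖T j‖
    have h2 : ∀ j : ℕ, 1 / ((j : ℝ) + 1) * (((j : ℝ) + 1) * ‖T j‖) = ‖T j‖ := fun j => by
      have : (0 : ℝ) < j + 1 := by positivity
      field_simp
    simp only [h2, div_pow, one_pow, mul_pow] at h1
    refine (pow_le_pow_left₀ (norm_nonneg _) (norm_sum_le _ _) 2).trans (h1.trans ?_)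
    refine mul_le_mul_of_nonneg_right ?_ (Finset.sum_nonneg fun j _ => by positivity)
    exact summable_inv_succ_sq.sum_le_tsum _ fun j _ => by positivity
  simp only [Function.comp_apply]
  rw [← ofReal_norm, ← ENNReal.ofReal_pow (norm_nonneg _)]
  refine (ENNReal.ofReal_le_ofReal hreal).trans ?_
  rw [ENNReal.ofReal_mul (tsum_nonneg fun j => by positivity)]
  refine mul_le_mul' le_rfl ?_
  rw [ENNReal.ofReal_sum_of_nonneg fun j _ => by positivity]
  refine le_trans (le_of_eq (Finset.sum_congr rfl fun j _ => ?_)) (ENNReal.sum_le_tsum _)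
  rw [ENNReal.ofReal_mul (by positivity), ENNReal.ofReal_pow (norm_nonneg _), ofReal_norm]

lemma IsSub.integrableOn_tsum (h : IsSub D r) {A : ℕ → ℂ → ℂ} {C : ℝ}
    (hA : ∀ j, DifferentiableOn ℂ (A j) D)
    (hi : ∀ j : ℕ, IntegrableOn (fun z => ‖A j z‖ ^ 2 * Real.exp (-(2 * (j + 1) * r z))) D)
    (hC : ∀ j : ℕ, ∫ z in D, ‖A j z‖ ^ 2 * Real.exp (-(2 * (j + 1) * r z)) ≤ C / (j + 1) ^ 4)
    (hs : ∀ p ∈ hartogsReal D r, Summable fun j => A j p.1 * p.2 ^ j)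
    (hd : DifferentiableOn ℂ (fun p : ℂ × ℂ => ∑' j, A j p.1 * p.2 ^ j) (hartogsReal D r)) :
    IntegrableOn (fun p : ℂ × ℂ => ‖∑' j, A j p.1 * p.2 ^ j‖ ^ 2) (hartogsReal D r) := by
  have hG := h.isOpen_hartogsReal.measurableSet
  refine ⟨(hd.continuousOn.norm.pow 2).aestronglyMeasurable hG, ?_⟩
  have hterm : ∀ j : ℕ, ∫⁻ p in hartogsReal D r, ‖A j p.1 * p.2 ^ j‖ₑ ^ 2 ≤
      NNReal.pi * ENNReal.ofReal (C / (j + 1) ^ 4) := fun j => by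
    refine (lintegral_hartogs_monomial_le h.isOpen.measurableSet hG _ j).trans ?_
    rw [← ofReal_integral_eq_lintegral_ofReal (hi j) (Eventually.of_forall fun z => by positivity)]
    gcongr
    exact hC j
  have hm : ∀ j : ℕ, AEMeasurable (fun p : ℂ × ℂ => ENNReal.ofReal (((j : ℝ) + 1) ^ 2) *
      ‖A j p.1 * p.2 ^ j‖ₑ ^ 2) (volume.restrict (hartogsReal D r)) := fun j => by
    have h1 : ContinuousOn (fun p : ℂ × ℂ => A j p.1 * p.2 ^ j) (hartogsReal D r) :=
      ((hA j).continuousOn.comp continuousOn_fst fun p hp => hp.1).mul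
        (continuous_snd.pow j).continuousOn
    exact ((h1.aestronglyMeasurable hG).enorm.pow_const 2).const_mul _
  have hsum := summable_inv_succ_sq.mul_left C
  calc ∫⁻ p in hartogsReal D r, ‖‖∑' j, A j p.1 * p.2 ^ j‖ ^ 2‖ₑ
      ≤ ∫⁻ p in hartogsReal D r, ENNReal.ofReal (∑' j : ℕ, 1 / ((j : ℝ) + 1) ^ 2) *
          ∑' j : ℕ, ENNReal.ofReal (((j : ℝ) + 1) ^ 2) * ‖A j p.1 * p.2 ^ j‖ₑ ^ 2 := by
        refine setLIntegral_mono' hG fun p hp => ?_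
        rw [enorm_pow, enorm_norm]
        exact enorm_tsum_sq_le (hs p hp)
    _ = ENNReal.ofReal (∑' j : ℕ, 1 / ((j : ℝ) + 1) ^ 2) * ∑' j : ℕ,
          ENNReal.ofReal (((j : ℝ) + 1) ^ 2) *
            ∫⁻ p in hartogsReal D r, ‖A j p.1 * p.2 ^ j‖ₑ ^ 2 := by
        rw [lintegral_const_mul' _ _ ENNReal.ofReal_ne_top, lintegral_tsum hm]
        simp only [lintegral_const_mul' _ _ ENNReal.ofReal_ne_top]
    _ ≤ ENNReal.ofReal (∑' j : ℕ, 1 / ((j : ℝ) + 1) ^ 2) * ∑' j : ℕ,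
          NNReal.pi * ENNReal.ofReal (C * (1 / ((j : ℝ) + 1) ^ 2)) := by
        refine mul_le_mul' le_rfl (ENNReal.tsum_le_tsum fun j => ?_)
        refine (mul_le_mul_right (hterm j) _).trans (le_of_eq ?_)
        rw [mul_left_comm, ← ENNReal.ofReal_mul (by positivity)]
        congr 2
        have : (0 : ℝ) < j + 1 := by positivity
        field_simp
    _ < ⊤ := by
        rw [ENNReal.tsum_mul_left]
        refine ENNReal.mul_lt_top ENNReal.ofReal_lt_top
          (ENNReal.mul_lt_top ENNReal.coe_lt_top ?_)
        exact hsum.tsum_ofReal_lt_top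

end


section

variable {D : Set ℂ} {r : ℂ → ℝ}

lemma elog_of_pos {x : ℝ} (hx : 0 < x) : elog x = (Real.log x : ℝ) := by
  rw [elog, if_neg hx.not_ge]

lemma elog_of_nonpos {x : ℝ} (hx : x ≤ 0) : elog x = ⊥ := by
  rw [elog, if_pos hx]

lemma elog_lt_coe_iff {x y : ℝ} : elog x < (y : EReal) ↔ x < Real.exp y := by
  rcases le_or_gt x 0 with hx | hx
  · rw [elog_of_nonpos hx]
    exact iff_of_true (EReal.bot_lt_coe y) (hx.trans_lt (Real.exp_pos y))
  · rw [elog_of_pos hx, EReal.coe_lt_coe_iff, Real.log_lt_iff_lt_exp hx]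

lemma elog_le_coe_iff {x y : ℝ} : elog x ≤ (y : EReal) ↔ x ≤ Real.exp y := by
  rcases le_or_gt x 0 with hx | hx
  · rw [elog_of_nonpos hx]
    exact iff_of_true bot_le (hx.trans (Real.exp_pos y).le)
  · rw [elog_of_pos hx, EReal.coe_le_coe_iff, Real.log_le_iff_le_exp hx]

lemma le_uscReg (g : ℂ → EReal) (z : ℂ) : g z ≤ uscReg g z := by
  refine le_limsup_of_frequently_le' (Frequently.filter_mono ?_ (pure_le_nhds z))
  simp

lemma uscReg_le {g : ℂ → EReal} {z : ℂ} {U : Set ℂ} (hU : IsOpen U) (hz : z ∈ U) {c : EReal}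
    (h : ∀ x ∈ U, g x ≤ c) : uscReg g z ≤ c :=
  limsup_le_of_le (h := eventually_of_mem (hU.mem_nhds hz) h)

lemma coeffGrowth_le {fj : ℕ → ℂ → ℂ} {z : ℂ} {c : ℝ}
    (h : ∀ t : ℝ, 0 < t → t < Real.exp (-c) → Summable fun j => fj j z * (t : ℂ) ^ j) :
    coeffGrowth fj z ≤ c := by
  refine EReal.le_of_forall_lt_iff_le.1 fun s hs => ?_
  rw [EReal.coe_lt_coe_iff] at hs
  have h1 := (h (Real.exp (-s)) (Real.exp_pos _)
    (Real.exp_lt_exp.2 (by linarith))).tendsto_atTop_zero.norm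
  rw [norm_zero] at h1
  refine limsup_le_of_le (h := ?_)
  filter_upwards [h1.eventually_le_const one_pos, eventually_gt_atTop 0] with j hj hj0
  have hj0' : (0 : ℝ) < j := by exact_mod_cast hj0
  rw [norm_mul, norm_pow, Complex.norm_real, Real.norm_of_nonneg (Real.exp_pos _).le,
    ← Real.exp_nat_mul] at hj
  have h2 : ‖fj j z‖ ≤ Real.exp (j * s) := by
    rw [mul_neg, Real.exp_neg, mul_inv_le_iff₀ (Real.exp_pos _), one_mul] at hj
    exact hj
  calc _ ≤ (((j : ℝ)⁻¹ : ℝ) : EReal) * ((j * s : ℝ) : EReal) :=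
        mul_le_mul_of_nonneg_left (elog_le_coe_iff.2 h2) (EReal.coe_nonneg.2 (by positivity))
    _ = s := by rw [← EReal.coe_mul, inv_mul_cancel_left₀ hj0'.ne']

lemma coeffGrowth_eq {fj : ℕ → ℂ → ℂ} {w : ℂ} {c : ℝ}
    (h : ∀ᶠ j : ℕ in atTop, ‖fj j w‖ = Real.exp ((j + 1) * c) / (j + 1) ^ 2) :
    coeffGrowth fj w = c := by
  have hlim : Tendsto (fun j : ℕ => c + (j : ℝ)⁻¹ * c - 2 * ((j : ℝ)⁻¹ * Real.log (j + 1))) atTop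
      (nhds c) := by
    have h1 : Tendsto (fun j : ℕ => (j : ℝ)⁻¹) atTop (nhds 0) := tendsto_inv_atTop_nhds_zero_nat
    have h2 : Tendsto (fun j : ℕ => (j : ℝ)⁻¹ * Real.log (j + 1)) atTop (nhds 0) := by
      have h3 : Tendsto (fun x : ℝ => Real.log x / (1 * x + (-1))) atTop (nhds 0) := by
        simpa using Real.tendsto_pow_log_div_mul_add_atTop 1 (-1) 1 one_ne_zero
      have h4 := h3.comp (tendsto_atTop_add_const_right atTop 1 tendsto_natCast_atTop_atTop)
      refine h4.congr fun j => ?_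
      simp [div_eq_inv_mul]
    simpa using (tendsto_const_nhds.add (h1.mul_const c)).sub (h2.const_mul 2)
  refine Tendsto.limsup_eq (((continuous_coe_real_ereal.tendsto c).comp hlim).congr' ?_)
  filter_upwards [h, eventually_gt_atTop 0] with j hj hj0
  have hj0' : (0 : ℝ) < j := by exact_mod_cast hj0
  rw [hj, elog_of_pos (by positivity), ← EReal.coe_mul, Function.comp_apply, EReal.coe_eq_coe_iff,
    Real.log_div (Real.exp_pos _).ne' (by positivity), Real.log_exp, Real.log_pow]
  field_simp
  push_cast
  ring

lemma hartogs_eq_hartogsReal {ρ : ℂ → EReal} (h : ∀ z ∈ D, ρ z = r z) :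
    hartogs D ρ = hartogsReal D r := by
  ext p
  refine and_congr_right fun hp => ?_
  rw [h _ hp, ← EReal.coe_neg, elog_lt_coe_iff]

/-- The statement for a real-valued function. -/
theorem IsSub.uscReg_rhoTilde (h : IsSub D r) (hconn : IsPreconnected D) {ρ : ℂ → EReal}
    (hρ : ∀ z ∈ D, ρ z = r z) {U : Set ℂ} (hU : IsOpen U) (hUD : U ⊆ D) {c : ℝ}
    (hUc : ∀ z ∈ U, r z = c) (hne : ∃ z ∈ D, r z ≠ c) {w : ℂ} (hw : w ∈ U) :
    uscReg (rhoTilde D ρ) w = c := by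
  have hG := hartogs_eq_hartogsReal hρ
  refine le_antisymm (uscReg_le hU hw fun z hz => ?_) ?_
  · refine iSup₂_le fun fj hfj => uscReg_le hU hz fun x hx => coeffGrowth_le fun t ht htc => ?_
    obtain ⟨f, -, -, hf⟩ := hfj
    refine (hf (x, (t : ℂ)) ?_).summable
    rw [hG]
    refine ⟨hUD hx, ?_⟩
    rwa [Complex.norm_real, Real.norm_of_nonneg ht.le, hUc x hx]
  · obtain ⟨A, C, -, K, -, hA, hi, hC, hK, hAw⟩ := h.exists_coeffs hconn (hUD hw)
      (eventually_of_mem (hU.mem_nhds hw) hUc) hne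
    obtain ⟨hs, hd⟩ := h.hasSum_and_differentiableOn hA hK
    have hL := h.integrableOn_tsum hA hi hC hs hd
    refine le_trans ?_ (le_uscReg _ _)
    refine le_trans ?_ (le_iSup₂ (f := fun (fj : ℕ → ℂ → ℂ) (_ : fj ∈ {fj : ℕ → ℂ → ℂ |
      ∃ f ∈ L2h (hartogs D ρ), HartogsExpansion D ρ f fj}) => uscReg (coeffGrowth fj) w) A
      ⟨fun p => ∑' j, A j p.1 * p.2 ^ j, ?_, hA, ?_⟩)
    · exact (coeffGrowth_eq hAw).ge.trans (le_uscReg _ _)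
    · rw [hG]; exact ⟨hd, hL⟩
    · rw [hG]; exact fun p hp => (hs p hp).hasSum

end


/-- The Lipschitz majorants of a bounded function: its sup-convolution with `n |x - y|`. -/
noncomputable def supConv (g : ℝ → ℝ) (n : ℕ) (x : ℝ) : ℝ := ⨆ y, (g y - n * |x - y|)

section

variable {g : ℝ → ℝ} {B : ℝ}

lemma bddAbove_supConv (hB : ∀ x, |g x| ≤ B) (n : ℕ) (x : ℝ) :
    BddAbove (range fun y => g y - n * |x - y|) := by
  refine ⟨B, ?_⟩
  rintro _ ⟨y, rfl⟩
  have : 0 ≤ n * |x - y| := by positivity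
  simp only
  linarith [(abs_le.1 (hB y)).2]

lemma le_supConv (hB : ∀ x, |g x| ≤ B) (n : ℕ) (x : ℝ) : g x ≤ supConv g n x := by
  have := le_ciSup (bddAbove_supConv hB n x) x
  simpa [supConv] using this

lemma supConv_le (hB : ∀ x, |g x| ≤ B) (n : ℕ) (x : ℝ) : supConv g n x ≤ B := by
  refine ciSup_le fun y => ?_
  have : 0 ≤ n * |x - y| := by positivity
  linarith [(abs_le.1 (hB y)).2]

lemma continuous_supConv (hB : ∀ x, |g x| ≤ B) (n : ℕ) : Continuous (supConv g n) := by
  refine (LipschitzWith.of_le_add_mul n fun x z => ?_).continuous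
  refine ciSup_le fun y => ?_
  have h1 := le_ciSup (bddAbove_supConv hB n z) y
  have h2 : |z - y| ≤ |x - y| + |x - z| := by
    rw [abs_sub_comm x z, add_comm]; exact abs_sub_le z x y
  have h3 : (n : ℝ) * |z - y| ≤ n * (|x - y| + |x - z|) := by gcongr
  rw [Real.dist_eq]
  simp only [NNReal.coe_natCast, supConv] at h1 ⊢
  linarith

lemma tendsto_supConv (hB : ∀ x, |g x| ≤ B) {x : ℝ} (hg : UpperSemicontinuousAt g x) :
    Tendsto (fun n => supConv g n x) atTop (nhds (g x)) := by
  rw [tendsto_order]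
  refine ⟨fun a ha => Eventually.of_forall fun n => ha.trans_le (le_supConv hB n x),
    fun a ha => ?_⟩
  obtain ⟨a', ha', ha''⟩ := exists_between ha
  obtain ⟨δ, hδ, hδg⟩ := Metric.eventually_nhds_iff.1 (hg a' ha')
  filter_upwards [eventually_ge_atTop ⌈2 * B / δ⌉₊] with n hn
  refine lt_of_le_of_lt (ciSup_le fun y => ?_) ha''
  by_cases hy : dist y x < δ
  · have : 0 ≤ n * |x - y| := by positivity
    linarith [hδg hy]
  · rw [not_lt, Real.dist_eq, abs_sub_comm] at hy
    have h1 : 2 * B / δ ≤ n := (Nat.le_ceil _).trans (by exact_mod_cast hn)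
    rw [div_le_iff₀ hδ] at h1
    have h2 : n * δ ≤ n * |x - y| := by gcongr
    linarith [(abs_le.1 (hB y)).2, (abs_le.1 (hB x)).1]

/-- A bound by the integrals of all continuous majorants of a bounded upper semicontinuous
function is a bound by its integral. -/
lemma le_integral_of_continuous_majorants (hg : UpperSemicontinuous g) (hB : ∀ x, |g x| ≤ B)
    {a b v : ℝ} (h : ∀ φ : ℝ → ℝ, Continuous φ → (∀ x, g x ≤ φ x) → v ≤ ∫ x in a..b, φ x) :
    v ≤ ∫ x in a..b, g x := by
  have hlim : Tendsto (fun n => ∫ x in a..b, supConv g n x) atTop (nhds (∫ x in a..b, g x)) := by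
    refine intervalIntegral.tendsto_integral_filter_of_dominated_convergence (fun _ => B)
      (Eventually.of_forall fun n => (continuous_supConv hB n).aestronglyMeasurable)
      (Eventually.of_forall fun n => Eventually.of_forall fun x _ => ?_)
      intervalIntegrable_const (Eventually.of_forall fun x _ => tendsto_supConv hB (hg x))
    exact abs_le.2 ⟨(abs_le.1 (hB x)).1.trans (le_supConv hB n x), supConv_le hB n x⟩
  exact ge_of_tendsto' hlim fun n => h _ (continuous_supConv hB n) (le_supConv hB n)

end

section

variable {D : Set ℂ} {ρ : ℂ → EReal}

open Classical in
/-- The real-valued function underlying `ρ` on `D`, extended by zero. -/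
noncomputable def realPart (D : Set ℂ) (ρ : ℂ → EReal) (z : ℂ) : ℝ :=
  if z ∈ D then (ρ z).toReal else 0

lemma coe_realPart (hρ : SubharmonicOn ρ D) {M : ℝ} (hM : ∀ z ∈ D, (M : EReal) ≤ ρ z) {z : ℂ}
    (hz : z ∈ D) : ρ z = realPart D ρ z := by
  rw [realPart, if_pos hz, EReal.coe_toReal (hρ.2.2.1 z hz)]
  exact ((EReal.bot_lt_coe M).trans_le (hM z hz)).ne'

lemma isSub_realPart (hρ : SubharmonicOn ρ D) {M : ℝ} (hM : ∀ z ∈ D, (M : EReal) ≤ ρ z) :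
    IsSub D (realPart D ρ) := by
  have hcoe : ∀ z ∈ D, ρ z = realPart D ρ z := fun z hz => coe_realPart hρ hM hz
  have hDo : IsOpen D := hρ.1
  have husc : UpperSemicontinuousOn (realPart D ρ) D := fun z hz a ha => by
    have h1 := hρ.2.1 z hz a (by
      change ρ z < ((a : ℝ) : EReal)
      rw [hcoe z hz]
      exact EReal.coe_lt_coe_iff.2 ha)
    filter_upwards [h1, self_mem_nhdsWithin] with y (hy : ρ y < (a : EReal)) hyD
    rw [hcoe y hyD] at hy
    exact EReal.coe_lt_coe_iff.1 hy
  have hbdd : ∀ K ⊆ D, IsCompact K → ∃ A, ∀ z ∈ K, |realPart D ρ z| ≤ A := fun K hKD hK => by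
    obtain ⟨A, hA⟩ := (husc.mono hKD).bddAbove_of_isCompact hK
    refine ⟨max A (-M), fun z hz => abs_le.2 ⟨?_, ?_⟩⟩
    · have h1 := hM z (hKD hz)
      rw [hcoe z (hKD hz), EReal.coe_le_coe_iff] at h1
      linarith [le_max_right A (-M)]
    · exact (hA (mem_image_of_mem _ hz)).trans (le_max_left _ _)
  refine ⟨hDo, measurable_of_Iio fun a => ?_, hbdd, husc, fun z R hR hz => ?_⟩
  · have h1 : IsOpen (D ∩ realPart D ρ ⁻¹' Iio a) := isOpen_iff_mem_nhds.2 fun z hz => by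
      have h2 := husc z hz.1 a hz.2
      rw [hDo.nhdsWithin_eq hz.1] at h2
      exact inter_mem (hDo.mem_nhds hz.1) h2
    have h3 : realPart D ρ ⁻¹' Iio a =
        (D ∩ realPart D ρ ⁻¹' Iio a) ∪ (Dᶜ ∩ {_z | 0 < a}) := by
      ext z
      by_cases hz : z ∈ D <;> simp [hz, realPart]
    rw [h3]
    exact h1.measurableSet.union (hDo.measurableSet.compl.inter (MeasurableSet.const _))
  · obtain ⟨A, hA⟩ := hbdd _ hz (isCompact_closedBall _ _)
    have hmem : ∀ θ, circleMap z R θ ∈ closedBall z R := fun θ =>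
      circleMap_mem_closedBall z hR.le θ
    refine le_integral_of_continuous_majorants (g := fun θ => realPart D ρ (circleMap z R θ))
      (fun θ a ha => ?_) (fun θ => hA _ (hmem θ)) fun φ hφ hle => ?_
    · have h1 := husc _ (hz (hmem θ)) a ha
      rw [hDo.nhdsWithin_eq (hz (hmem θ))] at h1
      exact (continuous_circleMap z R).continuousAt.eventually h1
    · have h1 := hρ.2.2.2.2 z R hR hz φ hφ fun θ => by
        have h2 := hle θ
        rw [circleMap] at h2
        rw [hcoe _ (by have := hz (hmem θ); rwa [circleMap] at this)]
        exact_mod_cast h2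
      rw [hcoe z (hz (mem_closedBall_self hR.le)), EReal.coe_le_coe_iff,
        inv_mul_eq_div, le_div_iff₀ (by positivity)] at h1
      linarith

end

end HartogsL2

/-- **Lemma 5.** If `ρ` is subharmonic on the domain `D`, bounded from below,
not constant on `D`, and constant on an open connected neighborhood `U ⊆ D` of `z₀ ∈ D`,
then `ρ̃* ≡ ρ` on `U`. -/
theorem lemma5 (D : Set ℂ) (hDopen : IsOpen D) (hDconn : IsConnected D)
    (ρ : ℂ → EReal) (hρ : SubharmonicOn ρ D) (hbd : ∃ M : ℝ, ∀ z ∈ D, (M : EReal) ≤ ρ z)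
    (hnotconst : ¬ ∃ c : EReal, ∀ z ∈ D, ρ z = c)
    (z₀ : ℂ) (hz₀ : z₀ ∈ D) (U : Set ℂ) (hUopen : IsOpen U) (hUconn : IsConnected U)
    (hz₀U : z₀ ∈ U) (hUD : U ⊆ D) (c : EReal) (hconst : ∀ z ∈ U, ρ z = c) :
    ∀ z ∈ U, uscReg (rhoTilde D ρ) z = ρ z := by
  intro w hw
  obtain ⟨M, hM⟩ := hbd
  have hcoe : ∀ z ∈ D, ρ z = HartogsL2.realPart D ρ z := fun z hz =>
    HartogsL2.coe_realPart hρ hM hz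
  rw [hcoe w (hUD hw)]
  refine (HartogsL2.isSub_realPart hρ hM).uscReg_rhoTilde hDconn.isPreconnected hcoe hUopen hUD
    (fun z hz => ?_) ?_ hw
  · rw [← EReal.coe_eq_coe_iff, ← hcoe z (hUD hz), ← hcoe w (hUD hw), hconst z hz, hconst w hw]
  · by_contra! hall
    exact hnotconst ⟨_, fun z hz => by rw [hcoe z hz, hall z hz]⟩
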